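/- Generalized MacMahon's formula (Macdonald's case, full version): ∑_{π ∈ P} F_π(q,t) s^{|π|} = ∏_{n=1}^{∞} [ (t s^n; q)_∞ / (s^n; q)_∞ ]^n, where the sum is over all plane partitions, as an identity of formal power series in s whose coefficients are rational functions of q and t (equivalently, for real parameters 0 ≤ q, t, s < 1 with s < 1 strictly). -/

import Mathlib

open scoped BigOperators

/-- A plane partition: a filling of a Young diagram (its support) with positive
integers that are weakly decreasing along rows and columns.  Entries outside
the support are recorded as `0`, and rows and columns are indexed from `0`
(so box `(i, j)` is box `(i+1, j+1)` in the 1-indexed convention). -/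
structure PlanePartition where
  part : ℕ → ℕ → ℕ
  row_decr : ∀ i j, part i (j + 1) ≤ part i j
  col_decr : ∀ i j, part (i + 1) j ≤ part i j
  finite_supp : {p : ℕ × ℕ | part p.1 p.2 ≠ 0}.Finite

namespace PlanePartition

/-- The weight `|π|`: the sum of all entries of `π`. -/
noncomputable def weight (π : PlanePartition) : ℕ := ∑ᶠ p : ℕ × ℕ, π.part p.1 p.2

/-- The trace `tr(π)`: the sum of the diagonal entries of `π`. -/
noncomputable def trace (π : PlanePartition) : ℕ := ∑ᶠ i : ℕ, π.part i i

/-- A strict plane partition: all of the diagonal partitions of `π` have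
distinct parts, i.e. every diagonal of `π` is strictly decreasing where
nonzero. -/
def IsStrict (π : PlanePartition) : Prop :=
  ∀ i j, π.part i j ≠ 0 → π.part (i + 1) (j + 1) < π.part i j

end PlanePartition

/-- Two boxes of `ℕ × ℕ` are adjacent when they share an edge. -/
def Adjacent (p q : ℕ × ℕ) : Prop :=
  (p.1 = q.1 ∧ (p.2 + 1 = q.2 ∨ q.2 + 1 = p.2)) ∨
  (p.2 = q.2 ∧ (p.1 + 1 = q.1 ∨ q.1 + 1 = p.1))

/-- One step of connectivity for a filling `g` of boxes by natural numbers: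
adjacent boxes carrying the same nonzero entry. -/
def ConnStep (g : ℕ → ℕ → ℕ) (p q : ℕ × ℕ) : Prop :=
  Adjacent p q ∧ g p.1 p.2 = g q.1 q.2 ∧ g p.1 p.2 ≠ 0

/-- `p` and `q` belong to the same connected component of `g`: both are boxes
of the support and they are joined by a chain of adjacent boxes all filled
with the same number. -/
def SameComponent (g : ℕ → ℕ → ℕ) (p q : ℕ × ℕ) : Prop :=
  g p.1 p.2 ≠ 0 ∧ Relation.ReflTransGen (ConnStep g) p q

/-- The set of connected components of a filling `g`. -/
def components (g : ℕ → ℕ → ℕ) : Set (Set (ℕ × ℕ)) :=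
  {C | ∃ p : ℕ × ℕ, g p.1 p.2 ≠ 0 ∧ C = {q | SameComponent g p q}}

/-- `k(g)`: the number of connected components. -/
noncomputable def numComponents (g : ℕ → ℕ → ℕ) : ℕ := (components g).ncard

/-- The level `h(p)` of a box `p`: the smallest positive `h` such that the box
shifted diagonally by `h` does not belong to the same connected component. -/
noncomputable def level (g : ℕ → ℕ → ℕ) (p : ℕ × ℕ) : ℕ :=
  sInf {h : ℕ | 0 < h ∧ ¬ SameComponent g p (p.1 + h, p.2 + h)}

/-- One step of border connectivity: adjacent boxes with the same nonzero
entry and the same level. -/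
def BorderStep (g : ℕ → ℕ → ℕ) (p q : ℕ × ℕ) : Prop :=
  ConnStep g p q ∧ level g p = level g q

/-- `p` and `q` belong to the same border component. -/
def SameBorder (g : ℕ → ℕ → ℕ) (p q : ℕ × ℕ) : Prop :=
  g p.1 p.2 ≠ 0 ∧ Relation.ReflTransGen (BorderStep g) p q

/-- The set of border components of a filling `g` (each border component is a
maximal connected set of boxes with the same entry and the same level). -/
def borderComponents (g : ℕ → ℕ → ℕ) : Set (Set (ℕ × ℕ)) :=
  {B | ∃ p : ℕ × ℕ, g p.1 p.2 ≠ 0 ∧ B = {q | SameBorder g p q}}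

/-- The (common) level of the boxes of a border component `B`. -/
noncomputable def borderLevel (g : ℕ → ℕ → ℕ) (B : Set (ℕ × ℕ)) : ℕ :=
  sInf {h : ℕ | ∃ p ∈ B, level g p = h}

/-- The polynomial `A_π(t)`: the product over all border components `B` of
`π` of `(1 - t ^ level(B))`; equivalently the product over connected
components `C` of `P_C(t) = ∏_i (1 - t^i)^{n_i}` where `n_i` is the number of
`i`-level border components of `C`. -/
noncomputable def Apoly (t : ℝ) (π : PlanePartition) : ℝ :=
  ∏ᶠ B ∈ borderComponents π.part, (1 - t ^ borderLevel π.part B)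

/-- The function `f(n, m)` (for parameters `q`, `t`); the empty product gives
`f(0, m) = 1`. -/
noncomputable def fmac (q t : ℝ) (n m : ℕ) : ℝ :=
  ∏ i ∈ Finset.range n, (1 - q ^ i * t ^ (m + 1)) / (1 - q ^ (i + 1) * t ^ m)

/-- `F_π(i,j)(q,t)`, associated to the box `(i, j)` of `π`: with
`λ = (π(i,j), π(i+1,j+1), …)`, `μ = (π(i+1,j), π(i+2,j+1), …)` and
`ν = (π(i,j+1), π(i+1,j+2), …)`, this is
`∏_{m ≥ 0} f(λ₁-μ_{m+1},m) f(λ₁-ν_{m+1},m) / (f(λ₁-λ_{m+1},m) f(λ₁-λ_{m+2},m))`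
(only finitely many factors differ from `1`). -/
noncomputable def Fbox (q t : ℝ) (π : PlanePartition) (i j : ℕ) : ℝ :=
  ∏' m : ℕ,
    (fmac q t (π.part i j - π.part (i + 1 + m) (j + m)) m *
        fmac q t (π.part i j - π.part (i + m) (j + 1 + m)) m) /
      (fmac q t (π.part i j - π.part (i + m) (j + m)) m *
        fmac q t (π.part i j - π.part (i + m + 1) (j + m + 1)) m)

/-- `F_π(q,t)`: the product of `F_π(i,j)(q,t)` over all boxes `(i,j)` of the
support of `π`. -/
noncomputable def Fmac (q t : ℝ) (π : PlanePartition) : ℝ :=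
  ∏ᶠ p : ℕ × ℕ, if π.part p.1 p.2 ≠ 0 then Fbox q t π p.1 p.2 else 1

/-- The infinite `q`-Pochhammer symbol `(x; q)_∞ = ∏_{n ≥ 0} (1 - x qⁿ)`. -/
noncomputable def qPoch (x q : ℝ) : ℝ := ∏' n : ℕ, (1 - x * q ^ n)

/-- The Vandermonde product `∏_{i<j} (v j - v i)`. -/
def vprod {n : ℕ} (v : Fin n → ℝ) : ℝ := ∏ i, ∏ j ∈ Finset.Ioi i, (v j - v i)

theorem prod_erase_sub_eq_vprod_sq {n : ℕ} (m : Fin n → ℝ) :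
    ∏ j, ∏ k ∈ Finset.univ.erase j, (m j - m k) =
      (∏ i : Fin n, ∏ _j ∈ Finset.Ioi i, (-1 : ℝ)) * (vprod m * vprod m) := by
  have h1 : ∀ j : Fin n, Finset.univ.erase j = Finset.Iio j ∪ Finset.Ioi j := by
    intro j; ext k; simp [lt_or_lt_iff_ne]
  have h2 : ∀ j : Fin n, Disjoint (Finset.Iio j) (Finset.Ioi j) := by
    intro j
    rw [Finset.disjoint_left]
    intro a ha hb
    simp at ha hb
    exact absurd ha (not_lt.2 hb.le)
  simp_rw [h1, Finset.prod_union (h2 _), Finset.prod_mul_distrib]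
  have h3 : ∏ x : Fin n, ∏ x_1 ∈ Finset.Iio x, (m x - m x_1) = vprod m := by
    unfold vprod
    rw [Finset.prod_sigma', Finset.prod_sigma']
    refine Finset.prod_bij' (fun a _ => ⟨a.2, a.1⟩) (fun a _ => ⟨a.2, a.1⟩) ?_ ?_ ?_ ?_ ?_ <;> simp
  have h4 : ∏ x : Fin n, ∏ x_1 ∈ Finset.Ioi x, (m x - m x_1) =
      (∏ i : Fin n, ∏ _j ∈ Finset.Ioi i, (-1 : ℝ)) * vprod m := by
    unfold vprod
    rw [← Finset.prod_mul_distrib]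
    refine Finset.prod_congr rfl fun i _ => ?_
    rw [← Finset.prod_mul_distrib]
    exact Finset.prod_congr rfl fun j _ => by ring
  rw [h3, h4]
  ring

/-- The numerator form of the Cauchy determinant. -/
theorem det_prod_erase_sub {n : ℕ} (y m : Fin n → ℝ) :
    (Matrix.of fun i j => ∏ k ∈ Finset.univ.erase j, (y i - m k)).det =
      (∏ i : Fin n, ∏ _j ∈ Finset.Ioi i, (-1 : ℝ)) * (vprod y * vprod m) := by
  by_cases hm : Function.Injective m
  swap
  · have h0 : vprod m = 0 := by
      rw [vprod, ← Matrix.det_vandermonde]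
      exact not_not.1 (mt Matrix.det_vandermonde_ne_zero_iff.1 hm)
    rw [h0]
    simp only [Function.Injective, not_forall] at hm
    obtain ⟨a, b, hab, hne⟩ := hm
    rw [Matrix.det_zero_of_column_eq hne]
    · simp
    · intro i
      simp only [Matrix.of_apply]
      rw [← Finset.mul_prod_erase _ _ (Finset.mem_erase.2 ⟨Ne.symm hne, Finset.mem_univ b⟩),
        ← Finset.mul_prod_erase (Finset.univ.erase b) _
          (Finset.mem_erase.2 ⟨hne, Finset.mem_univ a⟩), hab, Finset.erase_right_comm]
  · have hv : vprod m ≠ 0 := by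
      rw [vprod, ← Matrix.det_vandermonde]
      exact Matrix.det_vandermonde_ne_zero_iff.2 hm
    let p : Fin n → Polynomial ℝ := fun j =>
      ∏ k ∈ Finset.univ.erase j, (Polynomial.X - Polynomial.C (m k))
    have hp : ∀ j x, (p j).eval x = ∏ k ∈ Finset.univ.erase j, (x - m k) := by
      intro j x
      simp [p, Polynomial.eval_prod]
    have hdeg : ∀ j, (p j).natDegree < n := by
      intro j
      have := Polynomial.natDegree_prod_of_monic (Finset.univ.erase j)
        (fun k => Polynomial.X - Polynomial.C (m k)) (fun k _ => Polynomial.monic_X_sub_C _)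
      simp only [p]
      rw [this]
      simp
      exact Fin.pos j
    have hmat : ∀ x : Fin n → ℝ,
        (Matrix.of fun i j => ∏ k ∈ Finset.univ.erase j, (x i - m k)) =
        Matrix.vandermonde x * Matrix.of fun (k : Fin n) j => (p j).coeff k := by
      intro x
      ext i j
      rw [Matrix.of_apply, ← hp, Polynomial.eval_eq_sum_range' (hdeg j), Matrix.mul_apply,
        Finset.sum_range]
      exact Finset.sum_congr rfl fun k _ => by
        rw [Matrix.vandermonde_apply, Matrix.of_apply, mul_comm]
    have hdet : ∀ x : Fin n → ℝ,
        (Matrix.of fun i j => ∏ k ∈ Finset.univ.erase j, (x i - m k)).det =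
        vprod x * (Matrix.of fun (k : Fin n) j => (p j).coeff k).det := by
      intro x
      rw [hmat, Matrix.det_mul, Matrix.det_vandermonde, vprod]
    have hdiag : (Matrix.of fun i j => ∏ k ∈ Finset.univ.erase j, (m i - m k)) =
        Matrix.diagonal fun j => ∏ k ∈ Finset.univ.erase j, (m j - m k) := by
      ext i j
      rw [Matrix.of_apply, Matrix.diagonal_apply]
      split_ifs with h
      · rw [h]
      · exact Finset.prod_eq_zero (Finset.mem_erase.2 ⟨h, Finset.mem_univ i⟩) (sub_self _)
    have hd := hdet m
    rw [hdiag, Matrix.det_diagonal, prod_erase_sub_eq_vprod_sq] at hd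
    have : (Matrix.of fun (k : Fin n) j => (p j).coeff k).det =
        (∏ i : Fin n, ∏ _j ∈ Finset.Ioi i, (-1 : ℝ)) * vprod m := by
      apply mul_left_cancel₀ hv
      rw [← hd]; ring
    rw [hdet, this]; ring

theorem sign_prod_ne_zero (n : ℕ) : (∏ i : Fin n, ∏ _j ∈ Finset.Ioi i, (-1 : ℝ)) ≠ 0 :=
  Finset.prod_ne_zero_iff.2 fun _ _ => Finset.prod_ne_zero_iff.2 fun _ _ => by norm_num

/-- The cleared form of the matrix `1 / (y i - m j) + v / (y i - τ m j)`. -/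
noncomputable def twoTermMatrix {n : ℕ} (τ v : ℝ) (y m : Fin n → ℝ) : Matrix (Fin n) (Fin n) ℝ :=
  Matrix.of fun i j =>
    (∏ k, (y i - τ * m k)) * (∏ k ∈ Finset.univ.erase j, (y i - m k)) +
      v * ((∏ k, (y i - m k)) * ∏ k ∈ Finset.univ.erase j, (y i - τ * m k))

theorem det_twoTermMatrix_rows {n : ℕ} {τ : ℝ} (hτ : τ ≠ 0) (v : ℝ) (y m : Fin n → ℝ) :
    (twoTermMatrix τ v y m).det = (∏ i : Fin n, ∏ _j ∈ Finset.Ioi i, (-1 : ℝ)) *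
      ∑ ε : Fin n → Bool,
        (∏ i, if ε i then v * τ ^ (n - 1) * ∏ k, (y i - m k) else ∏ k, (y i - τ * m k)) *
          (vprod (fun i => if ε i then y i / τ else y i) * vprod m) := by
  let g : Fin n → Bool → (Fin n → ℝ) := fun i b =>
    (if b then v * τ ^ (n - 1) * ∏ k, (y i - m k) else ∏ k, (y i - τ * m k)) •
      fun j => ∏ k ∈ Finset.univ.erase j, ((if b then y i / τ else y i) - m k)
  have hM : twoTermMatrix τ v y m = fun i => ∑ b, g i b := by
    ext i j
    have h : ∏ k ∈ Finset.univ.erase j, (y i - τ * m k) =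
        τ ^ (n - 1) * ∏ k ∈ Finset.univ.erase j, (y i / τ - m k) := by
      have hc : (Finset.univ.erase j).card = n - 1 := by simp
      rw [← hc, ← Finset.prod_const, ← Finset.prod_mul_distrib]
      refine Finset.prod_congr rfl fun k _ => ?_
      field_simp
    simp only [twoTermMatrix, Matrix.of_apply, Fintype.sum_bool, Pi.add_apply, g, Pi.smul_apply,
      smul_eq_mul, h]
    simp
    ring
  let D : MultilinearMap ℝ (fun _ : Fin n => Fin n → ℝ) ℝ :=
    (Matrix.detRowAlternating (n := Fin n) (R := ℝ)).toMultilinearMap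
  have hsum : (twoTermMatrix τ v y m).det = ∑ ε : Fin n → Bool, D fun i => g i (ε i) := by
    rw [hM]
    exact D.map_sum g
  rw [hsum, Finset.mul_sum]
  refine Finset.sum_congr rfl fun ε _ => ?_
  have hD : D (fun i j => ∏ k ∈ Finset.univ.erase j, ((if ε i then y i / τ else y i) - m k)) = _ :=
    det_prod_erase_sub (fun i => if ε i then y i / τ else y i) m
  simp only [g]
  rw [MultilinearMap.map_smul_univ, smul_eq_mul, hD]
  ring

theorem det_twoTermMatrix_cols {n : ℕ} (τ v : ℝ) (y m : Fin n → ℝ) :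
    (twoTermMatrix τ v y m).det = (∏ i : Fin n, ∏ _j ∈ Finset.Ioi i, (-1 : ℝ)) *
      ∑ ε : Fin n → Bool,
        (∏ j, if ε j then v * ∏ i, (y i - m j) else ∏ i, (y i - τ * m j)) *
          (vprod y * vprod (fun j => if ε j then τ * m j else m j)) := by
  let g : Fin n → Bool → (Fin n → ℝ) := fun j b => fun i =>
    if b then v * ((∏ k, (y i - m k)) * ∏ k ∈ Finset.univ.erase j, (y i - τ * m k))
    else (∏ k, (y i - τ * m k)) * (∏ k ∈ Finset.univ.erase j, (y i - m k))
  have hM : (twoTermMatrix τ v y m).transpose = fun j => ∑ b, g j b := by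
    ext j i
    simp [twoTermMatrix, g]
    ring
  have hsum : (twoTermMatrix τ v y m).det =
      ∑ ε : Fin n → Bool, (Matrix.of fun j => g j (ε j)).det := by
    rw [← Matrix.det_transpose, hM]
    exact (Matrix.detRowAlternating (n := Fin n) (R := ℝ)).toMultilinearMap.map_sum g
  rw [hsum, Finset.mul_sum]
  refine Finset.sum_congr rfl fun ε _ => ?_
  rw [← Matrix.det_transpose]
  let mε : Fin n → ℝ := fun j => if ε j then τ * m j else m j
  let mc : Fin n → ℝ := fun j => if ε j then m j else τ * m j
  have hsplit : (Matrix.of fun j => g j (ε j)).transpose = Matrix.of fun i j =>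
      ((∏ k, (y i - mc k)) * (if ε j then v else 1)) *
        (Matrix.of fun i j => ∏ k ∈ Finset.univ.erase j, (y i - mε k)) i j := by
    ext i j
    simp only [Matrix.transpose_apply, Matrix.of_apply, g]
    rw [← Finset.mul_prod_erase _ _ (Finset.mem_univ j),
      ← Finset.mul_prod_erase _ (fun k => y i - τ * m k) (Finset.mem_univ j),
      ← Finset.mul_prod_erase _ (fun k => y i - mc k) (Finset.mem_univ j)]
    have hprod : (∏ k ∈ Finset.univ.erase j, (y i - m k)) *
          ∏ k ∈ Finset.univ.erase j, (y i - τ * m k) =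
        (∏ k ∈ Finset.univ.erase j, (y i - mc k)) *
          ∏ k ∈ Finset.univ.erase j, (y i - mε k) := by
      rw [← Finset.prod_mul_distrib, ← Finset.prod_mul_distrib]
      refine Finset.prod_congr rfl fun k _ => ?_
      simp only [mc, mε]
      split_ifs <;> ring
    by_cases hj : ε j
    · simp only [hj, if_true, mc]
      linear_combination v * (y i - m j) * hprod
    · simp only [hj, mc]
      simp only [Bool.false_eq_true, if_false]
      linear_combination (y i - τ * m j) * hprod
  have hfac : (Matrix.of fun i j =>
      ((∏ k, (y i - mc k)) * (if ε j then v else 1)) *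
        (Matrix.of fun i j => ∏ k ∈ Finset.univ.erase j, (y i - mε k)) i j).det =
      (∏ i, ∏ k, (y i - mc k)) * ((∏ j, if ε j then v else 1) *
        (Matrix.of fun i j => ∏ k ∈ Finset.univ.erase j, (y i - mε k)).det) := by
    rw [← Matrix.det_mul_row, ← Matrix.det_mul_column]
    congr 1
    ext i j
    simp only [Matrix.of_apply]
    ring
  rw [hsplit, hfac, det_prod_erase_sub, Finset.prod_comm]
  have : (∏ j, if ε j then v * ∏ i, (y i - m j) else ∏ i, (y i - τ * m j)) =
      (∏ j, ∏ i, (y i - mc j)) * ∏ j, if ε j then v else 1 := by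
    rw [← Finset.prod_mul_distrib]
    refine Finset.prod_congr rfl fun j _ => ?_
    simp only [mc]
    split_ifs <;> ring
  rw [this]
  ring

/-- Expanding one determinant along rows and along columns. -/
theorem rows_eq_cols {n : ℕ} {τ : ℝ} (hτ : τ ≠ 0) (v : ℝ) (y m : Fin n → ℝ) :
    ∑ ε : Fin n → Bool,
        (∏ i, if ε i then v * τ ^ (n - 1) * ∏ k, (y i - m k) else ∏ k, (y i - τ * m k)) *
          (vprod (fun i => if ε i then y i / τ else y i) * vprod m) =
      ∑ ε : Fin n → Bool,
        (∏ j, if ε j then v * ∏ i, (y i - m j) else ∏ i, (y i - τ * m j)) *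
          (vprod y * vprod (fun j => if ε j then τ * m j else m j)) :=
  mul_left_cancel₀ (sign_prod_ne_zero n)
    ((det_twoTermMatrix_rows hτ v y m).symm.trans (det_twoTermMatrix_cols τ v y m))

theorem vprod_cons {n : ℕ} (a : ℝ) (m : Fin n → ℝ) :
    vprod (Fin.cons a m : Fin (n + 1) → ℝ) = (∏ j, (m j - a)) * vprod m := by
  unfold vprod
  rw [Fin.prod_univ_succ]
  congr 1
  · simp
  · exact Finset.prod_congr rfl fun i _ => by simp [Fin.prod_Ioi_succ]

/-- The bordered form of `rows_eq_cols`, with one more row than columns. -/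
theorem rows_eq_cols_bordered {n : ℕ} {τ : ℝ} (hτ : τ ≠ 0) (v : ℝ) (y : Fin (n + 1) → ℝ)
    (m : Fin n → ℝ) (hy : ∀ i, y i ≠ 0) (hm : ∀ j, m j ≠ 0) :
    ∑ ε : Fin (n + 1) → Bool,
        (∏ i, if ε i then v * τ ^ n * ∏ k, (y i - m k) else ∏ k, (y i - τ * m k)) *
          (vprod (fun i => if ε i then y i / τ else y i) * vprod m) =
      (1 + v) * ∑ ε : Fin n → Bool,
        (∏ j, if ε j then v * τ * ∏ i, (y i - m j) else ∏ i, (y i - τ * m j)) *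
          (vprod y * vprod (fun j => if ε j then τ * m j else m j)) := by
  have hY : (∏ i, y i) ≠ 0 := Finset.prod_ne_zero_iff.2 fun i _ => hy i
  have hM : (∏ j, m j) ≠ 0 := Finset.prod_ne_zero_iff.2 fun i _ => hm i
  have key := rows_eq_cols hτ v y (Fin.cons 0 m)
  apply mul_left_cancel₀ (mul_ne_zero hY hM)
  convert key using 1
  · rw [Finset.mul_sum]
    refine Finset.sum_congr rfl fun ε _ => ?_
    rw [vprod_cons]
    have : (∏ i, if ε i then v * τ ^ (n + 1 - 1) * ∏ k, (y i - (Fin.cons 0 m : Fin (n + 1) → ℝ) k)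
          else ∏ k, (y i - τ * (Fin.cons 0 m : Fin (n + 1) → ℝ) k)) =
        (∏ i, y i) *
        ∏ i, if ε i then v * τ ^ n * ∏ k, (y i - m k) else ∏ k, (y i - τ * m k) := by
      rw [← Finset.prod_mul_distrib]
      refine Finset.prod_congr rfl fun i _ => ?_
      simp only [Fin.prod_univ_succ, Fin.cons_zero, Fin.cons_succ]
      split_ifs
      · simp; ring
      · simp
    rw [this]
    simp only [sub_zero]
    ring
  · rw [← (Fin.consEquiv fun _ => Bool).sum_comp, Fintype.sum_prod_type_right, Finset.mul_sum,
      Finset.mul_sum]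
    refine Finset.sum_congr rfl fun ε _ => ?_
    have hc : ∀ b : Bool, (fun j => if (Fin.cons b ε : Fin (n + 1) → Bool) j then
        τ * (Fin.cons 0 m : Fin (n + 1) → ℝ) j else (Fin.cons 0 m : Fin (n + 1) → ℝ) j) =
        (Fin.cons 0 (fun j => if ε j then τ * m j else m j) : Fin (n + 1) → ℝ) := by
      intro b
      ext j
      refine Fin.cases ?_ (fun j => ?_) j
      · simp
      · simp
    have hprod : (∏ j, (if ε j then τ * m j else m j)) =
        (∏ j, m j) * ∏ j, if ε j then τ else 1 := by
      rw [← Finset.prod_mul_distrib]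
      exact Finset.prod_congr rfl fun j _ => by split_ifs <;> ring
    have hprod2 : (∏ j, if ε j then v * τ * ∏ i, (y i - m j) else ∏ i, (y i - τ * m j)) =
        (∏ j, if ε j then τ else 1) *
          ∏ j, if ε j then v * ∏ i, (y i - m j) else ∏ i, (y i - τ * m j) := by
      rw [← Finset.prod_mul_distrib]
      exact Finset.prod_congr rfl fun j _ => by split_ifs <;> ring
    have hprod3 : ∀ b : Bool, (∏ j, if (Fin.cons b ε : Fin (n + 1) → Bool) j then
        v * ∏ i, (y i - (Fin.cons 0 m : Fin (n + 1) → ℝ) j)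
        else ∏ i, (y i - τ * (Fin.cons 0 m : Fin (n + 1) → ℝ) j)) =
        ((if b then v else 1) * ∏ i, y i) *
          ∏ j, if ε j then v * ∏ i, (y i - m j) else ∏ i, (y i - τ * m j) := by
      intro b
      rw [Fin.prod_univ_succ]
      cases b <;> simp
    simp only [Fin.consEquiv_apply, hc, hprod3, vprod_cons, sub_zero, hprod, hprod2,
      Fintype.sum_bool]
    simp only [if_true, Bool.false_eq_true, if_false]
    ring

/-- The two special values of the parameter at which the determinant factors. -/
theorem rows_wronski {n : ℕ} {τ : ℝ} (hτ : τ ≠ 0) (y m : Fin n → ℝ) (hm : vprod m ≠ 0) :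
    ∑ ε : Fin n → Bool,
        ((∏ i, y i) * (∏ i, if ε i then -1 else 1) - (∏ i, m i) * ∏ i, if ε i then -τ else 1) *
        ((∏ i, if ε i then τ ^ (n - 1) * ∏ k, (y i - m k) else ∏ k, (y i - τ * m k)) *
          vprod (fun i => if ε i then y i / τ else y i)) = 0 := by
  let C : Matrix (Fin n) (Fin n) ℝ := Matrix.of fun i j => (1 - τ) *
    ((∏ k ∈ Finset.univ.erase j, (y i - m k)) * ∏ k ∈ Finset.univ.erase j, (y i - τ * m k))
  have h1 : (twoTermMatrix τ (-1) y m).det = (∏ j, m j) * C.det := by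
    rw [← Matrix.det_mul_row]
    congr 1
    ext i j
    simp only [twoTermMatrix, C, Matrix.of_apply]
    rw [← Finset.mul_prod_erase _ _ (Finset.mem_univ j),
      ← Finset.mul_prod_erase _ (fun k => y i - m k) (Finset.mem_univ j)]
    ring
  have h2 : (twoTermMatrix τ (-τ) y m).det = (∏ j, y j) * C.det := by
    rw [← Matrix.det_mul_column]
    congr 1
    ext i j
    simp only [twoTermMatrix, C, Matrix.of_apply]
    rw [← Finset.mul_prod_erase _ _ (Finset.mem_univ j),
      ← Finset.mul_prod_erase _ (fun k => y i - m k) (Finset.mem_univ j)]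
    ring
  have h3 : (∏ j, y j) * (twoTermMatrix τ (-1) y m).det -
      (∏ j, m j) * (twoTermMatrix τ (-τ) y m).det = 0 := by rw [h1, h2]; ring
  rw [det_twoTermMatrix_rows hτ, det_twoTermMatrix_rows hτ] at h3
  have hs := sign_prod_ne_zero n
  apply mul_left_cancel₀ (mul_ne_zero hs hm)
  rw [mul_zero, ← h3, Finset.mul_sum, Finset.mul_sum, Finset.mul_sum, Finset.mul_sum,
    Finset.mul_sum, ← Finset.sum_sub_distrib]
  refine Finset.sum_congr rfl fun ε _ => ?_
  have h4 : ∀ v : ℝ, (∏ i, if ε i then v * τ ^ (n - 1) * ∏ k, (y i - m k)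
      else ∏ k, (y i - τ * m k)) = (∏ i, if ε i then v else 1) *
      ∏ i, if ε i then τ ^ (n - 1) * ∏ k, (y i - m k) else ∏ k, (y i - τ * m k) := by
    intro v
    rw [← Finset.prod_mul_distrib]
    exact Finset.prod_congr rfl fun j _ => by split_ifs <;> ring
  rw [h4, h4]
  ring

/-- Partitions, as weakly decreasing finitely supported sequences. -/
abbrev Partn := {f : ℕ →₀ ℕ // Antitone f}

namespace Partn

instance : CoeFun Partn fun _ => ℕ → ℕ := ⟨fun a => a.1⟩

theorem anti (a : Partn) : Antitone (a : ℕ → ℕ) := a.2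

/-- The sum of the parts. -/
def size (a : Partn) : ℕ := a.1.sum fun _ x => x

theorem eq_zero_of_le (a : Partn) {m n : ℕ} (h : a m = 0) (hmn : m ≤ n) : a n = 0 :=
  Nat.le_zero.1 (h ▸ a.anti hmn)

theorem support_subset (a : Partn) {N : ℕ} (h : a N = 0) : a.1.support ⊆ Finset.range N := by
  intro i hi
  rw [Finset.mem_range]
  by_contra! hN
  exact Finsupp.mem_support_iff.1 hi (a.eq_zero_of_le h hN)

theorem size_eq (a : Partn) {N : ℕ} (h : a N = 0) : a.size = ∑ i ∈ Finset.range N, a i :=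
  Finsupp.sum_of_support_subset _ (a.support_subset h) _ fun _ _ => rfl

theorem exists_bound (a : Partn) : ∃ N, a N = 0 := by
  obtain ⟨N, hN⟩ := Infinite.exists_notMem_finset a.1.support
  exact ⟨N, Finsupp.notMem_support_iff.1 hN⟩

theorem apply_size (a : Partn) : a a.size = 0 := by
  by_contra h
  obtain ⟨N, hN⟩ := a.exists_bound
  have hlt : a.size < N := by
    by_contra! h'
    exact h (a.eq_zero_of_le hN h')
  have h1 : ∑ i ∈ Finset.range (a.size + 1), 1 ≤ ∑ i ∈ Finset.range (a.size + 1), a i :=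
    Finset.sum_le_sum fun i hi =>
      (Nat.pos_of_ne_zero h).trans_le (a.anti (Nat.lt_succ_iff.1 (Finset.mem_range.1 hi)))
  have h2 : ∑ i ∈ Finset.range (a.size + 1), a i ≤ ∑ i ∈ Finset.range N, a i :=
    Finset.sum_le_sum_of_subset (Finset.range_mono hlt)
  rw [← a.size_eq hN] at h2
  simp at h1
  omega

/-- The partitions of a given integer. -/
noncomputable def ofSize (k : ℤ) : Finset Partn :=
  open Classical in
  if 0 ≤ k then Finset.subtype (fun f : ℕ →₀ ℕ => Antitone f)
    (Finset.finsuppAntidiag (Finset.range k.toNat) k.toNat) else ∅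

@[simp]
theorem mem_ofSize {k : ℤ} {a : Partn} : a ∈ ofSize k ↔ (a.size : ℤ) = k := by
  classical
  unfold ofSize
  split_ifs with hk
  · lift k to ℕ using hk
    rw [Finset.mem_subtype, Finset.mem_finsuppAntidiag, Int.toNat_natCast, Nat.cast_inj]
    constructor
    · rintro ⟨h1, h2⟩
      rw [← h1, size, Finsupp.sum_of_support_subset _ h2 _ fun _ _ => rfl]
    · intro h
      have h0 : a k = 0 := h ▸ a.apply_size
      exact ⟨by rw [← h, ← a.size_eq a.apply_size], a.support_subset h0⟩
  · simp
    omega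

/-- The interlacing relation `a₀ ≥ b₀ ≥ a₁ ≥ b₁ ≥ ⋯`. -/
def Interlace (a b : Partn) : Prop := ∀ i, b i ≤ a i ∧ a (i + 1) ≤ b i

/-- `a / b` is a vertical strip. -/
def VertStrip (a b : Partn) : Prop := ∀ i, b i ≤ a i ∧ a i ≤ b i + 1

end Partn

section weights

variable (q t : ℝ)

open scoped Classical in
/-- The one-variable skew `Q`-function coefficient of a horizontal strip. -/
noncomputable def phiCoeff (a b : Partn) : ℝ :=
  if a.Interlace b then ∏ j ∈ a.1.support, ∏ i ∈ Finset.range (j + 1),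
    fmac q t (a i - b j) (j - i) * fmac q t (b i - a (j + 1)) (j - i) /
      (fmac q t (a i - a j) (j - i) * fmac q t (b i - b (j + 1)) (j - i)) else 0

open scoped Classical in
/-- The one-variable skew `P`-function coefficient of a horizontal strip. -/
noncomputable def psiCoeff (a b : Partn) : ℝ :=
  if a.Interlace b then ∏ j ∈ a.1.support, ∏ i ∈ Finset.range (j + 1),
    fmac q t (a i - b j) (j - i) * fmac q t (b i - a (j + 1)) (j - i) /
      (fmac q t (b i - b j) (j - i) * fmac q t (a i - a (j + 1)) (j - i)) else 0

/-- One factor of the Pieri coefficient of a vertical strip. -/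
noncomputable def pieriFactor (y : ℝ) : ℝ :=
  (1 - y / t) * (1 - t * y / q) / ((1 - y) * (1 - y / q))

open scoped Classical in
/-- The Pieri coefficient of a vertical strip. -/
noncomputable def pieriCoeff (a b : Partn) : ℝ :=
  if a.VertStrip b then ∏ j ∈ a.1.support, ∏ i ∈ Finset.range j,
    (if a i = b i ∧ a j = b j + 1 then pieriFactor q t (q ^ (b i - b j) * t ^ (j - i)) else 1)
  else 0

variable {q t : ℝ}

theorem fmac_zero (m : ℕ) : fmac q t 0 m = 1 := by simp [fmac]

theorem fmac_pos (hq0 : 0 ≤ q) (hq1 : q < 1) (ht0 : 0 ≤ t) (ht1 : t < 1) (n m : ℕ) :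
    0 < fmac q t n m := by
  refine Finset.prod_pos fun i _ => div_pos ?_ ?_
  · have h1 : q ^ i ≤ 1 := pow_le_one₀ hq0 hq1.le
    have h2 : t ^ (m + 1) < 1 := pow_lt_one₀ ht0 ht1 (Nat.succ_ne_zero m)
    have h3 : q ^ i * t ^ (m + 1) ≤ 1 * t ^ (m + 1) := by gcongr
    linarith
  · have h1 : q ^ (i + 1) < 1 := pow_lt_one₀ hq0 hq1 (Nat.succ_ne_zero i)
    have h2 : t ^ m ≤ 1 := pow_le_one₀ ht0 ht1.le
    have h3 : q ^ (i + 1) * t ^ m ≤ q ^ (i + 1) * 1 := by gcongr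
    linarith

theorem phiCoeff_eq (hq0 : 0 ≤ q) (hq1 : q < 1) (ht0 : 0 ≤ t) (ht1 : t < 1) {a b : Partn}
    (h : a.Interlace b) {N : ℕ} (hN : a N = 0) :
    phiCoeff q t a b = ∏ j ∈ Finset.range N, ∏ i ∈ Finset.range (j + 1),
      fmac q t (a i - b j) (j - i) * fmac q t (b i - a (j + 1)) (j - i) /
        (fmac q t (a i - a j) (j - i) * fmac q t (b i - b (j + 1)) (j - i)) := by
  rw [phiCoeff, if_pos h]
  refine Finset.prod_subset (a.support_subset hN) fun j _ hj => Finset.prod_eq_one fun i _ => ?_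
  have h0 : a j = 0 := Finsupp.notMem_support_iff.1 hj
  have h1 : a (j + 1) = 0 := a.eq_zero_of_le h0 (Nat.le_succ j)
  have h2 : b j = 0 := Nat.le_zero.1 (h0 ▸ (h j).1)
  have h3 : b (j + 1) = 0 := b.eq_zero_of_le h2 (Nat.le_succ j)
  rw [h0, h1, h2, h3]
  exact div_self (mul_pos (fmac_pos hq0 hq1 ht0 ht1 _ _) (fmac_pos hq0 hq1 ht0 ht1 _ _)).ne'

theorem psiCoeff_eq (hq0 : 0 ≤ q) (hq1 : q < 1) (ht0 : 0 ≤ t) (ht1 : t < 1) {a b : Partn}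
    (h : a.Interlace b) {N : ℕ} (hN : a (N + 1) = 0) (hN' : b N = 0) :
    psiCoeff q t a b = ∏ j ∈ Finset.range N, ∏ i ∈ Finset.range (j + 1),
      fmac q t (a i - b j) (j - i) * fmac q t (b i - a (j + 1)) (j - i) /
        (fmac q t (b i - b j) (j - i) * fmac q t (a i - a (j + 1)) (j - i)) := by
  have key : ∀ j, a (j + 1) = 0 → b j = 0 → ∏ i ∈ Finset.range (j + 1),
      fmac q t (a i - b j) (j - i) * fmac q t (b i - a (j + 1)) (j - i) /
        (fmac q t (b i - b j) (j - i) * fmac q t (a i - a (j + 1)) (j - i)) = 1 := by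
    intro j h1 h2
    refine Finset.prod_eq_one fun i _ => ?_
    rw [h1, h2, mul_comm]
    exact div_self (mul_pos (fmac_pos hq0 hq1 ht0 ht1 _ _) (fmac_pos hq0 hq1 ht0 ht1 _ _)).ne'
  have h1 : psiCoeff q t a b = ∏ j ∈ Finset.range (N + 1), ∏ i ∈ Finset.range (j + 1),
      fmac q t (a i - b j) (j - i) * fmac q t (b i - a (j + 1)) (j - i) /
        (fmac q t (b i - b j) (j - i) * fmac q t (a i - a (j + 1)) (j - i)) := by
    rw [psiCoeff, if_pos h]
    refine Finset.prod_subset (a.support_subset hN) fun j _ hj => ?_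
    have h0 : a j = 0 := Finsupp.notMem_support_iff.1 hj
    exact key j (a.eq_zero_of_le h0 (Nat.le_succ j)) (Nat.le_zero.1 (h0 ▸ (h j).1))
  rw [h1, Finset.prod_range_succ, key N hN hN', mul_one]

theorem pieriCoeff_eq {a b : Partn} (h : a.VertStrip b) {N : ℕ} (hN : a N = 0) :
    pieriCoeff q t a b = ∏ j ∈ Finset.range N, ∏ i ∈ Finset.range j,
      (if a i = b i ∧ a j = b j + 1 then
        pieriFactor q t (q ^ (b i - b j) * t ^ (j - i)) else 1) := by
  rw [pieriCoeff, if_pos h]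
  refine Finset.prod_subset (a.support_subset hN) fun j _ hj => Finset.prod_eq_one fun i _ => ?_
  have h0 : a j = 0 := Finsupp.notMem_support_iff.1 hj
  rw [if_neg]
  omega

end weights

/-- Parameters at which no denominator below vanishes. -/
structure Generic (q t : ℝ) : Prop where
  q_pos : 0 < q
  q_lt : q < 1
  t_pos : 0 < t
  t_lt : t < 1
  ne : ∀ a b : ℕ, t ^ (a + 1) ≠ q ^ (b + 1)

namespace Generic

variable {q t : ℝ}

theorem sub_ne (h : Generic q t) (x : ℤ) (y : ℕ) : 1 - q ^ x * t ^ (y + 1) ≠ 0 := by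
  intro h0
  have h1 : q ^ x * t ^ (y + 1) = 1 := by linarith
  have hq := h.q_pos
  rcases le_or_gt 0 x with hx | hx
  · lift x to ℕ using hx
    rw [zpow_natCast] at h1
    have h2 : t ^ (y + 1) < 1 := pow_lt_one₀ h.t_pos.le h.t_lt (Nat.succ_ne_zero y)
    have h3 : q ^ x ≤ 1 := pow_le_one₀ hq.le h.q_lt.le
    have h4 : 0 < t ^ (y + 1) := pow_pos h.t_pos _
    nlinarith
  · obtain ⟨b, rfl⟩ : ∃ b : ℕ, x = -((b + 1 : ℕ) : ℤ) := ⟨(-x).toNat - 1, by omega⟩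
    rw [zpow_neg, zpow_natCast] at h1
    have := pow_pos hq (b + 1)
    field_simp at h1
    exact h.ne _ _ h1

theorem sub_ne' (h : Generic q t) (x : ℕ) : 1 - q ^ (x + 1) ≠ 0 := by
  have := pow_lt_one₀ h.q_pos.le h.q_lt (Nat.succ_ne_zero x)
  exact (sub_pos.2 this).ne'

end Generic

/-- The extension of `fmac` to all integers `n`, satisfying the same recursion in `n`. -/
noncomputable def fmacInt (q t : ℝ) (n : ℤ) (m : ℕ) : ℝ :=
  if 0 ≤ n then fmac q t n.toNat m else
    ∏ i ∈ Finset.range (-n).toNat,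
      (1 - q ^ (-(i : ℤ)) * t ^ m) / (1 - q ^ (-((i : ℤ) + 1)) * t ^ (m + 1))

section

variable {q t : ℝ}

theorem fmacInt_natCast (n m : ℕ) : fmacInt q t n m = fmac q t n m := by simp [fmacInt]

theorem fmacInt_sub {a b : ℕ} (h : b ≤ a) (m : ℕ) :
    fmacInt q t ((a : ℤ) - b) m = fmac q t (a - b) m := by
  rw [← Nat.cast_sub h, fmacInt_natCast]

theorem fmacInt_neg_zero {n : ℤ} (h : n < 0) : fmacInt q t n 0 = 0 := by
  rw [fmacInt, if_neg (not_le.2 h)]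
  exact Finset.prod_eq_zero (i := 0) (by simp; omega) (by simp)

theorem fmac_succ (n m : ℕ) : fmac q t (n + 1) m =
    fmac q t n m * ((1 - q ^ n * t ^ (m + 1)) / (1 - q ^ (n + 1) * t ^ m)) :=
  Finset.prod_range_succ _ _

theorem Generic.den_ne (h : Generic q t) (n m : ℕ) : 1 - q ^ (n + 1) * t ^ m ≠ 0 := by
  cases m with
  | zero => simpa using h.sub_ne' n
  | succ m => exact_mod_cast h.sub_ne (n + 1 : ℕ) m

theorem fmacInt_succ (h : Generic q t) (n : ℤ) (m : ℕ) :
    fmacInt q t (n + 1) m * (1 - q ^ (n + 1) * t ^ m) =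
      fmacInt q t n m * (1 - q ^ n * t ^ (m + 1)) := by
  rcases le_or_gt 0 n with hn | hn
  · lift n to ℕ using hn
    have h1 : ((n : ℤ) + 1) = ((n + 1 : ℕ) : ℤ) := by push_cast; ring
    rw [h1, fmacInt_natCast, fmacInt_natCast, fmac_succ, zpow_natCast, zpow_natCast]
    have := h.den_ne n m
    field_simp
  · obtain ⟨b, rfl⟩ : ∃ b : ℕ, n = -((b : ℤ) + 1) := ⟨(-n).toNat - 1, by omega⟩
    have h1 : -((b : ℤ) + 1) + 1 = -(b : ℤ) := by ring
    have h2 : fmacInt q t (-(b : ℤ)) m = ∏ i ∈ Finset.range b,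
      (1 - q ^ (-(i : ℤ)) * t ^ m) / (1 - q ^ (-((i : ℤ) + 1)) * t ^ (m + 1)) := by
      rw [fmacInt]
      split_ifs with h0
      · obtain rfl : b = 0 := by omega
        simp [fmac]
      · simp
    rw [h1, h2, fmacInt, if_neg (by omega), show (-(-((b : ℤ) + 1))).toNat = b + 1 by omega,
      Finset.prod_range_succ]
    have := h.sub_ne (-((b : ℤ) + 1)) m
    rw [mul_assoc, div_mul_cancel₀ _ this]

/-- The factors of the products over pairs of parts of two different partitions. -/
noncomputable def crossFactor (q t : ℝ) (n : ℤ) (i j : ℕ) : ℝ :=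
  if i ≤ j then fmacInt q t n (j - i) else fmacInt q t (-n) (i - 1 - j)

theorem exists_crossFactor_eq (h : Generic q t) (n : ℤ) (i j : ℕ) :
    ∃ c : ℝ, crossFactor q t n i j = c * (1 - q ^ (n + 1) * t ^ ((j : ℤ) - i)) ∧
      crossFactor q t (n + 1) i j =
        c * ((if j < i then (t / q)⁻¹ else 1) * (1 - q ^ n * t ^ ((j : ℤ) - i + 1))) := by
  have hq := h.q_pos.ne'
  have ht := h.t_pos.ne'
  unfold crossFactor
  rcases le_or_gt i j with hij | hij
  · obtain ⟨m, rfl⟩ := Nat.exists_eq_add_of_le hij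
    rw [if_pos hij, if_pos hij, if_neg (not_lt.2 hij), Nat.add_sub_cancel_left, one_mul]
    have e1 : ((i + m : ℕ) : ℤ) - i = m := by push_cast; ring
    have e2 : (m : ℤ) + 1 = ((m + 1 : ℕ) : ℤ) := by push_cast; ring
    rw [e1, e2, zpow_natCast, zpow_natCast]
    have hr := fmacInt_succ h n m
    by_cases h0 : 1 - q ^ (n + 1) * t ^ m = 0
    · have hm : m = 0 := by
        rcases m with _ | m
        · rfl
        · exact absurd h0 (h.sub_ne _ m)
      subst hm
      have hn : n = -1 := by
        rw [pow_zero, mul_one, sub_eq_zero] at h0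
        have := (zpow_eq_one_iff_right₀ h.q_pos.le h.q_lt.ne).1 h0.symm
        omega
      subst hn
      have h2 := h.sub_ne (-1) 0
      refine ⟨1 / (1 - q ^ (-1 : ℤ) * t ^ (0 + 1)), ?_, ?_⟩
      · rw [h0, fmacInt_neg_zero (by norm_num), mul_zero]
      · rw [one_div, inv_mul_cancel₀ h2]
        simp [fmacInt, fmac]
    · refine ⟨fmacInt q t n m / (1 - q ^ (n + 1) * t ^ m), ?_, ?_⟩
      · field_simp
      · field_simp
        linarith
  · obtain ⟨m, rfl⟩ := Nat.exists_eq_add_of_lt hij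
    rw [if_neg (not_le.2 hij), if_neg (not_le.2 hij), if_pos hij]
    have e1 : (j : ℤ) - ((j + m + 1 : ℕ) : ℤ) = -((m : ℤ) + 1) := by push_cast; ring
    have e2 : -((m : ℤ) + 1) + 1 = -(m : ℤ) := by ring
    have e3 : j + m + 1 - 1 - j = m := by omega
    rw [e1, e2, e3]
    have hr := fmacInt_succ h (-(n + 1)) m
    have e4 : -(n + 1) + 1 = -n := by ring
    rw [e4] at hr
    have hne := h.sub_ne (-(n + 1)) m
    have htm : t ^ (m + 1) = t ^ m * t := pow_succ _ _
    have hA : q ^ (n + 1) ≠ 0 := zpow_ne_zero _ hq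
    have hA' : q ^ n ≠ 0 := zpow_ne_zero _ hq
    have hq1 : q ^ (n + 1) = q ^ n * q := zpow_add_one₀ hq n
    have htm0 : t ^ m ≠ 0 := pow_ne_zero _ ht
    rw [zpow_neg] at hne
    rw [zpow_neg, zpow_neg] at hr
    refine ⟨-(fmacInt q t (-n) m) * t ^ (m + 1) /
      (q ^ (n + 1) * (1 - (q ^ (n + 1))⁻¹ * t ^ (m + 1))), ?_, ?_⟩
    · rw [zpow_neg, show (m : ℤ) + 1 = ((m + 1 : ℕ) : ℤ) by push_cast; ring, zpow_natCast]
      field_simp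
      have h3 : q ^ (n + 1) - t ^ (m + 1) ≠ 0 := by
        intro h4
        apply hne
        rw [sub_eq_zero] at h4 ⊢
        rw [← h4, inv_mul_cancel₀ hA]
      field_simp
      ring
    · rw [zpow_neg, zpow_natCast]
      have h5 : fmacInt q t (-(n + 1)) m =
          fmacInt q t (-n) m * (1 - (q ^ n)⁻¹ * t ^ m) / (1 - (q ^ (n + 1))⁻¹ * t ^ (m + 1)) := by
        rw [eq_div_iff hne]; exact hr.symm
      rw [h5]
      generalize 1 - (q ^ (n + 1))⁻¹ * t ^ (m + 1) = D at hne ⊢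
      rw [hq1, htm]
      field_simp
      ring

end

theorem prod_triangle_split {M N : ℕ} (h1 : N ≤ M) (h2 : M ≤ N + 1) (g h : ℕ → ℕ → ℝ) :
    ∏ i ∈ Finset.range M, ∏ j ∈ Finset.range N, (if i ≤ j then g i j else h i j) =
      (∏ j ∈ Finset.range N, ∏ i ∈ Finset.range (j + 1), g i j) *
        ∏ i ∈ Finset.range M, ∏ j ∈ Finset.range i, h i j := by
  have e : ∀ i j, (if i ≤ j then g i j else h i j) =
      (if i ≤ j then g i j else 1) * (if i ≤ j then 1 else h i j) := by
    intro i j; split_ifs <;> simp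
  simp_rw [e, Finset.prod_mul_distrib]
  congr 1
  · rw [Finset.prod_comm]
    refine Finset.prod_congr rfl fun j hj => ?_
    rw [Finset.mem_range] at hj
    rw [← Finset.prod_subset (Finset.range_mono (by omega : j + 1 ≤ M))]
    · refine Finset.prod_congr rfl fun i hi => if_pos ?_
      rw [Finset.mem_range] at hi; omega
    · intro i _ hi
      rw [Finset.mem_range] at hi
      exact if_neg (by omega)
  · refine Finset.prod_congr rfl fun i hi => ?_
    rw [Finset.mem_range] at hi
    rw [← Finset.prod_subset (Finset.range_mono (by omega : i ≤ N))]
    · refine Finset.prod_congr rfl fun j hj => if_neg ?_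
      rw [Finset.mem_range] at hj; omega
    · intro j _ hj
      rw [Finset.mem_range] at hj
      exact if_pos (by omega)

theorem prod_Ioi_eq_range {N : ℕ} (g : ℕ → ℕ → ℝ) :
    ∏ i : Fin N, ∏ j ∈ Finset.Ioi i, g i j =
      ∏ j ∈ Finset.range N, ∏ i ∈ Finset.range j, g i j := by
  rw [Finset.prod_sigma', Finset.prod_sigma']
  refine Finset.prod_bij (fun a _ => ⟨a.2, a.1⟩) ?_ ?_ ?_ ?_
  · intro a ha
    simp only [Finset.mem_sigma, Finset.mem_univ, Finset.mem_Ioi, true_and] at ha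
    simp [ha]
  · rintro ⟨a1, a2⟩ _ ⟨b1, b2⟩ _ hab
    simp only [Sigma.mk.injEq, heq_eq_eq, Fin.val_inj] at hab
    simp [hab]
  · rintro ⟨b1, b2⟩ hb
    simp only [Finset.mem_sigma, Finset.mem_range] at hb
    exact ⟨⟨⟨b2, by omega⟩, ⟨b1, hb.1⟩⟩, by simp [hb.2], rfl⟩
  · intro a _
    rfl

/-- The product of all cross factors of two sequences. -/
noncomputable def crossProd (q t : ℝ) (M N : ℕ) (a b : ℕ → ℤ) : ℝ :=
  ∏ i : Fin M, ∏ j : Fin N, crossFactor q t (a i - b j) i j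

/-- The product of `fmac` over pairs of parts, with arm lengths `j - i`. -/
noncomputable def pairProd (q t : ℝ) (N : ℕ) (a : ℕ → ℕ) : ℝ :=
  ∏ i : Fin N, ∏ j ∈ Finset.Ioi i, fmac q t (a i - a j) (j - i)

/-- The product of `fmac` over pairs of parts, with arm lengths `j - 1 - i`. -/
noncomputable def pairProd' (q t : ℝ) (N : ℕ) (a : ℕ → ℕ) : ℝ :=
  ∏ i : Fin N, ∏ j ∈ Finset.Ioi i, fmac q t (a i - a j) (j - 1 - i)

section

variable {q t : ℝ}

theorem le_of_crossProd_ne_zero {M N : ℕ} {a b : ℕ → ℤ} (h : crossProd q t M N a b ≠ 0) {i : ℕ}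
    (hM : i < M) (hN : i < N) : b i ≤ a i := by
  have := Finset.prod_ne_zero_iff.1 (Finset.prod_ne_zero_iff.1 h ⟨i, hM⟩ (Finset.mem_univ _))
    ⟨i, hN⟩ (Finset.mem_univ _)
  by_contra! hlt
  apply this
  simp only [crossFactor, le_refl, if_true, Nat.sub_self]
  exact fmacInt_neg_zero (by omega)

theorem le_of_crossProd_ne_zero' {M N : ℕ} {a b : ℕ → ℤ} (h : crossProd q t M N a b ≠ 0) {i : ℕ}
    (hM : i + 1 < M) (hN : i < N) : a (i + 1) ≤ b i := by
  have := Finset.prod_ne_zero_iff.1 (Finset.prod_ne_zero_iff.1 h ⟨i + 1, hM⟩ (Finset.mem_univ _))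
    ⟨i, hN⟩ (Finset.mem_univ _)
  by_contra! hlt
  apply this
  have h1 : ¬ (i + 1 ≤ i) := by omega
  simp only [crossFactor, h1, if_false, Nat.add_sub_cancel, Nat.sub_self]
  exact fmacInt_neg_zero (by omega)

theorem crossProd_eq {M N : ℕ} (h1 : N ≤ M) (h2 : M ≤ N + 1) {a b : Partn} (h : a.Interlace b) :
    crossProd q t M N (fun i => a i) (fun i => b i) =
      (∏ j ∈ Finset.range N, ∏ i ∈ Finset.range (j + 1), fmac q t (a i - b j) (j - i)) *
        ∏ i ∈ Finset.range M, ∏ j ∈ Finset.range i, fmac q t (b j - a i) (i - 1 - j) := by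
  unfold crossProd
  rw [Fin.prod_univ_eq_prod_range
    (fun i => ∏ j : Fin N, crossFactor q t ((a i : ℤ) - (b j : ℤ)) i j) M]
  simp_rw [fun i => Fin.prod_univ_eq_prod_range
    (fun j => crossFactor q t ((a i : ℤ) - (b j : ℤ)) i j) N]
  rw [← prod_triangle_split h1 h2]
  refine Finset.prod_congr rfl fun i _ => Finset.prod_congr rfl fun j _ => ?_
  unfold crossFactor
  split_ifs with hij
  · exact fmacInt_sub ((h j).1.trans (a.anti hij)) _
  · rw [neg_sub]
    exact fmacInt_sub (((a.anti (by omega)).trans (h j).2)) _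

theorem pairProd_eq (N : ℕ) (a : ℕ → ℕ) : pairProd q t N a =
    ∏ j ∈ Finset.range N, ∏ i ∈ Finset.range (j + 1), fmac q t (a i - a j) (j - i) := by
  rw [pairProd, prod_Ioi_eq_range fun i j => fmac q t (a i - a j) (j - i)]
  refine Finset.prod_congr rfl fun j _ => ?_
  rw [Finset.prod_range_succ, Nat.sub_self, fmac_zero, mul_one]

theorem pairProd'_eq (N : ℕ) (a : ℕ → ℕ) : pairProd' q t N a =
    ∏ j ∈ Finset.range N, ∏ i ∈ Finset.range j, fmac q t (a i - a j) (j - 1 - i) :=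
  prod_Ioi_eq_range fun i j => fmac q t (a i - a j) (j - 1 - i)

theorem pairProd_pos (hq0 : 0 ≤ q) (hq1 : q < 1) (ht0 : 0 ≤ t) (ht1 : t < 1) (N : ℕ)
    (a : ℕ → ℕ) : 0 < pairProd q t N a :=
  Finset.prod_pos fun _ _ => Finset.prod_pos fun _ _ => fmac_pos hq0 hq1 ht0 ht1 _ _

theorem pairProd'_pos (hq0 : 0 ≤ q) (hq1 : q < 1) (ht0 : 0 ≤ t) (ht1 : t < 1) (N : ℕ)
    (a : ℕ → ℕ) : 0 < pairProd' q t N a :=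
  Finset.prod_pos fun _ _ => Finset.prod_pos fun _ _ => fmac_pos hq0 hq1 ht0 ht1 _ _

theorem psiCoeff_mul (hq0 : 0 ≤ q) (hq1 : q < 1) (ht0 : 0 ≤ t) (ht1 : t < 1) {a b : Partn}
    {N : ℕ} (hN : a (N + 1) = 0) (hN' : b N = 0) :
    psiCoeff q t a b * (pairProd q t N b * pairProd' q t (N + 1) a) =
      crossProd q t (N + 1) N (fun i => a i) (fun i => b i) := by
  by_cases h : a.Interlace b
  · rw [psiCoeff_eq hq0 hq1 ht0 ht1 h hN hN', crossProd_eq (Nat.le_succ N) le_rfl h,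
      pairProd_eq, pairProd'_eq, Finset.prod_range_succ', Finset.prod_range_succ']
    simp only [Finset.range_zero, Finset.prod_empty, mul_one, Nat.add_sub_cancel]
    simp only [← Finset.prod_mul_distrib]
    refine Finset.prod_congr rfl fun j _ => Finset.prod_congr rfl fun i _ => ?_
    exact div_mul_cancel₀ _
      (mul_pos (fmac_pos hq0 hq1 ht0 ht1 _ _) (fmac_pos hq0 hq1 ht0 ht1 _ _)).ne'
  · rw [psiCoeff, if_neg h, zero_mul]
    symm
    by_contra h0
    apply h
    intro i
    rcases lt_or_ge i N with hi | hi
    · exact ⟨by exact_mod_cast le_of_crossProd_ne_zero h0 (by omega) hi,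
        by exact_mod_cast le_of_crossProd_ne_zero' h0 (by omega) hi⟩
    · rw [b.eq_zero_of_le hN' hi, a.eq_zero_of_le hN (by omega : N + 1 ≤ i + 1)]
      simp

theorem phiCoeff_mul (hq0 : 0 ≤ q) (hq1 : q < 1) (ht0 : 0 ≤ t) (ht1 : t < 1) {a b : Partn}
    {N : ℕ} (hN : a N = 0) (hN' : b N = 0) :
    phiCoeff q t a b * (pairProd q t N a * pairProd' q t N b) =
      crossProd q t N N (fun i => a i) (fun i => b i) := by
  by_cases h : a.Interlace b
  · have hpos : (∏ i ∈ Finset.range N, fmac q t (b i - b N) (N - 1 - i)) ≠ 0 :=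
      (Finset.prod_pos fun _ _ => fmac_pos hq0 hq1 ht0 ht1 _ _).ne'
    apply mul_right_cancel₀ hpos
    have e1 : pairProd' q t N b * (∏ i ∈ Finset.range N, fmac q t (b i - b N) (N - 1 - i)) =
        ∏ j ∈ Finset.range N, ∏ i ∈ Finset.range (j + 1), fmac q t (b i - b (j + 1)) (j - i) := by
      rw [pairProd'_eq, ← Finset.prod_range_succ
        (fun j => ∏ i ∈ Finset.range j, fmac q t (b i - b j) (j - 1 - i)), Finset.prod_range_succ']
      simp
    have e2 : (∏ i ∈ Finset.range N, ∏ j ∈ Finset.range i, fmac q t (b j - a i) (i - 1 - j)) *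
        (∏ i ∈ Finset.range N, fmac q t (b i - b N) (N - 1 - i)) =
        ∏ j ∈ Finset.range N, ∏ i ∈ Finset.range (j + 1), fmac q t (b i - a (j + 1)) (j - i) := by
      rw [hN', ← hN, ← Finset.prod_range_succ
        (fun i => ∏ j ∈ Finset.range i, fmac q t (b j - a i) (i - 1 - j)), Finset.prod_range_succ']
      simp
    rw [phiCoeff_eq hq0 hq1 ht0 ht1 h hN, crossProd_eq le_rfl (Nat.le_succ N) h, pairProd_eq,
      mul_assoc, mul_assoc, mul_assoc, e1, e2]
    simp only [← Finset.prod_mul_distrib]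
    refine Finset.prod_congr rfl fun j _ => Finset.prod_congr rfl fun i _ => ?_
    exact div_mul_cancel₀ _
      (mul_pos (fmac_pos hq0 hq1 ht0 ht1 _ _) (fmac_pos hq0 hq1 ht0 ht1 _ _)).ne'
  · rw [phiCoeff, if_neg h, zero_mul]
    symm
    by_contra h0
    apply h
    intro i
    constructor
    · rcases lt_or_ge i N with hi | hi
      · exact_mod_cast le_of_crossProd_ne_zero h0 hi hi
      · simp [b.eq_zero_of_le hN' hi]
    · rcases lt_or_ge (i + 1) N with hi | hi
      · exact_mod_cast le_of_crossProd_ne_zero' h0 hi (by omega)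
      · simp [a.eq_zero_of_le hN hi]

end

/-- The normalized ratio of Vandermonde products of a rescaled and an original sequence. -/
noncomputable def vratio {n : ℕ} (ρ : ℝ) (y : Fin n → ℝ) (σ : Fin n → Bool) : ℝ :=
  ∏ i, ∏ j ∈ Finset.Ioi i, ((if σ j then ρ * y j else y j) - (if σ i then ρ * y i else y i)) /
    (y j - y i) * (if σ j then ρ⁻¹ else 1)

theorem vratio_mul {n : ℕ} {ρ : ℝ} (hρ : ρ ≠ 0) {y : Fin n → ℝ} (hy : vprod y ≠ 0)
    (σ : Fin n → Bool) :
    vprod (fun i => if σ i then ρ * y i else y i) =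
      vratio ρ y σ * (∏ j, if σ j then ρ ^ (j : ℕ) else 1) * vprod y := by
  have h1 : (∏ i : Fin n, ∏ j ∈ Finset.Ioi i, if σ j then ρ⁻¹ else 1) *
      (∏ j, if σ j then ρ ^ (j : ℕ) else 1) = 1 := by
    have h2 : (∏ i : Fin n, ∏ j ∈ Finset.Ioi i, if σ j then ρ⁻¹ else 1) =
        ∏ j : Fin n, ∏ i ∈ Finset.Iio j, if σ j then ρ⁻¹ else 1 := by
      rw [Finset.prod_sigma', Finset.prod_sigma']
      refine Finset.prod_bij' (fun a _ => ⟨a.2, a.1⟩) (fun a _ => ⟨a.2, a.1⟩) ?_ ?_ ?_ ?_ ?_ <;>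
        simp
    rw [h2, ← Finset.prod_mul_distrib]
    refine Finset.prod_eq_one fun j _ => ?_
    rw [Finset.prod_const, Fin.card_Iio]
    split_ifs
    · rw [← mul_pow, inv_mul_cancel₀ hρ, one_pow]
    · simp
  have h3 : vratio ρ y σ * vprod y = vprod (fun i => if σ i then ρ * y i else y i) *
      ∏ i : Fin n, ∏ j ∈ Finset.Ioi i, if σ j then ρ⁻¹ else 1 := by
    unfold vratio vprod at *
    simp only [← Finset.prod_mul_distrib]
    refine Finset.prod_congr rfl fun i hi => Finset.prod_congr rfl fun j hj => ?_
    have := Finset.prod_ne_zero_iff.1 (Finset.prod_ne_zero_iff.1 hy i hi) j hj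
    rw [mul_right_comm, div_mul_cancel₀ _ this]
  rw [mul_right_comm, h3, mul_assoc, h1, mul_one]

section

variable {q t : ℝ}

theorem pieri_pair (h : Generic q t) (n m n' : ℕ) (si sj : Bool)
    (hn : n' + (if sj then 1 else 0) = n + (if si then 1 else 0)) :
    (if si = false ∧ sj = true then pieriFactor q t (q ^ n * t ^ (m + 1)) else 1) *
        fmac q t n m =
      ((if sj then (t / q)⁻¹ else 1) -
        (if si then (t / q)⁻¹ * (q ^ n * t ^ (m + 1)) else q ^ n * t ^ (m + 1))) /
        (1 - q ^ n * t ^ (m + 1)) * (if sj then (t / q)⁻¹⁻¹ else 1) * fmac q t n' m := by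
  have hq := h.q_pos.ne'
  have ht := h.t_pos.ne'
  have h1 : 1 - q ^ n * t ^ (m + 1) ≠ 0 := by exact_mod_cast h.sub_ne n m
  cases si <;> cases sj <;> simp at hn ⊢
  · subst hn
    rw [div_self h1, one_mul]
  · subst hn
    have h2 := h.den_ne n' m
    have h3 : 1 - q ^ n' * t ^ (m + 1) ≠ 0 := by exact_mod_cast h.sub_ne n' m
    rw [fmac_succ, pieriFactor]
    have e1 : q ^ (n' + 1) * t ^ (m + 1) / t = q ^ (n' + 1) * t ^ m := by
      rw [pow_succ t]; field_simp
    have e2 : t * (q ^ (n' + 1) * t ^ (m + 1)) / q = t * (q ^ n' * t ^ (m + 1)) := by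
      rw [pow_succ q]; field_simp
    have e3 : q ^ (n' + 1) * t ^ (m + 1) / q = q ^ n' * t ^ (m + 1) := by
      rw [pow_succ q]; field_simp
    rw [e1, e2, e3]
    field_simp
    ring
  · subst hn
    have h2 := h.den_ne n m
    rw [fmac_succ]
    have e1 : q / t * (q ^ n * t ^ (m + 1)) = q ^ (n + 1) * t ^ m := by
      rw [pow_succ t, pow_succ q]; field_simp
    rw [e1]
    field_simp
  · subst hn
    field_simp

theorem pieri_pair' (h : Generic q t) (n m n' : ℕ) (si sj : Bool)
    (hn : n' + (if si then 1 else 0) = n + (if sj then 1 else 0)) :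
    (if si = false ∧ sj = true then pieriFactor q t (q ^ n' * t ^ (m + 1)) else 1) *
        fmac q t n (m + 1) =
      ((if sj then t / q else 1) -
        (if si then t / q * (q ^ n * t ^ (m + 1)) else q ^ n * t ^ (m + 1))) /
        (1 - q ^ n * t ^ (m + 1)) * (if sj then (t / q)⁻¹ else 1) * fmac q t n' (m + 1) := by
  have hq := h.q_pos.ne'
  have ht := h.t_pos.ne'
  have h1 : 1 - q ^ n * t ^ (m + 1) ≠ 0 := by exact_mod_cast h.sub_ne n m
  cases si <;> cases sj <;> simp at hn ⊢
  · subst hn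
    rw [div_self h1, one_mul]
  · subst hn
    have h2 := h.den_ne n (m + 1)
    have h3 : 1 - q ^ n * t ^ (m + 1 + 1) ≠ 0 := by exact_mod_cast h.sub_ne n (m + 1)
    rw [fmac_succ, pieriFactor]
    have e1 : q ^ (n + 1) * t ^ (m + 1) / t = q ^ (n + 1) * t ^ m := by
      rw [pow_succ t]; field_simp
    have e2 : t * (q ^ (n + 1) * t ^ (m + 1)) / q = q ^ n * t ^ (m + 1 + 1) := by
      rw [pow_succ q, pow_succ t (m + 1)]; field_simp
    have e3 : q ^ (n + 1) * t ^ (m + 1) / q = q ^ n * t ^ (m + 1) := by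
      rw [pow_succ q]; field_simp
    rw [e1, e2, e3]
    field_simp
    ring
  · subst hn
    have h2 := h.den_ne n' (m + 1)
    have h3 : 1 - q ^ n' * t ^ (m + 1 + 1) ≠ 0 := by exact_mod_cast h.sub_ne n' (m + 1)
    rw [fmac_succ]
    have e1 : t / q * (q ^ (n' + 1) * t ^ (m + 1)) = q ^ n' * t ^ (m + 1 + 1) := by
      rw [pow_succ q, pow_succ t (m + 1)]; field_simp
    rw [e1]
    field_simp
  · subst hn
    field_simp

/-- The spectral variables `q ^ (a i) * t ^ (-i)`. -/
noncomputable def spec (q t : ℝ) (a : ℕ → ℕ) (i : ℕ) : ℝ := q ^ a i * (t ^ i)⁻¹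

theorem spec_ne_zero (h : Generic q t) (a : ℕ → ℕ) (i : ℕ) : spec q t a i ≠ 0 :=
  mul_ne_zero (pow_ne_zero _ h.q_pos.ne') (inv_ne_zero (pow_ne_zero _ h.t_pos.ne'))

theorem spec_eq_mul (h : Generic q t) {a : ℕ → ℕ} (ha : Antitone a) {i j : ℕ} (hij : i ≤ j) :
    spec q t a i = q ^ (a i - a j) * t ^ (j - i) * spec q t a j := by
  obtain ⟨m, rfl⟩ := Nat.exists_eq_add_of_le hij
  obtain ⟨n, hn⟩ := Nat.exists_eq_add_of_le (ha hij)
  have := h.q_pos.ne'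
  have := h.t_pos.ne'
  rw [spec, spec, hn, Nat.add_sub_cancel_left, Nat.add_sub_cancel_left, pow_add, pow_add]
  field_simp

theorem spec_sub_ne_zero (h : Generic q t) {a : ℕ → ℕ} (ha : Antitone a) {i j : ℕ} (hij : i < j) :
    spec q t a j - spec q t a i ≠ 0 := by
  rw [spec_eq_mul h ha hij.le]
  obtain ⟨m, rfl⟩ := Nat.exists_eq_add_of_lt hij
  have h1 : 1 - q ^ (a i - a (i + m + 1)) * t ^ (m + 1) ≠ 0 := by
    exact_mod_cast h.sub_ne (a i - a (i + m + 1) : ℕ) m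
  have h2 := mul_ne_zero h1 (spec_ne_zero h a (i + m + 1))
  rw [show i + m + 1 - i = m + 1 by omega]
  rwa [sub_mul, one_mul] at h2

theorem vprod_spec_ne_zero (h : Generic q t) {a : ℕ → ℕ} (ha : Antitone a) (n : ℕ) :
    vprod (fun i : Fin n => spec q t a i) ≠ 0 :=
  Finset.prod_ne_zero_iff.2 fun _ _ => Finset.prod_ne_zero_iff.2 fun _ hj =>
    spec_sub_ne_zero h ha (Fin.lt_def.1 (Finset.mem_Ioi.1 hj))

theorem ratio_eq {R y : ℝ} (ρ : ℝ) (hy : y ≠ 0) (si sj : Bool) :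
    ((if sj then ρ * y else y) - (if si then ρ * (R * y) else R * y)) / (y - R * y) =
      ((if sj then ρ else 1) - (if si then ρ * R else R)) / (1 - R) := by
  have e1 : y - R * y = (1 - R) * y := by ring
  have e2 : ((if sj then ρ * y else y) - (if si then ρ * (R * y) else R * y)) =
      ((if sj then ρ else 1) - (if si then ρ * R else R)) * y := by
    split_ifs <;> ring
  rw [e1, e2, mul_div_mul_right _ _ hy]

/-- The Pieri coefficient of adding a vertical strip. -/
theorem pieriCoeff_mul_pairProd' (h : Generic q t) {a b : Partn} {N : ℕ} (hN : a N = 0)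
    (σ : Fin N → Bool) (hσ : ∀ i : Fin N, a i = b i + if σ i then 1 else 0) (hv : a.VertStrip b) :
    pieriCoeff q t a b * pairProd' q t N b =
      vratio (t / q)⁻¹ (fun i => spec q t b i) σ * pairProd' q t N a := by
  rw [pieriCoeff_eq hv hN, ← prod_Ioi_eq_range fun i j => if a i = b i ∧ a j = b j + 1 then
    pieriFactor q t (q ^ (b i - b j) * t ^ (j - i)) else 1]
  unfold pairProd' vratio
  simp only [← Finset.prod_mul_distrib]
  refine Finset.prod_congr rfl fun i _ => Finset.prod_congr rfl fun j hj => ?_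
  have hij : (i : ℕ) < j := Fin.lt_def.1 (Finset.mem_Ioi.1 hj)
  obtain ⟨m, hm⟩ := Nat.exists_eq_add_of_lt hij
  have hb := b.anti hij.le
  have ha := a.anti hij.le
  have key := pieri_pair h (b i - b j) m (a i - a j) (σ i) (σ j)
    (by have := hσ i; have := hσ j; omega)
  rw [spec_eq_mul h b.anti hij.le, ratio_eq _ (spec_ne_zero h _ _),
    show (j : ℕ) - i = m + 1 by omega, show (j : ℕ) - 1 - i = m by omega, ← key]
  congr 1
  have hi := hσ i
  have hj := hσ j
  rcases hsi : σ i <;> rcases hsj : σ j <;> simp [hsi, hsj] at hi hj <;> simp [hi, hj]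

/-- The Pieri coefficient of removing a vertical strip. -/
theorem pieriCoeff_mul_pairProd (h : Generic q t) {a b : Partn} {N : ℕ} (hN : a N = 0)
    (σ : Fin N → Bool) (hσ : ∀ i : Fin N, a i = b i + if σ i then 1 else 0) (hv : a.VertStrip b) :
    pieriCoeff q t a b * pairProd q t N a =
      vratio (t / q) (fun i => spec q t a i) σ * pairProd q t N b := by
  rw [pieriCoeff_eq hv hN, ← prod_Ioi_eq_range fun i j => if a i = b i ∧ a j = b j + 1 then
    pieriFactor q t (q ^ (b i - b j) * t ^ (j - i)) else 1]
  unfold pairProd vratio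
  simp only [← Finset.prod_mul_distrib]
  refine Finset.prod_congr rfl fun i _ => Finset.prod_congr rfl fun j hj => ?_
  have hij : (i : ℕ) < j := Fin.lt_def.1 (Finset.mem_Ioi.1 hj)
  obtain ⟨m, hm⟩ := Nat.exists_eq_add_of_lt hij
  have hb := b.anti hij.le
  have ha := a.anti hij.le
  have key := pieri_pair' h (a i - a j) m (b i - b j) (σ i) (σ j)
    (by have := hσ i; have := hσ j; omega)
  rw [spec_eq_mul h a.anti hij.le, ratio_eq _ (spec_ne_zero h _ _),
    show (j : ℕ) - i = m + 1 by omega, ← key]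
  congr 1
  have hi := hσ i
  have hj := hσ j
  rcases hsi : σ i <;> rcases hsj : σ j <;> simp [hsi, hsj] at hi hj <;> simp [hi, hj]

end

/-- The indicator sequence of a finite set of positions. -/
def indSeq {n : ℕ} (σ : Fin n → Bool) (i : ℕ) : ℕ :=
  if h : i < n then (if σ ⟨i, h⟩ then 1 else 0) else 0

@[simp]
theorem indSeq_coe {n : ℕ} (σ : Fin n → Bool) (i : Fin n) :
    indSeq σ i = if σ i then 1 else 0 := by simp [indSeq]

theorem indSeq_of_le {n : ℕ} (σ : Fin n → Bool) {i : ℕ} (h : n ≤ i) : indSeq σ i = 0 :=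
  dif_neg (not_lt.2 h)

theorem indSeq_le {n : ℕ} (σ : Fin n → Bool) (i : ℕ) : indSeq σ i ≤ 1 := by
  unfold indSeq; split_ifs <;> simp

theorem prod_if_lt_fst {N i : ℕ} (h : i ≤ N) (x : ℝ) :
    (∏ j : Fin N, if (j : ℕ) < i then x else 1) = x ^ i := by
  rw [Fin.prod_univ_eq_prod_range (fun j => if j < i then x else 1) N, Finset.prod_ite,
    Finset.prod_const_one, mul_one, Finset.prod_const]
  congr 1
  rw [show (Finset.range N).filter (· < i) = Finset.range i by ext; simp; omega, Finset.card_range]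

theorem prod_if_lt_snd {M j : ℕ} (x : ℝ) :
    (∏ i : Fin M, if j < (i : ℕ) then x else 1) = x ^ (M - 1 - j) := by
  rw [Fin.prod_univ_eq_prod_range (fun i => if j < i then x else 1) M, Finset.prod_ite,
    Finset.prod_const_one, mul_one, Finset.prod_const]
  congr 1
  rw [show (Finset.range M).filter (j < ·) = Finset.Ioo j M by ext; simp; omega, Nat.card_Ioo]
  omega

theorem vratio_smul {n : ℕ} (ρ : ℝ) (y : Fin n → ℝ) (σ : Fin n → Bool) {c : ℝ} (hc : c ≠ 0) :
    vratio ρ (fun i => c * y i) σ = vratio ρ y σ := by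
  unfold vratio
  refine Finset.prod_congr rfl fun i _ => Finset.prod_congr rfl fun j _ => ?_
  have e1 : c * y j - c * y i = c * (y j - y i) := by ring
  have e2 : ((if σ j then ρ * (c * y j) else c * y j) - (if σ i then ρ * (c * y i) else c * y i)) =
      c * ((if σ j then ρ * y j else y j) - (if σ i then ρ * y i else y i)) := by
    split_ifs <;> ring
  rw [e1, e2, mul_div_mul_left _ _ hc]

theorem vprod_smul_ne_zero {n : ℕ} {y : Fin n → ℝ} {c : ℝ} (hc : c ≠ 0) (h : vprod y ≠ 0) :
    vprod (fun i => c * y i) ≠ 0 := by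
  unfold vprod at *
  refine Finset.prod_ne_zero_iff.2 fun i hi => Finset.prod_ne_zero_iff.2 fun j hj => ?_
  rw [← mul_sub]
  exact mul_ne_zero hc (Finset.prod_ne_zero_iff.1 (Finset.prod_ne_zero_iff.1 h i hi) j hj)

section

variable {q t : ℝ}

theorem zpow_mul_zpow_eq (h : Generic q t) (a b : ℕ → ℕ) (i j : ℕ) :
    q ^ ((a i : ℤ) - b j) * t ^ ((j : ℤ) - i) = spec q t a i / spec q t b j := by
  have hq := h.q_pos.ne'
  have ht := h.t_pos.ne'
  rw [zpow_sub₀ hq, zpow_sub₀ ht]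
  simp only [zpow_natCast, spec]
  field_simp

theorem exists_crossProd_bordered (h : Generic q t) (a b : ℕ → ℕ) (N : ℕ) :
    ∃ C : ℝ,
      (∀ σ : Fin (N + 1) → Bool,
        crossProd q t (N + 1) N (fun i => a i + indSeq σ i) (fun i => b i) =
        C * (∏ i : Fin (N + 1), if σ i then
          (t / q) ^ N * ∏ k : Fin N, (t * spec q t a i - spec q t b k)
          else ∏ k : Fin N, (t * spec q t a i - t / q * spec q t b k)) *
          ∏ i : Fin (N + 1), if σ i then (t / q)⁻¹ ^ (i : ℕ) else 1) ∧
      (∀ σ : Fin N → Bool,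
        crossProd q t (N + 1) N (fun i => a i) (fun i => b i - indSeq σ i) =
        C * (∏ j : Fin N, if σ j then t / q * ∏ i : Fin (N + 1), (t * spec q t a i - spec q t b j)
          else ∏ i : Fin (N + 1), (t * spec q t a i - t / q * spec q t b j)) *
          ∏ j : Fin N, if σ j then (t / q) ^ (j : ℕ) else 1) := by
  have hq := h.q_pos.ne'
  have ht := h.t_pos.ne'
  have hτ : t / q ≠ 0 := div_ne_zero ht hq
  choose c hc0 hc1 using fun i j : ℕ => exists_crossFactor_eq h ((a i : ℤ) - b j) i j
  have e0 : ∀ i j : ℕ, crossFactor q t ((a i : ℤ) - b j) i j =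
      -c i j / (t / q * spec q t b j) * (t * spec q t a i - t / q * spec q t b j) := by
    intro i j
    have hs := spec_ne_zero h b j
    rw [hc0, zpow_add₀ hq, mul_assoc, mul_comm (q ^ (1 : ℤ)), ← mul_assoc,
      zpow_mul_zpow_eq h, zpow_one]
    field_simp
    ring
  have e1 : ∀ i j : ℕ, crossFactor q t ((a i : ℤ) - b j + 1) i j =
      -c i j / (t / q * spec q t b j) * (t / q * (if j < i then (t / q)⁻¹ else 1) *
        (t * spec q t a i - spec q t b j)) := by
    intro i j
    have hs := spec_ne_zero h b j
    rw [hc1, zpow_add₀ ht, ← mul_assoc (q ^ _), zpow_mul_zpow_eq h, zpow_one]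
    generalize (if j < i then (t / q)⁻¹ else (1 : ℝ)) = x
    field_simp
    ring
  refine ⟨∏ i : Fin (N + 1), ∏ j : Fin N, -c i j / (t / q * spec q t b j), fun σ => ?_, fun σ => ?_⟩
  · unfold crossProd
    simp only [← Finset.prod_mul_distrib]
    refine Finset.prod_congr rfl fun i _ => ?_
    cases hσ : σ i
    · simp only [indSeq_coe, hσ, Bool.false_eq_true, if_false, Nat.cast_zero, add_zero, e0, mul_one,
        Finset.prod_mul_distrib]
    · have e2 : ∀ j : ℕ, (a i : ℤ) + ((1 : ℕ) : ℤ) - b j = (a i : ℤ) - b j + 1 := by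
        intro j; push_cast; ring
      simp only [indSeq_coe, hσ, if_true, e2, e1]
      rw [Finset.prod_mul_distrib, Finset.prod_mul_distrib, Finset.prod_mul_distrib,
        prod_if_lt_fst (Nat.lt_succ_iff.1 i.2), Finset.prod_const, Finset.card_univ,
        Fintype.card_fin]
      ring
  · unfold crossProd
    rw [Finset.prod_comm, Finset.prod_comm (s := (Finset.univ : Finset (Fin (N + 1))))]
    simp only [← Finset.prod_mul_distrib]
    refine Finset.prod_congr rfl fun j _ => ?_
    cases hσ : σ j
    · simp only [indSeq_coe, hσ, Bool.false_eq_true, if_false, Nat.cast_zero, sub_zero, e0, mul_one,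
        Finset.prod_mul_distrib]
    · have e2 : ∀ i : ℕ, (a i : ℤ) - ((b j : ℤ) - ((1 : ℕ) : ℤ)) = (a i : ℤ) - b j + 1 := by
        intro i; push_cast; ring
      simp only [indSeq_coe, hσ, if_true, e2, e1]
      have e3 : (t / q) ^ (N + 1) * (t / q)⁻¹ ^ (N + 1 - 1 - j) = t / q * (t / q) ^ (j : ℕ) := by
        obtain ⟨m, hm⟩ := Nat.exists_eq_add_of_lt j.2
        rw [show N + 1 - 1 - (j : ℕ) = m + 1 by omega,
          show N + 1 = (m + 1) + ((j : ℕ) + 1) by omega, pow_add, inv_pow]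
        generalize t / q = τ at hτ ⊢
        field_simp
        ring
      rw [Finset.prod_mul_distrib, Finset.prod_mul_distrib, Finset.prod_mul_distrib,
        prod_if_lt_snd, Finset.prod_const, Finset.card_univ, Fintype.card_fin, e3]
      ring

theorem exists_crossProd_square (h : Generic q t) (a b : ℕ → ℕ) (N : ℕ) :
    ∃ C : ℝ, ∀ σ : Fin N → Bool,
        crossProd q t N N (fun i => a i) (fun i => b i + indSeq σ i) =
        C * (∏ j : Fin N, if σ j then (t / q) ^ (N - 1) * ∏ k : Fin N, (spec q t b j - spec q t a k)
          else ∏ k : Fin N, (spec q t b j - t / q * spec q t a k)) *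
          ∏ j : Fin N, if σ j then (t / q)⁻¹ ^ (j : ℕ) else 1 := by
  have hq := h.q_pos.ne'
  have ht := h.t_pos.ne'
  have hτ : t / q ≠ 0 := div_ne_zero ht hq
  choose c hc0 hc1 using fun i j : ℕ => exists_crossFactor_eq h ((a i : ℤ) - b j - 1) i j
  have e1 : ∀ i j : ℕ, crossFactor q t ((a i : ℤ) - b j - 1) i j =
      c i j / spec q t b j * (spec q t b j - spec q t a i) := by
    intro i j
    have hs := spec_ne_zero h b j
    rw [hc0, sub_add_cancel, zpow_mul_zpow_eq h]
    field_simp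
  have e0 : ∀ i j : ℕ, crossFactor q t ((a i : ℤ) - b j) i j =
      c i j / spec q t b j * ((if j < i then (t / q)⁻¹ else 1) *
        (spec q t b j - t / q * spec q t a i)) := by
    intro i j
    have hs := spec_ne_zero h b j
    have := hc1 i j
    rw [sub_add_cancel] at this
    rw [this, zpow_add₀ ht, ← mul_assoc (q ^ _), zpow_sub₀ hq _ 1, div_mul_eq_mul_div,
      zpow_mul_zpow_eq h, zpow_one, zpow_one]
    generalize (if j < i then (t / q)⁻¹ else (1 : ℝ)) = x
    field_simp
  refine ⟨∏ j : Fin N, (∏ i : Fin N, c i j / spec q t b j) * (t / q)⁻¹ ^ (N - 1 - j),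
    fun σ => ?_⟩
  unfold crossProd
  rw [Finset.prod_comm]
  simp only [← Finset.prod_mul_distrib]
  refine Finset.prod_congr rfl fun j _ => ?_
  cases hσ : σ j
  · simp only [indSeq_coe, hσ, Bool.false_eq_true, if_false, Nat.cast_zero, add_zero, e0, mul_one]
    rw [Finset.prod_mul_distrib, Finset.prod_mul_distrib, prod_if_lt_snd]
    ring
  · have e2 : ∀ i : ℕ, (a i : ℤ) - ((b j : ℤ) + ((1 : ℕ) : ℤ)) = (a i : ℤ) - b j - 1 := by
      intro i; push_cast; ring
    simp only [indSeq_coe, hσ, if_true, e2, e1]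
    have e3 : (t / q)⁻¹ ^ (N - 1 - (j : ℕ)) * ((t / q) ^ (N - 1) * (t / q)⁻¹ ^ (j : ℕ)) = 1 := by
      obtain ⟨m, hm⟩ := Nat.exists_eq_add_of_lt j.2
      rw [show N - 1 - (j : ℕ) = m by omega, show N - 1 = m + (j : ℕ) by omega, pow_add, inv_pow,
        inv_pow]
      field_simp
    rw [Finset.prod_mul_distrib]
    linear_combination -(∏ i : Fin N, c i j / spec q t b j) *
      (∏ i : Fin N, (spec q t b j - spec q t a i)) * e3

/-- The determinant identity behind the commutation of horizontal and vertical strips. -/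
theorem sum_crossProd_bordered (h : Generic q t) {a b : ℕ → ℕ} (ha : Antitone a) (hb : Antitone b)
    (N : ℕ) (v : ℝ) :
    ∑ σ : Fin (N + 1) → Bool, (∏ i, if σ i then v else 1) *
        (crossProd q t (N + 1) N (fun i => a i + indSeq σ i) (fun i => b i) *
          vratio (t / q)⁻¹ (fun i => spec q t a i) σ) =
      (1 + v) * ∑ σ : Fin N → Bool, (∏ i, if σ i then v else 1) *
        (crossProd q t (N + 1) N (fun i => a i) (fun i => b i - indSeq σ i) *
          vratio (t / q) (fun i => spec q t b i) σ) := by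
  have hq := h.q_pos.ne'
  have ht := h.t_pos.ne'
  have hτ : t / q ≠ 0 := div_ne_zero ht hq
  obtain ⟨C, hC1, hC2⟩ := exists_crossProd_bordered h a b N
  have hVa := vprod_smul_ne_zero ht (vprod_spec_ne_zero h ha (N + 1))
  have hVb := vprod_spec_ne_zero h hb N
  have key := rows_eq_cols_bordered hτ v (fun i : Fin (N + 1) => t * spec q t a i)
    (fun i : Fin N => spec q t b i) (fun i => mul_ne_zero ht (spec_ne_zero h a i))
    (fun i => spec_ne_zero h b i)
  apply mul_right_cancel₀ (mul_ne_zero hVa hVb)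
  rw [mul_assoc (1 + v)]
  rw [Finset.sum_mul, Finset.sum_mul]
  refine Eq.trans ?_ ((congrArg (C * ·) key).trans ?_)
  · rw [Finset.mul_sum]
    refine Finset.sum_congr rfl fun σ _ => ?_
    have e1 : (fun i : Fin (N + 1) => if σ i then t * spec q t a i / (t / q) else t * spec q t a i)
        = fun i => if σ i then (t / q)⁻¹ * (t * spec q t a i) else t * spec q t a i := by
      ext i
      rw [div_eq_inv_mul]
    rw [e1, vratio_mul (inv_ne_zero hτ) hVa, hC1,
      vratio_smul (t / q)⁻¹ (fun i : Fin (N + 1) => spec q t a i) σ ht]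
    have e2 : (∏ i : Fin (N + 1), if σ i then
        v * (t / q) ^ N * ∏ k : Fin N, (t * spec q t a i - spec q t b k)
        else ∏ k : Fin N, (t * spec q t a i - t / q * spec q t b k)) =
        (∏ i, if σ i then v else 1) * ∏ i : Fin (N + 1),
          if σ i then
          (t / q) ^ N * ∏ k : Fin N, (t * spec q t a i - spec q t b k)
          else ∏ k : Fin N, (t * spec q t a i - t / q * spec q t b k) := by
      rw [← Finset.prod_mul_distrib]
      exact Finset.prod_congr rfl fun j _ => by split_ifs <;> ring
    rw [e2]
    ring
  · simp only [← mul_assoc]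
    rw [mul_comm C, mul_assoc (1 + v), Finset.mul_sum]
    congr 1
    refine Finset.sum_congr rfl fun σ _ => ?_
    rw [vratio_mul hτ hVb, hC2]
    have e2 : (∏ j : Fin N, if σ j then
        v * (t / q) * ∏ i : Fin (N + 1), (t * spec q t a i - spec q t b j)
        else ∏ i : Fin (N + 1), (t * spec q t a i - t / q * spec q t b j)) =
        (∏ i, if σ i then v else 1) * ∏ j : Fin N,
          if σ j then t / q * ∏ i : Fin (N + 1), (t * spec q t a i - spec q t b j)
          else ∏ i : Fin (N + 1), (t * spec q t a i - t / q * spec q t b j) := by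
      rw [← Finset.prod_mul_distrib]
      exact Finset.prod_congr rfl fun j _ => by split_ifs <;> ring
    rw [e2]
    ring

/-- The determinant identity behind the relation of horizontal and vertical strip operators. -/
theorem sum_crossProd_square (h : Generic q t) {a b : ℕ → ℕ} (ha : Antitone a) (hb : Antitone b)
    (N : ℕ) :
    ∑ σ : Fin N → Bool, ((∏ i : Fin N, spec q t b i) * (∏ i, if σ i then -1 else 1) -
        (∏ i : Fin N, spec q t a i) * ∏ i, if σ i then -(t / q) else 1) *
        (crossProd q t N N (fun i => a i) (fun i => b i + indSeq σ i) *
          vratio (t / q)⁻¹ (fun i => spec q t b i) σ) = 0 := by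
  have hτ : t / q ≠ 0 := div_ne_zero h.t_pos.ne' h.q_pos.ne'
  obtain ⟨C, hC⟩ := exists_crossProd_square h a b N
  have hVa := vprod_spec_ne_zero h ha N
  have hVb := vprod_spec_ne_zero h hb N
  have key := rows_wronski hτ (fun i : Fin N => spec q t b i) (fun i : Fin N => spec q t a i) hVa
  apply mul_right_cancel₀ hVb
  rw [Finset.sum_mul, zero_mul]
  refine Eq.trans ?_ ((congrArg (C * ·) key).trans (mul_zero C))
  rw [Finset.mul_sum]
  refine Finset.sum_congr rfl fun σ _ => ?_
  have e1 : (fun i : Fin N => if σ i then spec q t b i / (t / q) else spec q t b i)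
      = fun i => if σ i then (t / q)⁻¹ * spec q t b i else spec q t b i := by
    ext i
    rw [div_eq_inv_mul]
  rw [e1, vratio_mul (inv_ne_zero hτ) hVb, hC]
  ring

end

/-- The number of selected positions. -/
def onCard {n : ℕ} (σ : Fin n → Bool) : ℕ := (Finset.univ.filter fun i => σ i = true).card

theorem onCard_le {n : ℕ} (σ : Fin n → Bool) : onCard σ ≤ n :=
  (Finset.card_le_univ _).trans_eq (Fintype.card_fin n)

theorem prod_ite_eq_pow_onCard {n : ℕ} (σ : Fin n → Bool) (v : ℝ) :
    (∏ i, if σ i then v else 1) = v ^ onCard σ := by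
  rw [Finset.prod_ite, Finset.prod_const, Finset.prod_const_one, mul_one, onCard]

/-- Comparing coefficients in an identity of polynomial functions. -/
theorem coeff_compare {α β : Type*} [Fintype α] [Fintype β] (c : α → ℕ) (d : β → ℕ) (A : α → ℝ)
    (B : β → ℝ) (h : ∀ v : ℝ, ∑ x, v ^ c x * A x = (1 + v) * ∑ y, v ^ d y * B y) (r : ℕ) :
    ∑ x with c x = r, A x = ∑ y with d y = r, B y + ∑ y with d y + 1 = r, B y := by
  open Polynomial in
  have hp : ∑ x, C (A x) * X ^ c x = ∑ y, C (B y) * X ^ d y + ∑ y, C (B y) * X ^ (d y + 1) := by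
    refine Polynomial.funext fun v => ?_
    simp only [eval_finsetSum, eval_mul, eval_C, eval_pow, eval_X, eval_add]
    have := h v
    rw [one_add_mul, Finset.mul_sum] at this
    simp only [mul_comm (A _), mul_comm (B _), pow_succ', mul_assoc]
    exact this
  have := congrArg (Polynomial.coeff · r) hp
  simp only [Polynomial.finsetSum_coeff, Polynomial.coeff_C_mul_X_pow, Polynomial.coeff_add] at this
  rw [Finset.sum_filter, Finset.sum_filter, Finset.sum_filter]
  simpa only [eq_comm (a := r)] using this

namespace Partn

/-- A partition from a function. -/
noncomputable def ofFun (f : ℕ → ℕ) (hf : Antitone f) {N : ℕ} (hN : f N = 0) : Partn :=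
  ⟨Finsupp.onFinset (Finset.range N) f fun i hi => by
    rw [Finset.mem_range]
    by_contra! h
    exact hi (Nat.le_zero.1 (hN ▸ hf h)), hf⟩

@[simp]
theorem ofFun_apply (f : ℕ → ℕ) (hf : Antitone f) {N : ℕ} (hN : f N = 0) (i : ℕ) :
    ofFun f hf hN i = f i := rfl

theorem ext' {a b : Partn} (h : ∀ i, a i = b i) : a = b := Subtype.ext (Finsupp.ext h)

theorem apply_of_size_le (a : Partn) {N : ℕ} (h : a.size ≤ N) : a N = 0 :=
  a.eq_zero_of_le a.apply_size h

theorem size_eq_add_onCard {a b : Partn} {n : ℕ} {σ : Fin n → Bool}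
    (h : ∀ i, a i = b i + indSeq σ i) : a.size = b.size + onCard σ := by
  obtain ⟨M, hM, ha, hb⟩ : ∃ M, n ≤ M ∧ a M = 0 ∧ b M = 0 :=
    ⟨a.size + b.size + n, by omega, a.apply_of_size_le (by omega), b.apply_of_size_le (by omega)⟩
  rw [a.size_eq ha, b.size_eq hb, Finset.sum_congr rfl fun i _ => h i, Finset.sum_add_distrib]
  congr 1
  rw [← Finset.sum_subset (Finset.range_mono hM) fun i _ hi =>
    indSeq_of_le σ (by simpa using hi), Finset.sum_range]
  simp [onCard]

theorem size_le_size {a b : Partn} (h : ∀ i, b i ≤ a i) : b.size ≤ a.size := by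
  obtain ⟨M, ha, hb⟩ : ∃ M, a M = 0 ∧ b M = 0 :=
    ⟨a.size + b.size, a.apply_of_size_le (by omega), b.apply_of_size_le (by omega)⟩
  rw [b.size_eq hb, a.size_eq ha]
  exact Finset.sum_le_sum fun i _ => h i

theorem VertStrip.eq_add {a b : Partn} (h : a.VertStrip b) {n : ℕ} (hn : a n = 0) (i : ℕ) :
    a i = b i + indSeq (fun j : Fin n => decide (a j = b j + 1)) i := by
  have h1 := h i
  unfold indSeq
  split_ifs with h2 h3
  · simpa using h3
  · have : a i ≠ b i + 1 := by simpa using h3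
    omega
  · have := a.eq_zero_of_le hn (not_lt.1 h2)
    omega

theorem vertStrip_of_eq_add {a b : Partn} {n : ℕ} {σ : Fin n → Bool}
    (h : ∀ i, a i = b i + indSeq σ i) : a.VertStrip b := fun i => by
  have := indSeq_le σ i
  have := h i
  omega

theorem eq_decide_of_eq_add {a b : Partn} {n : ℕ} {σ : Fin n → Bool}
    (h : ∀ i, a i = b i + indSeq σ i) : (fun j : Fin n => decide (a j = b j + 1)) = σ := by
  ext j
  have := h j
  rw [indSeq_coe] at this
  cases hj : σ j <;> simp_all

end Partn

section

variable {q t : ℝ}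

theorem interlace_of_psiCoeff_ne_zero {a b : Partn} (h : psiCoeff q t a b ≠ 0) : a.Interlace b := by
  by_contra h0; exact h (if_neg h0)

theorem interlace_of_phiCoeff_ne_zero {a b : Partn} (h : phiCoeff q t a b ≠ 0) : a.Interlace b := by
  by_contra h0; exact h (if_neg h0)

theorem vertStrip_of_pieriCoeff_ne_zero {a b : Partn} (h : pieriCoeff q t a b ≠ 0) :
    a.VertStrip b := by
  by_contra h0; exact h (if_neg h0)

theorem sum_psi_pieri_up (h : Generic q t) (μ ν : Partn) {N : ℕ} (hμ : μ N = 0) (hν : ν N = 0)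
    (r : ℕ) :
    (∑ l ∈ Partn.ofSize (ν.size + r), psiCoeff q t l μ * pieriCoeff q t l ν) *
        (pairProd q t N μ * pairProd' q t (N + 1) ν) =
      ∑ σ : Fin (N + 1) → Bool with onCard σ = r,
        crossProd q t (N + 1) N (fun i => ν i + indSeq σ i) (fun i => μ i) *
          vratio (t / q)⁻¹ (fun i => spec q t ν i) σ := by
  rw [Finset.sum_mul]
  have hl : ∀ l : Partn, l.Interlace μ → l (N + 1) = 0 := fun l hI =>
    Nat.le_zero.1 (hμ ▸ (hI N).2)
  have hp : pairProd q t N μ * pairProd' q t (N + 1) ν ≠ 0 :=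
    (mul_pos (pairProd_pos h.q_pos.le h.q_lt h.t_pos.le h.t_lt N μ)
      (pairProd'_pos h.q_pos.le h.q_lt h.t_pos.le h.t_lt (N + 1) ν)).ne'
  have key : ∀ (l : Partn) (σ : Fin (N + 1) → Bool), (∀ i, l i = ν i + indSeq σ i) →
      l.Interlace μ → psiCoeff q t l μ * pieriCoeff q t l ν *
        (pairProd q t N μ * pairProd' q t (N + 1) ν) =
        crossProd q t (N + 1) N (fun i => ν i + indSeq σ i) (fun i => μ i) *
          vratio (t / q)⁻¹ (fun i => spec q t ν i) σ := by
    intro l σ hσ hI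
    have e1 := psiCoeff_mul h.q_pos.le h.q_lt h.t_pos.le h.t_lt (hl l hI) hμ
    have e2 := pieriCoeff_mul_pairProd' h (hl l hI) σ (fun i => by rw [hσ, indSeq_coe])
      (Partn.vertStrip_of_eq_add hσ)
    have e3 : crossProd q t (N + 1) N (fun i => ν i + indSeq σ i) (fun i => μ i) =
        crossProd q t (N + 1) N (fun i => l i) (fun i => μ i) := by
      simp only [hσ, Nat.cast_add]
    rw [e3, ← e1]
    linear_combination (psiCoeff q t l μ * pairProd q t N μ) * e2
  refine Finset.sum_bij_ne_zero (fun l _ _ => fun j : Fin (N + 1) => decide (l j = ν j + 1))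
    ?_ ?_ ?_ ?_
  · intro l hl1 hl2
    have hl3 := left_ne_zero_of_mul hl2
    have hI := interlace_of_psiCoeff_ne_zero (left_ne_zero_of_mul hl3)
    have hV := vertStrip_of_pieriCoeff_ne_zero (right_ne_zero_of_mul hl3)
    have h1 := Partn.size_eq_add_onCard (hV.eq_add (hl l hI))
    rw [Partn.mem_ofSize] at hl1
    simp only [Finset.mem_filter, Finset.mem_univ, true_and]
    omega
  · intro l hl1 hl2 l' hl1' hl2' heq
    have hl3 := left_ne_zero_of_mul hl2
    have hI := interlace_of_psiCoeff_ne_zero (left_ne_zero_of_mul hl3)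
    have hV := vertStrip_of_pieriCoeff_ne_zero (right_ne_zero_of_mul hl3)
    have hl3' := left_ne_zero_of_mul hl2'
    have hI' := interlace_of_psiCoeff_ne_zero (left_ne_zero_of_mul hl3')
    have hV' := vertStrip_of_pieriCoeff_ne_zero (right_ne_zero_of_mul hl3')
    refine Partn.ext' fun i => ?_
    rw [hV.eq_add (hl l hI), hV'.eq_add (hl l' hI'), heq]
  · intro σ hσ hne
    simp only [Finset.mem_filter, Finset.mem_univ, true_and] at hσ
    have hc := left_ne_zero_of_mul hne
    have hI1 : ∀ i, i < N → μ i ≤ ν i + indSeq σ i := fun i hi => by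
      exact_mod_cast le_of_crossProd_ne_zero hc (by omega) hi
    have hI2 : ∀ i, i < N → ν (i + 1) + indSeq σ (i + 1) ≤ μ i := fun i hi => by
      exact_mod_cast le_of_crossProd_ne_zero' hc (by omega) hi
    have hN1 : ∀ i, N < i → ν i + indSeq σ i = 0 := fun i hi => by
      rw [ν.eq_zero_of_le hν hi.le, indSeq_of_le σ hi]
    have hanti : Antitone fun i => ν i + indSeq σ i := antitone_nat_of_succ_le fun i => by
      rcases lt_or_ge i N with hi | hi
      · exact (hI2 i hi).trans (hI1 i hi)
      · rw [hN1 (i + 1) (by omega)]; exact Nat.zero_le _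
    let l : Partn := Partn.ofFun _ hanti (hN1 (N + 1) (by omega))
    have hlσ : ∀ i, l i = ν i + indSeq σ i := fun i => rfl
    have hI : l.Interlace μ := fun i => by
      rcases lt_or_ge i N with hi | hi
      · exact ⟨hI1 i hi, hI2 i hi⟩
      · rw [μ.eq_zero_of_le hμ hi, hlσ (i + 1), hN1 (i + 1) (by omega)]; simp
    refine ⟨l, ?_, ?_, Partn.eq_decide_of_eq_add hlσ⟩
    · rw [Partn.mem_ofSize, Partn.size_eq_add_onCard hlσ, hσ]; push_cast; rfl
    · rw [key l σ hlσ hI]; exact hne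
  · intro l hl1 hl2
    have hl3 := left_ne_zero_of_mul hl2
    have hI := interlace_of_psiCoeff_ne_zero (left_ne_zero_of_mul hl3)
    have hV := vertStrip_of_pieriCoeff_ne_zero (right_ne_zero_of_mul hl3)
    exact key l _ (hV.eq_add (hl l hI)) hI

theorem sum_psi_pieri_down (h : Generic q t) (μ ν : Partn) {N : ℕ} (hμ : μ N = 0) (hν : ν N = 0)
    (r : ℕ) :
    (∑ k ∈ Partn.ofSize (μ.size - r), pieriCoeff q t μ k * psiCoeff q t ν k) *
        (pairProd q t N μ * pairProd' q t (N + 1) ν) =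
      ∑ σ : Fin N → Bool with onCard σ = r,
        crossProd q t (N + 1) N (fun i => ν i) (fun i => μ i - indSeq σ i) *
          vratio (t / q) (fun i => spec q t μ i) σ := by
  rw [Finset.sum_mul]
  have key : ∀ (k : Partn) (σ : Fin N → Bool), (∀ i, μ i = k i + indSeq σ i) →
      pieriCoeff q t μ k * psiCoeff q t ν k * (pairProd q t N μ * pairProd' q t (N + 1) ν) =
        crossProd q t (N + 1) N (fun i => ν i) (fun i => μ i - indSeq σ i) *
          vratio (t / q) (fun i => spec q t μ i) σ := by
    intro k σ hσ
    have hk : k N = 0 := by have := hσ N; omega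
    have e1 := psiCoeff_mul (a := ν) h.q_pos.le h.q_lt h.t_pos.le h.t_lt
      (ν.eq_zero_of_le hν (Nat.le_succ N)) hk
    have e2 := pieriCoeff_mul_pairProd h hμ σ (fun i => by rw [hσ, indSeq_coe])
      (Partn.vertStrip_of_eq_add hσ)
    have e3 : crossProd q t (N + 1) N (fun i => ν i) (fun i => μ i - indSeq σ i) =
        crossProd q t (N + 1) N (fun i => ν i) (fun i => k i) := by
      simp only [hσ, Nat.cast_add, add_sub_cancel_right]
    rw [e3, ← e1]
    linear_combination (psiCoeff q t ν k * pairProd' q t (N + 1) ν) * e2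
  refine Finset.sum_bij_ne_zero (fun k _ _ => fun j : Fin N => decide (μ j = k j + 1))
    ?_ ?_ ?_ ?_
  · intro l hl1 hl2
    have hl3 := left_ne_zero_of_mul hl2
    have hV := vertStrip_of_pieriCoeff_ne_zero (left_ne_zero_of_mul hl3)
    have h1 := Partn.size_eq_add_onCard (hV.eq_add hμ)
    rw [Partn.mem_ofSize] at hl1
    simp only [Finset.mem_filter, Finset.mem_univ, true_and]
    omega
  · intro l hl1 hl2 l' hl1' hl2' heq
    have hV := vertStrip_of_pieriCoeff_ne_zero (left_ne_zero_of_mul (left_ne_zero_of_mul hl2))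
    have hV' := vertStrip_of_pieriCoeff_ne_zero (left_ne_zero_of_mul (left_ne_zero_of_mul hl2'))
    refine Partn.ext' fun i => ?_
    have e1 := hV.eq_add hμ i
    have e2 := hV'.eq_add hμ i
    rw [heq] at e1
    omega
  · intro σ hσ hne
    simp only [Finset.mem_filter, Finset.mem_univ, true_and] at hσ
    have hc := left_ne_zero_of_mul hne
    have hI1 : ∀ i, i < N → (μ i : ℤ) - indSeq σ i ≤ ν i := fun i hi => by
      exact_mod_cast le_of_crossProd_ne_zero hc (by omega) hi
    have hI2 : ∀ i, i < N → (ν (i + 1) : ℤ) ≤ (μ i : ℤ) - indSeq σ i := fun i hi => by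
      exact_mod_cast le_of_crossProd_ne_zero' hc (by omega) hi
    have hN1 : ∀ i, N ≤ i → μ i = 0 ∧ indSeq σ i = 0 := fun i hi =>
      ⟨μ.eq_zero_of_le hμ hi, indSeq_of_le σ hi⟩
    have hanti : Antitone fun i => μ i - indSeq σ i := antitone_nat_of_succ_le fun i => by
      rcases lt_or_ge (i + 1) N with hi | hi
      · have := hI2 i (by omega)
        have := hI1 (i + 1) hi
        omega
      · have := hN1 _ hi
        omega
    have hN0 : μ N - indSeq σ N = 0 := by rw [hμ, Nat.zero_sub]
    let k : Partn := Partn.ofFun _ hanti hN0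
    have hkσ : ∀ i, μ i = k i + indSeq σ i := fun i => by
      change μ i = μ i - indSeq σ i + indSeq σ i
      rcases lt_or_ge i N with hi | hi
      · have := hI2 i hi
        omega
      · have := hN1 i hi
        omega
    refine ⟨k, ?_, ?_, Partn.eq_decide_of_eq_add hkσ⟩
    · rw [Partn.mem_ofSize, Partn.size_eq_add_onCard hkσ, hσ]; push_cast; ring
    · rw [key k σ hkσ]; exact hne
  · intro l hl1 hl2
    have hV := vertStrip_of_pieriCoeff_ne_zero (left_ne_zero_of_mul (left_ne_zero_of_mul hl2))
    exact key l _ (hV.eq_add hμ)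

theorem sum_phi_pieri (h : Generic q t) (l μ : Partn) {N : ℕ} (hl : l N = 0) (hμ : μ N = 0)
    (r : ℕ) :
    (∑ ρ ∈ Partn.ofSize (μ.size + r), phiCoeff q t l ρ * pieriCoeff q t ρ μ) *
        (pairProd q t N l * pairProd' q t N μ) =
      ∑ σ : Fin N → Bool with onCard σ = r,
        crossProd q t N N (fun i => l i) (fun i => μ i + indSeq σ i) *
          vratio (t / q)⁻¹ (fun i => spec q t μ i) σ := by
  rw [Finset.sum_mul]
  have hρ : ∀ ρ : Partn, l.Interlace ρ → ρ N = 0 := fun ρ hI => Nat.le_zero.1 (hl ▸ (hI N).1)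
  have key : ∀ (ρ : Partn) (σ : Fin N → Bool), (∀ i, ρ i = μ i + indSeq σ i) →
      phiCoeff q t l ρ * pieriCoeff q t ρ μ * (pairProd q t N l * pairProd' q t N μ) =
        crossProd q t N N (fun i => l i) (fun i => μ i + indSeq σ i) *
          vratio (t / q)⁻¹ (fun i => spec q t μ i) σ := by
    intro ρ σ hσ
    have hρN : ρ N = 0 := by rw [hσ, hμ, indSeq_of_le σ le_rfl]
    have e1 := phiCoeff_mul h.q_pos.le h.q_lt h.t_pos.le h.t_lt hl hρN
    have e2 := pieriCoeff_mul_pairProd' h hρN σ (fun i => by rw [hσ, indSeq_coe])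
      (Partn.vertStrip_of_eq_add hσ)
    have e3 : crossProd q t N N (fun i => l i) (fun i => μ i + indSeq σ i) =
        crossProd q t N N (fun i => l i) (fun i => ρ i) := by
      simp only [hσ, Nat.cast_add]
    rw [e3, ← e1]
    linear_combination (phiCoeff q t l ρ * pairProd q t N l) * e2
  refine Finset.sum_bij_ne_zero (fun ρ _ _ => fun j : Fin N => decide (ρ j = μ j + 1))
    ?_ ?_ ?_ ?_
  · intro ρ hl1 hl2
    have hl3 := left_ne_zero_of_mul hl2
    have hI := interlace_of_phiCoeff_ne_zero (left_ne_zero_of_mul hl3)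
    have hV := vertStrip_of_pieriCoeff_ne_zero (right_ne_zero_of_mul hl3)
    have h1 := Partn.size_eq_add_onCard (hV.eq_add (hρ ρ hI))
    rw [Partn.mem_ofSize] at hl1
    simp only [Finset.mem_filter, Finset.mem_univ, true_and]
    omega
  · intro ρ hl1 hl2 ρ' hl1' hl2' heq
    have hl3 := left_ne_zero_of_mul hl2
    have hI := interlace_of_phiCoeff_ne_zero (left_ne_zero_of_mul hl3)
    have hV := vertStrip_of_pieriCoeff_ne_zero (right_ne_zero_of_mul hl3)
    have hl3' := left_ne_zero_of_mul hl2'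
    have hI' := interlace_of_phiCoeff_ne_zero (left_ne_zero_of_mul hl3')
    have hV' := vertStrip_of_pieriCoeff_ne_zero (right_ne_zero_of_mul hl3')
    refine Partn.ext' fun i => ?_
    rw [hV.eq_add (hρ ρ hI), hV'.eq_add (hρ ρ' hI'), heq]
  · intro σ hσ hne
    simp only [Finset.mem_filter, Finset.mem_univ, true_and] at hσ
    have hc := left_ne_zero_of_mul hne
    have hI1 : ∀ i, i < N → μ i + indSeq σ i ≤ l i := fun i hi => by
      exact_mod_cast le_of_crossProd_ne_zero hc hi hi
    have hI2 : ∀ i, i + 1 < N → l (i + 1) ≤ μ i + indSeq σ i := fun i hi => by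
      exact_mod_cast le_of_crossProd_ne_zero' hc hi (by omega)
    have hN1 : ∀ i, N ≤ i → μ i + indSeq σ i = 0 := fun i hi => by
      rw [μ.eq_zero_of_le hμ hi, indSeq_of_le σ hi]
    have hanti : Antitone fun i => μ i + indSeq σ i := antitone_nat_of_succ_le fun i => by
      rcases lt_or_ge (i + 1) N with hi | hi
      · exact (hI1 _ hi).trans (hI2 i hi)
      · rw [hN1 _ hi]; exact Nat.zero_le _
    let ρ : Partn := Partn.ofFun _ hanti (hN1 N le_rfl)
    have hρσ : ∀ i, ρ i = μ i + indSeq σ i := fun i => rfl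
    refine ⟨ρ, ?_, ?_, Partn.eq_decide_of_eq_add hρσ⟩
    · rw [Partn.mem_ofSize, Partn.size_eq_add_onCard hρσ, hσ]; push_cast; rfl
    · rw [key ρ σ hρσ]; exact hne
  · intro ρ hl1 hl2
    have hl3 := left_ne_zero_of_mul hl2
    have hI := interlace_of_phiCoeff_ne_zero (left_ne_zero_of_mul hl3)
    have hV := vertStrip_of_pieriCoeff_ne_zero (right_ne_zero_of_mul hl3)
    exact key ρ _ (hV.eq_add (hρ ρ hI))

/-- Horizontal and vertical strips commute up to a correction of one box in each. -/
theorem psi_pieri_comm (h : Generic q t) (μ ν : Partn) (r : ℕ) :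
    ∑ l ∈ Partn.ofSize (ν.size + (r + 1 : ℕ)), psiCoeff q t l μ * pieriCoeff q t l ν =
      ∑ k ∈ Partn.ofSize (μ.size - (r + 1 : ℕ)), pieriCoeff q t μ k * psiCoeff q t ν k +
        ∑ k ∈ Partn.ofSize (μ.size - r), pieriCoeff q t μ k * psiCoeff q t ν k := by
  have hμ := μ.apply_of_size_le (Nat.le_add_right _ ν.size)
  have hν := ν.apply_of_size_le (Nat.le_add_left _ μ.size)
  have hp : pairProd q t (μ.size + ν.size) μ * pairProd' q t (μ.size + ν.size + 1) ν ≠ 0 :=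
    (mul_pos (pairProd_pos h.q_pos.le h.q_lt h.t_pos.le h.t_lt _ μ)
      (pairProd'_pos h.q_pos.le h.q_lt h.t_pos.le h.t_lt _ ν)).ne'
  apply mul_right_cancel₀ hp
  rw [add_mul, sum_psi_pieri_up h μ ν hμ hν, sum_psi_pieri_down h μ ν hμ hν,
    sum_psi_pieri_down h μ ν hμ hν]
  have key := coeff_compare _ _ _ _ (fun v => by
    have := sum_crossProd_bordered h ν.anti μ.anti (μ.size + ν.size) v
    simp only [prod_ite_eq_pow_onCard] at this
    exact this) (r + 1)
  simpa only [Nat.add_right_cancel_iff] using key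

/-- The linear relation expressing horizontal strips through vertical strips. -/
theorem phi_pieri_relation (h : Generic q t) (l μ : Partn) {k : ℕ} (hk : l.size = μ.size + k) :
    ∑ r ∈ Finset.range (k + 1), (-1) ^ r * (1 - t ^ r * q ^ (k - r)) *
      ∑ ρ ∈ Partn.ofSize (μ.size + r), phiCoeff q t l ρ * pieriCoeff q t ρ μ = 0 := by
  have hq := h.q_pos.ne'
  have ht := h.t_pos.ne'
  set N := l.size with hNdef
  have hl : l N = 0 := l.apply_size
  have hμ : μ N = 0 := μ.apply_of_size_le (by omega)
  have hp : pairProd q t N l * pairProd' q t N μ ≠ 0 :=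
    (mul_pos (pairProd_pos h.q_pos.le h.q_lt h.t_pos.le h.t_lt _ l)
      (pairProd'_pos h.q_pos.le h.q_lt h.t_pos.le h.t_lt _ μ)).ne'
  have hY : (∏ i : Fin N, spec q t μ i) ≠ 0 :=
    Finset.prod_ne_zero_iff.2 fun i _ => spec_ne_zero h μ i
  have hM : (∏ i : Fin N, spec q t l i) = q ^ k * ∏ i : Fin N, spec q t μ i := by
    have e : ∀ a : Partn, a N = 0 →
        (∏ i : Fin N, spec q t a i) = q ^ a.size * ∏ i : Fin N, (t ^ (i : ℕ))⁻¹ := by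
      intro a ha
      rw [a.size_eq ha, ← Finset.prod_pow_eq_pow_sum, Finset.prod_range, ← Finset.prod_mul_distrib]
      rfl
    rw [e l hl, e μ hμ, ← hNdef, hk, pow_add]
    ring
  have key := sum_crossProd_square h l.anti μ.anti N
  apply mul_right_cancel₀ (mul_ne_zero hY hp)
  rw [zero_mul, ← key, ← Finset.sum_fiberwise_of_maps_to (s := Finset.univ)
    (t := Finset.range (N + 1)) (g := onCard)
    (fun σ _ => Finset.mem_range.2 (Nat.lt_succ_iff.2 (onCard_le σ))), Finset.sum_mul]
  have hterm : ∀ r, ∑ σ : Fin N → Bool with onCard σ = r,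
      ((∏ i : Fin N, spec q t μ i) * (∏ i, if σ i then -1 else 1) -
        (∏ i : Fin N, spec q t l i) * ∏ i, if σ i then -(t / q) else 1) *
        (crossProd q t N N (fun i => l i) (fun i => μ i + indSeq σ i) *
          vratio (t / q)⁻¹ (fun i => spec q t μ i) σ) =
      ((∏ i : Fin N, spec q t μ i) * (-1) ^ r * (1 - q ^ k * (t / q) ^ r)) *
      ((∑ ρ ∈ Partn.ofSize (μ.size + r), phiCoeff q t l ρ * pieriCoeff q t ρ μ) *
        (pairProd q t N l * pairProd' q t N μ)) := by
    intro r
    rw [sum_phi_pieri h l μ hl hμ r, Finset.mul_sum]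
    refine Finset.sum_congr rfl fun σ hσ => ?_
    simp only [Finset.mem_filter, Finset.mem_univ, true_and] at hσ
    rw [prod_ite_eq_pow_onCard, prod_ite_eq_pow_onCard, hσ, hM, neg_pow (t / q)]
    ring
  rw [Finset.sum_congr rfl fun r _ => hterm r]
  rw [← Finset.sum_subset (Finset.range_mono (by omega : k + 1 ≤ N + 1))]
  · refine Finset.sum_congr rfl fun r hr => ?_
    have hr' : r ≤ k := Nat.lt_succ_iff.1 (Finset.mem_range.1 hr)
    have e : t ^ r * q ^ (k - r) = q ^ k * (t / q) ^ r := by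
      obtain ⟨m, rfl⟩ := Nat.exists_eq_add_of_le hr'
      rw [Nat.add_sub_cancel_left, pow_add, div_pow]
      field_simp
    rw [e]
    ring
  · intro r _ hr
    rw [Finset.mem_range] at hr
    rw [Finset.sum_eq_zero, zero_mul, mul_zero]
    intro ρ hρ
    rw [Partn.mem_ofSize] at hρ
    by_contra hne
    have hI := interlace_of_phiCoeff_ne_zero (left_ne_zero_of_mul hne)
    have := Partn.size_le_size fun i => (hI i).1
    omega

end

theorem sum_antidiagonal_swap_inner {M : Type*} [AddCommMonoid M] (f : ℕ → ℕ → ℕ → M) (k : ℕ) :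
    ∑ p ∈ Finset.HasAntidiagonal.antidiagonal k,
        ∑ r ∈ Finset.HasAntidiagonal.antidiagonal p.2, f p.1 r.1 r.2 =
      ∑ p ∈ Finset.HasAntidiagonal.antidiagonal k,
        ∑ r ∈ Finset.HasAntidiagonal.antidiagonal p.2, f r.1 p.1 r.2 := by
  rw [Finset.sum_sigma', Finset.sum_sigma']
  refine Finset.sum_nbij' (fun x => ⟨(x.2.1, x.1.1 + x.2.2), (x.1.1, x.2.2)⟩)
    (fun x => ⟨(x.2.1, x.1.1 + x.2.2), (x.1.1, x.2.2)⟩) ?_ ?_ ?_ ?_ ?_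
  · rintro ⟨⟨a, b⟩, ⟨c, d⟩⟩ hx
    simp at hx ⊢; omega
  · rintro ⟨⟨a, b⟩, ⟨c, d⟩⟩ hx
    simp at hx ⊢; omega
  · rintro ⟨⟨a, b⟩, ⟨c, d⟩⟩ hx
    simp at hx ⊢; omega
  · rintro ⟨⟨a, b⟩, ⟨c, d⟩⟩ hx
    simp at hx ⊢; omega
  · rintro ⟨⟨a, b⟩, ⟨c, d⟩⟩ _
    rfl

/-- The coefficients of the series `(tz; q)_∞ / (z; q)_∞`. -/
noncomputable def qbinom (q t : ℝ) (n : ℕ) : ℝ :=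
  ∏ i ∈ Finset.range n, (1 - t * q ^ i) / (1 - q ^ (i + 1))

section exchange

variable {q t : ℝ} {R : Type*} [Ring R] [Algebra ℝ R]

theorem qbinom_succ_mul (hq : ∀ n : ℕ, q ^ (n + 1) ≠ 1) (n : ℕ) :
    qbinom q t (n + 1) * (1 - q ^ (n + 1)) = qbinom q t n * (1 - t * q ^ n) := by
  have : 1 - q ^ (n + 1) ≠ 0 := sub_ne_zero.2 (hq n).symm
  rw [qbinom, qbinom, Finset.prod_range_succ]
  field_simp

/-- From the relation between the `e`'s and the `h`'s and the exchange relation of `e` and `g`,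
the exchange relation of `h` and `g` follows. -/
theorem exchange_of_relations (hq : ∀ n : ℕ, q ^ (n + 1) ≠ 1) (e h : ℕ → R) (g : ℤ → R)
    (he : e 0 = 1) (hh : h 0 = 1)
    (heg : ∀ r m, e (r + 1) * g m = g m * e (r + 1) + g (m - 1) * e r)
    (heh : ∀ k, ∑ p ∈ Finset.HasAntidiagonal.antidiagonal k,
      ((-1) ^ p.1 * (1 - t ^ p.1 * q ^ p.2)) • (e p.1 * h p.2) = 0)
    (k : ℕ) (m : ℤ) :
    h k * g m = ∑ p ∈ Finset.HasAntidiagonal.antidiagonal k,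
      qbinom q t p.1 • (g (m - p.1) * h p.2) := by
  induction k using Nat.strong_induction_on generalizing m with
  | _ k ih =>
  rcases k with _ | k
  · simp [hh, qbinom]
  set X : ℕ → R := fun l =>
    ∑ p ∈ Finset.HasAntidiagonal.antidiagonal l, qbinom q t p.1 • (g (m - p.1) * h p.2) with hX
  set Y : ℕ → R := fun n => ∑ p ∈ Finset.HasAntidiagonal.antidiagonal n,
    (-1 : ℝ) ^ p.1 • (e p.1 * h p.2) with hY
  obtain ⟨e', he0, heS⟩ : ∃ e' : ℕ → R, e' 0 = 0 ∧ ∀ r, e' (r + 1) = e r :=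
    ⟨fun r => Nat.casesOn r 0 e, rfl, fun _ => rfl⟩
  have hW : ∀ n, ∑ p ∈ Finset.HasAntidiagonal.antidiagonal n,
      ((-1) ^ p.1 * (t ^ p.1 * q ^ p.2)) • (e p.1 * h p.2) = Y n := by
    intro n
    rw [eq_comm, ← sub_eq_zero, ← heh n, hY, ← Finset.sum_sub_distrib]
    refine Finset.sum_congr rfl fun p _ => ?_
    rw [← sub_smul]; congr 1; ring
  have heg' : ∀ r m, e r * g m = g m * e r + g (m - 1) * e' r := by
    rintro (_ | r) m
    · simp [he, he0]
    · rw [heS, heg]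
  have hU : ∀ j n, ∑ p ∈ Finset.HasAntidiagonal.antidiagonal n,
      ((-1) ^ p.1 * (1 - t ^ p.1 * q ^ (j + p.2))) • (e p.1 * h p.2) = (1 - q ^ j) • Y n := by
    intro j n
    rw [sub_smul, one_smul]
    nth_rw 2 [← hW n]
    rw [hY, Finset.smul_sum, ← Finset.sum_sub_distrib]
    refine Finset.sum_congr rfl fun p _ => ?_
    rw [smul_smul, ← sub_smul]; congr 1; ring
  have hV : ∀ j n, ∑ p ∈ Finset.HasAntidiagonal.antidiagonal (n + 1),
      ((-1) ^ p.1 * (1 - t ^ p.1 * q ^ (j + p.2))) • (e' p.1 * h p.2) =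
        -((1 - t * q ^ j) • Y n) := by
    intro j n
    rw [Finset.Nat.sum_antidiagonal_succ]
    simp only [he0, heS, zero_mul, smul_zero, zero_add]
    rw [sub_smul, one_smul]
    nth_rw 2 [← hW n]
    rw [hY, Finset.smul_sum, ← Finset.sum_sub_distrib, ← Finset.sum_neg_distrib]
    refine Finset.sum_congr rfl fun p _ => ?_
    rw [smul_smul, ← sub_smul, ← neg_smul]; congr 1; ring
  have hzero : ∑ p ∈ Finset.HasAntidiagonal.antidiagonal (k + 1),
      ((-1) ^ p.1 * (1 - t ^ p.1 * q ^ p.2)) • (e p.1 * X p.2) = 0 := by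
    have h1 : ∀ p : ℕ × ℕ, ((-1) ^ p.1 * (1 - t ^ p.1 * q ^ p.2)) • (e p.1 * X p.2) =
        ∑ r ∈ Finset.HasAntidiagonal.antidiagonal p.2,
          ((-1) ^ p.1 * (1 - t ^ p.1 * q ^ (r.1 + r.2))) •
          (e p.1 * (qbinom q t r.1 • (g (m - r.1) * h r.2))) := by
      intro p
      rw [hX, Finset.mul_sum, Finset.smul_sum]
      refine Finset.sum_congr rfl fun r hr => ?_
      rw [Finset.HasAntidiagonal.mem_antidiagonal.1 hr]
    rw [Finset.sum_congr rfl fun p _ => h1 p, sum_antidiagonal_swap_inner (M := R) fun a b c =>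
      ((-1 : ℝ) ^ a * (1 - t ^ a * q ^ (b + c))) • (e a * (qbinom q t b • (g (m - b) * h c)))]
    have h2 : ∀ p : ℕ × ℕ, ∑ r ∈ Finset.HasAntidiagonal.antidiagonal p.2,
        ((-1) ^ r.1 * (1 - t ^ r.1 * q ^ (p.1 + r.2))) •
          (e r.1 * (qbinom q t p.1 • (g (m - p.1) * h r.2))) =
        qbinom q t p.1 • (g (m - p.1) * ∑ r ∈ Finset.HasAntidiagonal.antidiagonal p.2,
          ((-1) ^ r.1 * (1 - t ^ r.1 * q ^ (p.1 + r.2))) • (e r.1 * h r.2)) +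
        qbinom q t p.1 • (g (m - p.1 - 1) * ∑ r ∈ Finset.HasAntidiagonal.antidiagonal p.2,
          ((-1) ^ r.1 * (1 - t ^ r.1 * q ^ (p.1 + r.2))) • (e' r.1 * h r.2)) := by
      intro p
      rw [Finset.mul_sum, Finset.mul_sum, Finset.smul_sum, Finset.smul_sum,
        ← Finset.sum_add_distrib]
      refine Finset.sum_congr rfl fun r _ => ?_
      rw [mul_smul_comm, ← mul_assoc, heg', add_mul, mul_smul_comm, mul_smul_comm, mul_assoc,
        mul_assoc, smul_add, smul_add, smul_comm, smul_comm (qbinom q t p.1)]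
      congr 1
      rw [smul_comm]
    rw [Finset.sum_congr rfl fun p _ => h2 p, Finset.sum_add_distrib]
    simp only [hU]
    rw [Finset.Nat.sum_antidiagonal_succ, Finset.Nat.sum_antidiagonal_succ' (f := fun p => _ • _)]
    simp only [hV, pow_zero, sub_self, zero_smul, mul_zero, smul_zero, zero_add,
      Finset.HasAntidiagonal.antidiagonal_zero, Finset.sum_singleton, he0, zero_mul]
    rw [← Finset.sum_add_distrib]
    refine Finset.sum_eq_zero fun p _ => ?_
    rw [mul_neg, smul_neg, mul_smul_comm, mul_smul_comm, smul_smul, smul_smul,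
      qbinom_succ_mul hq, Nat.cast_succ, sub_sub, add_neg_cancel]
  have hfull : ∑ p ∈ Finset.HasAntidiagonal.antidiagonal (k + 1),
      ((-1) ^ p.1 * (1 - t ^ p.1 * q ^ p.2)) • (e p.1 * (h p.2 * g m)) = 0 := by
    rw [← zero_mul (g m), ← heh (k + 1), Finset.sum_mul]
    refine Finset.sum_congr rfl fun p _ => ?_
    rw [smul_mul_assoc, mul_assoc]
  rw [Finset.Nat.sum_antidiagonal_succ] at hzero hfull
  have htail : ∑ p ∈ Finset.HasAntidiagonal.antidiagonal k,
      ((-1) ^ (p.1 + 1) * (1 - t ^ (p.1 + 1) * q ^ p.2)) •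
      (e (p.1 + 1) * X p.2) = ∑ p ∈ Finset.HasAntidiagonal.antidiagonal k,
        ((-1) ^ (p.1 + 1) * (1 - t ^ (p.1 + 1) * q ^ p.2)) • (e (p.1 + 1) * (h p.2 * g m)) := by
    refine Finset.sum_congr rfl fun p hp => ?_
    rw [ih p.2 (by have := Finset.HasAntidiagonal.mem_antidiagonal.1 hp; omega) m]
  rw [htail, ← hfull] at hzero
  have h3 := add_right_cancel hzero
  simp only [pow_zero, one_mul, he] at h3
  exact (smul_right_injective R (sub_ne_zero.2 (hq k).symm) h3).symm

end exchange

theorem Partn.eq_of_le_of_size_eq {a b : Partn} (h : ∀ i, b i ≤ a i) (hs : a.size = b.size) :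
    a = b := by
  refine Partn.ext' fun i => ?_
  obtain ⟨M, hM, ha, hb⟩ : ∃ M, i < M ∧ a M = 0 ∧ b M = 0 :=
    ⟨a.size + b.size + i + 1, by omega, a.apply_of_size_le (by omega),
      b.apply_of_size_le (by omega)⟩
  rw [a.size_eq ha, b.size_eq hb, eq_comm, Finset.sum_eq_sum_iff_of_le fun i _ => h i] at hs
  exact (hs i (Finset.mem_range.2 hM)).symm

section operators

/-- The operator on the span of all partitions with kernel `K`, homogeneous of degree `m`. -/
noncomputable def gradedOp (K : Partn → Partn → ℝ) (m : ℤ) : Module.End ℝ (Partn →₀ ℝ) :=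
  Finsupp.linearCombination ℝ fun a =>
    ∑ b ∈ Partn.ofSize (a.size + m), Finsupp.single b (K a b)

theorem gradedOp_single (K : Partn → Partn → ℝ) (m : ℤ) (a : Partn) (x : ℝ) :
    gradedOp K m (Finsupp.single a x) =
      x • ∑ b ∈ Partn.ofSize (a.size + m), Finsupp.single b (K a b) :=
  Finsupp.linearCombination_single ..

open scoped Classical in
theorem gradedOp_single_apply (K : Partn → Partn → ℝ) (m : ℤ) (a c : Partn) :
    gradedOp K m (Finsupp.single a 1) c = if (c.size : ℤ) = a.size + m then K a c else 0 := by
  rw [gradedOp_single, one_smul, Finsupp.finsetSum_apply]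
  simp only [Finsupp.single_apply, Finset.sum_ite_eq', Partn.mem_ofSize]

open scoped Classical in
theorem gradedOp_mul_single_apply (K L : Partn → Partn → ℝ) (m n : ℤ) (a c : Partn) :
    (gradedOp K m * gradedOp L n) (Finsupp.single a 1) c =
      if (c.size : ℤ) = a.size + n + m then
        ∑ b ∈ Partn.ofSize (a.size + n), L a b * K b c else 0 := by
  rw [Module.End.mul_apply, gradedOp_single, one_smul, map_sum, Finsupp.finsetSum_apply]
  rw [← Finset.sum_const_zero (s := Partn.ofSize (a.size + n)), ← Finset.sum_ite_irrel]
  refine Finset.sum_congr rfl fun b hb => ?_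
  rw [Partn.mem_ofSize] at hb
  rw [← mul_one (L a b), ← smul_eq_mul, ← Finsupp.smul_single, map_smul, Finsupp.smul_apply,
    gradedOp_single_apply, hb]
  split_ifs <;> simp

theorem End_ext_single {f g : Module.End ℝ (Partn →₀ ℝ)}
    (h : ∀ a c, f (Finsupp.single a 1) c = g (Finsupp.single a 1) c) : f = g :=
  Finsupp.lhom_ext' fun a => LinearMap.ext_ring (Finsupp.ext fun c => h a c)

theorem gradedOp_zero_eq_one {K : Partn → Partn → ℝ} (h1 : ∀ a, K a a = 1)
    (h0 : ∀ a b, a.size = b.size → K a b ≠ 0 → a = b) : gradedOp K 0 = 1 := by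
  classical
  refine End_ext_single fun a c => ?_
  rw [gradedOp_single_apply, Module.End.one_apply, Finsupp.single_apply]
  by_cases hac : a = c
  · subst hac; simp [h1]
  · rw [if_neg hac]
    split_ifs with hs
    · by_contra hK
      exact hac (h0 a c (by omega) hK)
    · rfl

variable {q t : ℝ}

theorem phiCoeff_self (hq0 : 0 ≤ q) (hq1 : q < 1) (ht0 : 0 ≤ t) (ht1 : t < 1) (a : Partn) :
    phiCoeff q t a a = 1 := by
  rw [phiCoeff, if_pos (show a.Interlace a from fun i => ⟨le_rfl, a.anti (Nat.le_succ i)⟩)]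
  exact Finset.prod_eq_one fun j _ => Finset.prod_eq_one fun i _ =>
    div_self (mul_pos (fmac_pos hq0 hq1 ht0 ht1 _ _) (fmac_pos hq0 hq1 ht0 ht1 _ _)).ne'

theorem pieriCoeff_self (a : Partn) : pieriCoeff q t a a = 1 := by
  rw [pieriCoeff, if_pos (show a.VertStrip a from fun i => ⟨le_rfl, Nat.le_succ _⟩)]
  exact Finset.prod_eq_one fun j _ => Finset.prod_eq_one fun i _ => if_neg (by omega)

theorem Generic.pow_ne_one (h : Generic q t) (n : ℕ) : q ^ (n + 1) ≠ 1 :=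
  (pow_lt_one₀ h.q_pos.le h.q_lt n.succ_ne_zero).ne

theorem gradedOp_pieri_psi (h : Generic q t) (r : ℕ) (m : ℤ) :
    gradedOp (pieriCoeff q t) (-(r + 1 : ℕ)) * gradedOp (fun a b => psiCoeff q t b a) m =
      gradedOp (fun a b => psiCoeff q t b a) m * gradedOp (pieriCoeff q t) (-(r + 1 : ℕ)) +
        gradedOp (fun a b => psiCoeff q t b a) (m - 1) * gradedOp (pieriCoeff q t) (-(r : ℤ)) := by
  refine End_ext_single fun μ ν => ?_
  rw [LinearMap.add_apply, Finsupp.add_apply]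
  simp only [gradedOp_mul_single_apply]
  by_cases hs : (ν.size : ℤ) = μ.size + m + -(r + 1 : ℕ)
  · rw [if_pos hs, if_pos (by omega), if_pos (by push_cast at hs; omega),
      show (μ.size : ℤ) + m = ν.size + (r + 1 : ℕ) by omega]
    exact psi_pieri_comm h μ ν r
  · rw [if_neg hs, if_neg (by omega), if_neg (by push_cast at hs; omega), add_zero]

theorem gradedOp_pieri_phi (h : Generic q t) (k : ℕ) :
    ∑ p ∈ Finset.HasAntidiagonal.antidiagonal k, ((-1) ^ p.1 * (1 - t ^ p.1 * q ^ p.2)) •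
      (gradedOp (pieriCoeff q t) (-(p.1 : ℤ)) * gradedOp (phiCoeff q t) (-(p.2 : ℤ))) = 0 := by
  refine End_ext_single fun l μ => ?_
  rw [LinearMap.sum_apply, Finsupp.finsetSum_apply, LinearMap.zero_apply, Finsupp.zero_apply]
  simp only [LinearMap.smul_apply, Finsupp.smul_apply, gradedOp_mul_single_apply, smul_eq_mul]
  by_cases hs : l.size = μ.size + k
  · rw [Finset.Nat.sum_antidiagonal_eq_sum_range_succ_mk, ← phi_pieri_relation h l μ hs]
    refine Finset.sum_congr rfl fun r hr => ?_
    have hr' := Finset.mem_range.1 hr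
    rw [if_pos (by omega),
      show (l.size : ℤ) + -((k - r : ℕ) : ℤ) = μ.size + r by omega]
  · refine Finset.sum_eq_zero fun p hp => ?_
    have := Finset.HasAntidiagonal.mem_antidiagonal.1 hp
    rw [if_neg (by omega), mul_zero]

/-- The degree by degree skew Cauchy identity for generic parameters. -/
theorem sum_psi_phi_of_generic (h : Generic q t) (μ ν : Partn) (k : ℕ) :
    ∑ l ∈ Partn.ofSize (ν.size + k), psiCoeff q t l μ * phiCoeff q t l ν =
      ∑ p ∈ Finset.HasAntidiagonal.antidiagonal k, qbinom q t p.1 *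
        ∑ σ ∈ Partn.ofSize (μ.size - p.2), phiCoeff q t μ σ * psiCoeff q t ν σ := by
  have key := exchange_of_relations (t := t) h.pow_ne_one
    (fun r => gradedOp (pieriCoeff q t) (-(r : ℤ))) (fun r => gradedOp (phiCoeff q t) (-(r : ℤ)))
    (gradedOp fun a b => psiCoeff q t b a)
    (by
      simpa using gradedOp_zero_eq_one pieriCoeff_self fun a b hs hK => Partn.eq_of_le_of_size_eq
        (fun i => (vertStrip_of_pieriCoeff_ne_zero hK i).1) hs)
    (by
      simpa using gradedOp_zero_eq_one (phiCoeff_self h.q_pos.le h.q_lt h.t_pos.le h.t_lt)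
        fun a b hs hK => Partn.eq_of_le_of_size_eq
          (fun i => (interlace_of_phiCoeff_ne_zero hK i).1) hs)
    (gradedOp_pieri_psi h) (gradedOp_pieri_phi h) k (ν.size + k - μ.size)
  have key' := DFunLike.congr_fun (DFunLike.congr_fun key (Finsupp.single μ 1)) ν
  rw [LinearMap.sum_apply, Finsupp.finsetSum_apply] at key'
  simp only [LinearMap.smul_apply, Finsupp.smul_apply, gradedOp_mul_single_apply,
    smul_eq_mul] at key'
  rw [if_pos (by omega), add_sub_cancel] at key'
  rw [key']
  refine Finset.sum_congr rfl fun p hp => ?_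
  have := Finset.HasAntidiagonal.mem_antidiagonal.1 hp
  rw [if_pos (by push_cast [← this]; ring)]
  rfl

end operators

section density

open Set

theorem subset_closure_generic :
    Ico (0 : ℝ) 1 ×ˢ Ico (0 : ℝ) 1 ⊆ closure {p : ℝ × ℝ | Generic p.1 p.2} := by
  rintro ⟨q, t⟩ ⟨⟨hq0, hq1⟩, ⟨ht0, ht1⟩⟩
  dsimp only at hq0 hq1 ht0 ht1
  rw [Metric.mem_closure_iff]
  intro ε hε
  obtain ⟨q', hq', hq'1⟩ := exists_between (lt_min hq1 (lt_add_of_pos_right q hε))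
  have hc : (⋃ a : ℕ, ⋃ b : ℕ, {x : ℝ | 0 < x ∧ x ^ (a + 1) = q' ^ (b + 1)}).Countable := by
    refine countable_iUnion fun a => countable_iUnion fun b => Set.Subsingleton.countable ?_
    rintro x ⟨hx, hx'⟩ y ⟨hy, hy'⟩
    exact (pow_left_inj₀ hx.le hy.le (Nat.succ_ne_zero a)).1 (hx'.trans hy'.symm)
  obtain ⟨t', htc, ht', ht'1⟩ := (hc.dense_compl ℝ).exists_mem_open isOpen_Ioo
    (nonempty_Ioo.2 (lt_min ht1 (lt_add_of_pos_right t hε)))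
  rw [lt_min_iff] at hq'1 ht'1
  simp only [mem_compl_iff, mem_iUnion, not_exists] at htc
  refine ⟨(q', t'), ⟨hq0.trans_lt hq', hq'1.1, ht0.trans_lt ht', ht'1.1, fun a b hab =>
    htc a b ⟨ht0.trans_lt ht', hab⟩⟩, ?_⟩
  rw [Prod.dist_eq, max_lt_iff, Real.dist_eq, Real.dist_eq, abs_sub_lt_iff, abs_sub_lt_iff]
  dsimp only
  constructor <;> constructor <;> linarith [hq'1.2, ht'1.2]

end density

section extension

open Set

theorem continuousOn_fmac (n m : ℕ) :
    ContinuousOn (fun p : ℝ × ℝ => fmac p.1 p.2 n m) (Ico (0 : ℝ) 1 ×ˢ Ico (0 : ℝ) 1) := by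
  unfold fmac
  refine continuousOn_finsetProd _ fun i _ => ContinuousOn.div (by fun_prop) (by fun_prop) ?_
  rintro ⟨q, t⟩ ⟨⟨hq0, hq1⟩, ⟨ht0, ht1⟩⟩
  dsimp only at *
  have h1 : q ^ (i + 1) < 1 := pow_lt_one₀ hq0 hq1 (Nat.succ_ne_zero i)
  have h2 : t ^ m ≤ 1 := pow_le_one₀ ht0 ht1.le
  have h3 : q ^ (i + 1) * t ^ m ≤ q ^ (i + 1) * 1 := by gcongr
  linarith

theorem continuousOn_fmac_mul_div (a b c d i j k l : ℕ) :
    ContinuousOn (fun p : ℝ × ℝ => fmac p.1 p.2 a i * fmac p.1 p.2 b j /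
      (fmac p.1 p.2 c k * fmac p.1 p.2 d l)) (Ico (0 : ℝ) 1 ×ˢ Ico (0 : ℝ) 1) :=
  ((continuousOn_fmac _ _).mul (continuousOn_fmac _ _)).div
    ((continuousOn_fmac _ _).mul (continuousOn_fmac _ _)) fun _ hp =>
      (mul_pos (fmac_pos hp.1.1 hp.1.2 hp.2.1 hp.2.2 _ _)
        (fmac_pos hp.1.1 hp.1.2 hp.2.1 hp.2.2 _ _)).ne'

theorem continuousOn_phiCoeff (a b : Partn) :
    ContinuousOn (fun p : ℝ × ℝ => phiCoeff p.1 p.2 a b) (Ico (0 : ℝ) 1 ×ˢ Ico (0 : ℝ) 1) := by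
  unfold phiCoeff
  split_ifs
  · exact continuousOn_finsetProd _ fun j _ => continuousOn_finsetProd _ fun i _ =>
      continuousOn_fmac_mul_div _ _ _ _ _ _ _ _
  · exact continuousOn_const

theorem continuousOn_psiCoeff (a b : Partn) :
    ContinuousOn (fun p : ℝ × ℝ => psiCoeff p.1 p.2 a b) (Ico (0 : ℝ) 1 ×ˢ Ico (0 : ℝ) 1) := by
  unfold psiCoeff
  split_ifs
  · exact continuousOn_finsetProd _ fun j _ => continuousOn_finsetProd _ fun i _ =>
      continuousOn_fmac_mul_div _ _ _ _ _ _ _ _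
  · exact continuousOn_const

theorem continuousOn_qbinom (n : ℕ) :
    ContinuousOn (fun p : ℝ × ℝ => qbinom p.1 p.2 n) (Ico (0 : ℝ) 1 ×ˢ Ico (0 : ℝ) 1) := by
  unfold qbinom
  refine continuousOn_finsetProd _ fun i _ => ContinuousOn.div (by fun_prop) (by fun_prop) ?_
  rintro ⟨q, t⟩ ⟨⟨hq0, hq1⟩, _⟩
  exact (sub_pos.2 (pow_lt_one₀ hq0 hq1 (Nat.succ_ne_zero i))).ne'

/-- The degree by degree form of the skew Cauchy identity in one variable on each side. -/
theorem sum_psi_phi {q t : ℝ} (hq0 : 0 ≤ q) (hq1 : q < 1) (ht0 : 0 ≤ t) (ht1 : t < 1)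
    (μ ν : Partn) (k : ℕ) :
    ∑ l ∈ Partn.ofSize (ν.size + k), psiCoeff q t l μ * phiCoeff q t l ν =
      ∑ p ∈ Finset.HasAntidiagonal.antidiagonal k, qbinom q t p.1 *
        ∑ σ ∈ Partn.ofSize (μ.size - p.2), phiCoeff q t μ σ * psiCoeff q t ν σ := by
  have key : EqOn
      (fun p : ℝ × ℝ => ∑ l ∈ Partn.ofSize (ν.size + k),
        psiCoeff p.1 p.2 l μ * phiCoeff p.1 p.2 l ν)
      (fun p : ℝ × ℝ => ∑ r ∈ Finset.HasAntidiagonal.antidiagonal k, qbinom p.1 p.2 r.1 *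
        ∑ σ ∈ Partn.ofSize (μ.size - r.2), phiCoeff p.1 p.2 μ σ * psiCoeff p.1 p.2 ν σ)
      (Ico (0 : ℝ) 1 ×ˢ Ico (0 : ℝ) 1) := by
    refine EqOn.of_subset_closure (s := {p : ℝ × ℝ | Generic p.1 p.2})
      (fun p hp => sum_psi_phi_of_generic hp μ ν k) ?_ ?_ ?_ subset_closure_generic
    · exact continuousOn_finsetSum _ fun l _ =>
        (continuousOn_psiCoeff _ _).mul (continuousOn_phiCoeff _ _)
    · exact continuousOn_finsetSum _ fun r _ => (continuousOn_qbinom _).mul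
        (continuousOn_finsetSum _ fun l _ =>
          (continuousOn_phiCoeff _ _).mul (continuousOn_psiCoeff _ _))
    · exact fun p hp => ⟨⟨hp.q_pos.le, hp.q_lt⟩, ⟨hp.t_pos.le, hp.t_lt⟩⟩
  exact key (x := (q, t)) ⟨⟨hq0, hq1⟩, ⟨ht0, ht1⟩⟩

end extension

section qbinomial

open Filter Topology

variable {q t z : ℝ}

theorem qbinom_zero : qbinom q t 0 = 1 := by simp [qbinom]

theorem qbinom_pos (hq0 : 0 ≤ q) (hq1 : q < 1) (ht0 : 0 ≤ t) (ht1 : t < 1) (n : ℕ) :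
    0 < qbinom q t n := by
  refine Finset.prod_pos fun i _ => div_pos ?_ ?_
  · have h2 : q ^ i ≤ 1 := pow_le_one₀ hq0 hq1.le
    have h3 : t * q ^ i ≤ t * 1 := by gcongr
    linarith
  · exact sub_pos.2 (pow_lt_one₀ hq0 hq1 i.succ_ne_zero)

theorem summable_qbinom (hq0 : 0 ≤ q) (hq1 : q < 1) (ht0 : 0 ≤ t) (ht1 : t < 1) (hz0 : 0 ≤ z)
    (hz1 : z < 1) : Summable fun n => qbinom q t n * z ^ n := by
  rcases hz0.eq_or_lt with rfl | hz0
  · exact summable_of_ne_finset_zero (s := {0}) fun n hn => by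
      rw [zero_pow (by simpa using hn), mul_zero]
  refine summable_of_ratio_test_tendsto_lt_one hz1
    (Eventually.of_forall fun n => (mul_pos (qbinom_pos hq0 hq1 ht0 ht1 n) (pow_pos hz0 n)).ne') ?_
  have hr : ∀ n, ‖qbinom q t (n + 1) * z ^ (n + 1)‖ / ‖qbinom q t n * z ^ n‖ =
      (1 - t * q ^ n) / (1 - q * q ^ n) * z := by
    intro n
    rw [Real.norm_of_nonneg (mul_pos (qbinom_pos hq0 hq1 ht0 ht1 _) (pow_pos hz0 _)).le,
      Real.norm_of_nonneg (mul_pos (qbinom_pos hq0 hq1 ht0 ht1 _) (pow_pos hz0 _)).le,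
      div_eq_iff (mul_pos (qbinom_pos hq0 hq1 ht0 ht1 _) (pow_pos hz0 _)).ne', qbinom,
      Finset.prod_range_succ, ← qbinom, pow_succ', pow_succ']
    ring
  simp only [hr]
  have hp := tendsto_pow_atTop_nhds_zero_of_lt_one hq0 hq1
  have h1 : Tendsto (fun n : ℕ => 1 - t * q ^ n) atTop (𝓝 (1 - t * 0)) :=
    tendsto_const_nhds.sub (hp.const_mul t)
  have h2 : Tendsto (fun n : ℕ => 1 - q * q ^ n) atTop (𝓝 (1 - q * 0)) :=
    tendsto_const_nhds.sub (hp.const_mul q)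
  simpa using (h1.div h2 (by simp)).mul_const z

theorem tsum_qbinom_functional (hq0 : 0 ≤ q) (hq1 : q < 1) (ht0 : 0 ≤ t) (ht1 : t < 1)
    (hz0 : 0 ≤ z) (hz1 : z < 1) :
    (1 - z) * ∑' n, qbinom q t n * z ^ n = (1 - t * z) * ∑' n, qbinom q t n * (z * q) ^ n := by
  have hzq0 : 0 ≤ z * q := mul_nonneg hz0 hq0
  have hzq1 : z * q < 1 := mul_lt_one_of_nonneg_of_lt_one_left hz0 hz1 hq1.le
  have s1 := summable_qbinom hq0 hq1 ht0 ht1 hz0 hz1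
  have s2 := summable_qbinom hq0 hq1 ht0 ht1 hzq0 hzq1
  have s1' := (summable_nat_add_iff 1).2 s1
  have s2' := (summable_nat_add_iff 1).2 s2
  rw [sub_mul, sub_mul, one_mul, one_mul]
  nth_rw 1 [s1.tsum_eq_zero_add]
  nth_rw 1 [s2.tsum_eq_zero_add]
  rw [← tsum_mul_left, ← tsum_mul_left, pow_zero, pow_zero, add_sub_assoc, add_sub_assoc,
    ← s1'.tsum_sub (s1.mul_left z), ← s2'.tsum_sub (s2.mul_left (t * z))]
  congr 1
  refine tsum_congr fun n => ?_
  have h := qbinom_succ_mul (q := q) (t := t)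
    (fun n => (pow_lt_one₀ hq0 hq1 n.succ_ne_zero).ne) n
  rw [mul_pow, mul_pow, pow_succ z n]
  linear_combination z ^ n * z * h

theorem multipliable_one_sub_mul_pow (hq0 : 0 ≤ q) (hq1 : q < 1) (x : ℝ) :
    Multipliable fun n : ℕ => 1 - x * q ^ n := by
  have h : Summable fun n : ℕ => ‖-(x * q ^ n)‖ := by
    simpa only [norm_neg] using ((summable_geometric_of_lt_one hq0 hq1).mul_left x).norm
  simpa only [sub_eq_add_neg] using multipliable_one_add_of_summable h

theorem tsum_qbinom_mul_qPoch (hq0 : 0 ≤ q) (hq1 : q < 1) (ht0 : 0 ≤ t) (ht1 : t < 1)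
    (hz0 : 0 ≤ z) (hz1 : z < 1) :
    (∑' n, qbinom q t n * z ^ n) * qPoch z q = qPoch (t * z) q := by
  have hzq0 : ∀ N : ℕ, 0 ≤ z * q ^ N := fun N => mul_nonneg hz0 (pow_nonneg hq0 N)
  have hzq1 : ∀ N : ℕ, z * q ^ N < 1 := fun N =>
    mul_lt_one_of_nonneg_of_lt_one_left hz0 hz1 (pow_le_one₀ hq0 hq1.le)
  have hit : ∀ N : ℕ, (∑' n, qbinom q t n * z ^ n) * ∏ n ∈ Finset.range N, (1 - z * q ^ n) =
      (∏ n ∈ Finset.range N, (1 - t * z * q ^ n)) *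
        ∑' n, qbinom q t n * (z * q ^ N) ^ n := by
    intro N
    induction N with
    | zero => simp
    | succ N ih =>
      rw [Finset.prod_range_succ, ← mul_assoc, ih, mul_assoc, mul_comm _ (1 - z * q ^ N),
        tsum_qbinom_functional hq0 hq1 ht0 ht1 (hzq0 N) (hzq1 N), Finset.prod_range_succ,
        mul_assoc z, ← pow_succ, mul_assoc t, mul_assoc]
  have hlim : Tendsto (fun N : ℕ => ∑' n, qbinom q t n * (z * q ^ N) ^ n) atTop (𝓝 1) := by
    set B := ∑' n, qbinom q t (n + 1) * z ^ (n + 1) with hB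
    have s1' := (summable_nat_add_iff 1).2 (summable_qbinom hq0 hq1 ht0 ht1 hz0 hz1)
    have hN : ∀ N : ℕ, ∑' n, qbinom q t n * (z * q ^ N) ^ n =
        1 + ∑' n, qbinom q t (n + 1) * (z * q ^ N) ^ (n + 1) := fun N => by
      rw [(summable_qbinom hq0 hq1 ht0 ht1 (hzq0 N) (hzq1 N)).tsum_eq_zero_add, pow_zero,
        qbinom_zero, one_mul]
    have hc := fun n => (qbinom_pos hq0 hq1 ht0 ht1 n).le
    refine tendsto_of_tendsto_of_tendsto_of_le_of_le (g := fun _ => 1)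
      (h := fun N : ℕ => 1 + q ^ N * B) tendsto_const_nhds ?_ ?_ ?_
    · simpa using ((tendsto_pow_atTop_nhds_zero_of_lt_one hq0 hq1).mul_const B).const_add 1
    · intro N
      dsimp only
      rw [hN, le_add_iff_nonneg_right]
      exact tsum_nonneg fun n => mul_nonneg (hc _) (pow_nonneg (hzq0 N) _)
    · intro N
      dsimp only
      rw [hN, add_le_add_iff_left, hB, ← tsum_mul_left]
      refine Summable.tsum_le_tsum (fun n => ?_) ((summable_nat_add_iff 1).2
        (summable_qbinom hq0 hq1 ht0 ht1 (hzq0 N) (hzq1 N))) (s1'.mul_left _)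
      have h1 : (q ^ N) ^ (n + 1) ≤ q ^ N :=
        pow_le_of_le_one (pow_nonneg hq0 N) (pow_le_one₀ hq0 hq1.le) n.succ_ne_zero
      have h2 := mul_le_mul_of_nonneg_left h1 (mul_nonneg (hc (n + 1)) (pow_nonneg hz0 (n + 1)))
      rw [mul_pow]
      linarith
  have h1 := ((multipliable_one_sub_mul_pow hq0 hq1 z).hasProd.tendsto_prod_nat).const_mul
    (∑' n, qbinom q t n * z ^ n)
  have h2 := ((multipliable_one_sub_mul_pow hq0 hq1 (t * z)).hasProd.tendsto_prod_nat).mul hlim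
  simp only [hit] at h1
  simpa [qPoch] using tendsto_nhds_unique h1 h2

theorem qPoch_ne_zero (hq0 : 0 ≤ q) (hq1 : q < 1) (hz0 : 0 ≤ z) (hz1 : z < 1) :
    qPoch z q ≠ 0 := by
  intro h
  have := tsum_qbinom_mul_qPoch hq0 hq1 le_rfl one_pos hz0 hz1
  rw [h] at this
  simp [qPoch] at this

theorem tsum_qbinom (hq0 : 0 ≤ q) (hq1 : q < 1) (ht0 : 0 ≤ t) (ht1 : t < 1)
    (hz0 : 0 ≤ z) (hz1 : z < 1) :
    ∑' n, qbinom q t n * z ^ n = qPoch (t * z) q / qPoch z q := by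
  rw [eq_div_iff (qPoch_ne_zero hq0 hq1 hz0 hz1),
    tsum_qbinom_mul_qPoch hq0 hq1 ht0 ht1 hz0 hz1]

end qbinomial

open scoped ENNReal

theorem ENNReal.tsum_mul_tsum_eq_tsum_sum_antidiagonal (f g : ℕ → ℝ≥0∞) :
    (∑' i, f i) * ∑' j, g j =
      ∑' k, ∑ p ∈ Finset.HasAntidiagonal.antidiagonal k, f p.1 * g p.2 := by
  have h1 : (∑' i, f i) * ∑' j, g j = ∑' p : ℕ × ℕ, f p.1 * g p.2 := by
    rw [ENNReal.tsum_prod', ← ENNReal.tsum_mul_right]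
    exact tsum_congr fun i => ENNReal.tsum_mul_left.symm
  rw [h1, ← Finset.HasAntidiagonal.sigmaAntidiagonalEquivProd.tsum_eq, ENNReal.tsum_sigma']
  refine tsum_congr fun k => ?_
  exact Finset.tsum_subtype (Finset.HasAntidiagonal.antidiagonal k) fun p => f p.1 * g p.2

theorem Partn.tsum_eq_tsum_ofSize (f : Partn → ℝ≥0∞) {e : ℕ → ℤ} (he : e.Injective)
    (h : ∀ a, f a ≠ 0 → ∃ k, (a.size : ℤ) = e k) :
    ∑' a, f a = ∑' k, ∑ a ∈ Partn.ofSize (e k), f a := by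
  classical
  have h1 : ∀ k, ∑ a ∈ Partn.ofSize (e k), f a = ∑' a : Partn, if a.size = e k then f a else 0 := by
    intro k
    rw [tsum_eq_sum (s := Partn.ofSize (e k)) fun a ha => if_neg (by simpa using ha)]
    exact Finset.sum_congr rfl fun a ha => (if_pos (Partn.mem_ofSize.1 ha)).symm
  simp only [h1]
  rw [ENNReal.tsum_comm]
  refine tsum_congr fun a => ?_
  by_cases ha : f a = 0
  · simp [ha]
  · obtain ⟨k, hk⟩ := h a ha
    rw [tsum_eq_single k fun k' hk' => if_neg fun h' => hk' (he (h'.symm.trans hk)), if_pos hk]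

section transfer

variable {q t : ℝ}

theorem phiCoeff_nonneg (hq0 : 0 ≤ q) (hq1 : q < 1) (ht0 : 0 ≤ t) (ht1 : t < 1) (a b : Partn) :
    0 ≤ phiCoeff q t a b := by
  unfold phiCoeff
  have hf := fun n m => (fmac_pos hq0 hq1 ht0 ht1 n m).le
  split_ifs
  · exact Finset.prod_nonneg fun j _ => Finset.prod_nonneg fun i _ =>
      div_nonneg (mul_nonneg (hf _ _) (hf _ _)) (mul_nonneg (hf _ _) (hf _ _))
  · exact le_rfl

theorem psiCoeff_nonneg (hq0 : 0 ≤ q) (hq1 : q < 1) (ht0 : 0 ≤ t) (ht1 : t < 1) (a b : Partn) :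
    0 ≤ psiCoeff q t a b := by
  unfold psiCoeff
  have hf := fun n m => (fmac_pos hq0 hq1 ht0 ht1 n m).le
  split_ifs
  · exact Finset.prod_nonneg fun j _ => Finset.prod_nonneg fun i _ =>
      div_nonneg (mul_nonneg (hf _ _) (hf _ _)) (mul_nonneg (hf _ _) (hf _ _))
  · exact le_rfl

theorem size_le_of_phiCoeff_ne_zero {a b : Partn} (h : phiCoeff q t a b ≠ 0) : b.size ≤ a.size :=
  Partn.size_le_size fun i => (interlace_of_phiCoeff_ne_zero h i).1

theorem size_le_of_psiCoeff_ne_zero {a b : Partn} (h : psiCoeff q t a b ≠ 0) : b.size ≤ a.size :=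
  Partn.size_le_size fun i => (interlace_of_psiCoeff_ne_zero h i).1

variable (q t)

/-- The coefficients `phiCoeff` as extended nonnegative reals. -/
noncomputable def phiE (a b : Partn) : ℝ≥0∞ := ENNReal.ofReal (phiCoeff q t a b)

/-- The coefficients `psiCoeff` as extended nonnegative reals. -/
noncomputable def psiE (a b : Partn) : ℝ≥0∞ := ENNReal.ofReal (psiCoeff q t a b)

/-- The series `(tz; q)_∞ / (z; q)_∞` over the extended nonnegative reals. -/
noncomputable def qbinomSeries (z : ℝ≥0∞) : ℝ≥0∞ := ∑' n, ENNReal.ofReal (qbinom q t n) * z ^ n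

variable {q t}

theorem phiE_eq_zero {a b : Partn} (h : ¬b.size ≤ a.size) : phiE q t a b = 0 := by
  by_contra h0
  exact h (size_le_of_phiCoeff_ne_zero fun h1 => h0 (by rw [phiE, h1, ENNReal.ofReal_zero]))

theorem psiE_eq_zero {a b : Partn} (h : ¬b.size ≤ a.size) : psiE q t a b = 0 := by
  by_contra h0
  exact h (size_le_of_psiCoeff_ne_zero fun h1 => h0 (by rw [psiE, h1, ENNReal.ofReal_zero]))

/-- The skew Cauchy identity in one variable on each side. -/
theorem skew_cauchy (hq0 : 0 ≤ q) (hq1 : q < 1) (ht0 : 0 ≤ t) (ht1 : t < 1) (μ ν : Partn)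
    (z : ℝ≥0∞) :
    ∑' l, psiE q t l μ * phiE q t l ν * z ^ (l.size - ν.size) =
      qbinomSeries q t z * ∑' σ, phiE q t μ σ * psiE q t ν σ * z ^ (μ.size - σ.size) := by
  have hφ := phiCoeff_nonneg hq0 hq1 ht0 ht1
  have hψ := psiCoeff_nonneg hq0 hq1 ht0 ht1
  have hc := fun n => (qbinom_pos hq0 hq1 ht0 ht1 n).le
  rw [Partn.tsum_eq_tsum_ofSize (e := fun k => ν.size + k) _ (fun a b hab => by simpa using hab),
    Partn.tsum_eq_tsum_ofSize (e := fun k => μ.size - k) _ (fun a b hab => by simpa using hab),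
    qbinomSeries, ENNReal.tsum_mul_tsum_eq_tsum_sum_antidiagonal]
  · refine tsum_congr fun k => ?_
    have h1 : ∑ l ∈ Partn.ofSize (ν.size + k),
        psiE q t l μ * phiE q t l ν * z ^ (l.size - ν.size) =
        ENNReal.ofReal (∑ l ∈ Partn.ofSize (ν.size + k),
          psiCoeff q t l μ * phiCoeff q t l ν) * z ^ k := by
      rw [ENNReal.ofReal_sum_of_nonneg fun l _ => mul_nonneg (hψ _ _) (hφ _ _), Finset.sum_mul]
      refine Finset.sum_congr rfl fun l hl => ?_
      rw [Partn.mem_ofSize] at hl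
      rw [ENNReal.ofReal_mul (hψ _ _), show l.size - ν.size = k by omega, psiE, phiE]
    have h2 : ∀ j : ℕ, ∑ σ ∈ Partn.ofSize (μ.size - j),
        phiE q t μ σ * psiE q t ν σ * z ^ (μ.size - σ.size) =
        ENNReal.ofReal (∑ σ ∈ Partn.ofSize (μ.size - j),
          phiCoeff q t μ σ * psiCoeff q t ν σ) * z ^ j := by
      intro j
      rw [ENNReal.ofReal_sum_of_nonneg fun l _ => mul_nonneg (hφ _ _) (hψ _ _), Finset.sum_mul]
      refine Finset.sum_congr rfl fun l hl => ?_
      rw [Partn.mem_ofSize] at hl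
      rw [ENNReal.ofReal_mul (hφ _ _), show μ.size - l.size = j by omega, psiE, phiE]
    rw [h1, sum_psi_phi hq0 hq1 ht0 ht1, ENNReal.ofReal_sum_of_nonneg fun p _ =>
      mul_nonneg (hc _) (Finset.sum_nonneg fun l _ => mul_nonneg (hφ _ _) (hψ _ _)),
      Finset.sum_mul]
    refine Finset.sum_congr rfl fun p hp => ?_
    rw [h2, ENNReal.ofReal_mul (hc _), ← Finset.HasAntidiagonal.mem_antidiagonal.1 hp, pow_add]
    ring
  · intro σ hσ
    by_cases h : σ.size ≤ μ.size
    · exact ⟨μ.size - σ.size, by omega⟩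
    · rw [phiE_eq_zero h, zero_mul, zero_mul] at hσ
      exact absurd rfl hσ
  · intro l hl
    by_cases h : ν.size ≤ l.size
    · exact ⟨l.size - ν.size, by omega⟩
    · rw [phiE_eq_zero h, mul_zero, zero_mul] at hl
      exact absurd rfl hl

end transfer

/-- The empty partition. -/
def Partn.nil : Partn := ⟨0, fun _ _ _ => le_rfl⟩

@[simp]
theorem Partn.nil_apply (i : ℕ) : Partn.nil i = 0 := rfl

@[simp]
theorem Partn.nil_size : Partn.nil.size = 0 := by
  rw [Partn.nil.size_eq (N := 0) rfl, Finset.sum_range_zero]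

section iterate

open scoped Classical in
/-- The iterates of a kernel, started from the empty partition. -/
noncomputable def kernelIter (K : Partn → Partn → ℝ≥0∞) : ℕ → Partn → ℝ≥0∞
  | 0 => fun a => if a = Partn.nil then 1 else 0
  | n + 1 => fun a => ∑' b, K a b * kernelIter K n b

theorem kernelIter_zero_nil (K : Partn → Partn → ℝ≥0∞) : kernelIter K 0 Partn.nil = 1 := by
  simp [kernelIter]

theorem kernelIter_zero_of_ne (K : Partn → Partn → ℝ≥0∞) {a : Partn} (h : a ≠ Partn.nil) :
    kernelIter K 0 a = 0 := by
  simp [kernelIter, h]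

theorem kernelIter_succ (K : Partn → Partn → ℝ≥0∞) (n : ℕ) (a : Partn) :
    kernelIter K (n + 1) a = ∑' b, K a b * kernelIter K n b := by
  simp [kernelIter]

variable {q t : ℝ} (hq0 : 0 ≤ q) (hq1 : q < 1) (ht0 : 0 ≤ t) (ht1 : t < 1) (s : ℝ≥0∞)

theorem phiE_self_nil : phiE q t Partn.nil Partn.nil = 1 := by
  unfold phiE phiCoeff
  rw [if_pos (show Partn.nil.Interlace Partn.nil from fun i => ⟨le_rfl, le_rfl⟩)]
  simp [Partn.nil]

theorem psiE_self_nil : psiE q t Partn.nil Partn.nil = 1 := by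
  unfold psiE psiCoeff
  rw [if_pos (show Partn.nil.Interlace Partn.nil from fun i => ⟨le_rfl, le_rfl⟩)]
  simp [Partn.nil]

theorem Partn.eq_nil_of_size_eq_zero {a : Partn} (h : a.size = 0) : a = Partn.nil :=
  Partn.eq_of_le_of_size_eq (fun _ => Nat.zero_le _) (h.trans Partn.nil_size.symm)

theorem kernelIter_psi_nil (n : ℕ) :
    kernelIter (fun a b => s ^ a.size * psiE q t a b) n Partn.nil = 1 := by
  induction n with
  | zero => exact kernelIter_zero_nil _
  | succ n ih =>
    rw [kernelIter_succ, tsum_eq_single Partn.nil, ih, psiE_self_nil, Partn.nil_size, pow_zero,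
      one_mul, one_mul]
    intro b hb
    rw [psiE_eq_zero fun h => hb (Partn.eq_nil_of_size_eq_zero (by simpa using h)), mul_zero,
      zero_mul]

include hq0 hq1 ht0 ht1

/-- The iterates of the `ψ` kernel are eigenvectors for the adjoint of the `φ` kernel. -/
theorem tsum_phi_kernelIter_psi (n : ℕ) (x : ℝ≥0∞) (ν : Partn) :
    ∑' l, phiE q t l ν * x ^ (l.size - ν.size) *
        kernelIter (fun a b => s ^ a.size * psiE q t a b) n l =
      (∏ j ∈ Finset.range n, qbinomSeries q t (x * s ^ (j + 1))) *
        kernelIter (fun a b => s ^ a.size * psiE q t a b) n ν := by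
  induction n generalizing x ν with
  | zero =>
    rw [Finset.prod_range_zero, one_mul, tsum_eq_single Partn.nil]
    · by_cases hν : ν = Partn.nil
      · subst hν
        rw [phiE_self_nil, Nat.sub_self, pow_zero, one_mul, one_mul]
      · rw [phiE_eq_zero fun h => hν (Partn.eq_nil_of_size_eq_zero (by simpa using h)), zero_mul,
          zero_mul, kernelIter_zero_of_ne _ hν]
    · intro b hb
      rw [kernelIter_zero_of_ne _ hb, mul_zero]
  | succ n ih =>
    set v := kernelIter (fun a b => s ^ a.size * psiE q t a b) n with hv
    have hstep : ∀ a, kernelIter (fun a b => s ^ a.size * psiE q t a b) (n + 1) a =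
        s ^ a.size * ∑' b, psiE q t a b * v b := fun a => by
      rw [kernelIter_succ, ← ENNReal.tsum_mul_left]
      exact tsum_congr fun b => mul_assoc _ _ _
    have h1 : ∀ l : Partn, phiE q t l ν * x ^ (l.size - ν.size) *
        (s ^ l.size * ∑' b, psiE q t l b * v b) =
        s ^ ν.size * ∑' b, v b *
          (psiE q t l b * phiE q t l ν * (x * s) ^ (l.size - ν.size)) := by
      intro l
      rw [← ENNReal.tsum_mul_left, ← ENNReal.tsum_mul_left, ← ENNReal.tsum_mul_left]
      refine tsum_congr fun b => ?_
      by_cases h : ν.size ≤ l.size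
      · nth_rw 2 [← Nat.sub_add_cancel h]
        rw [pow_add, mul_pow]
        ring
      · rw [phiE_eq_zero h]
        simp
    simp only [hstep, h1]
    rw [ENNReal.tsum_mul_left, ENNReal.tsum_comm]
    simp only [ENNReal.tsum_mul_left, skew_cauchy hq0 hq1 ht0 ht1]
    have h2 : ∀ b, v b * (qbinomSeries q t (x * s) * ∑' σ, phiE q t b σ * psiE q t ν σ *
        (x * s) ^ (b.size - σ.size)) = qbinomSeries q t (x * s) * ∑' σ, psiE q t ν σ *
          (phiE q t b σ * (x * s) ^ (b.size - σ.size) * v b) := by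
      intro b
      rw [mul_left_comm, ← ENNReal.tsum_mul_left]
      congr 1
      refine tsum_congr fun σ => ?_
      ring
    simp only [h2]
    rw [ENNReal.tsum_mul_left, ENNReal.tsum_comm]
    simp only [ENNReal.tsum_mul_left, ih]
    have h3 : ∀ j, x * s * s ^ (j + 1) = x * s ^ (j + 1 + 1) := fun j => by
      rw [mul_assoc, ← pow_succ']
    simp only [h3, mul_left_comm (psiE _ _ _ _)]
    rw [Finset.prod_range_succ', zero_add, pow_one, ENNReal.tsum_mul_left]
    ring

/-- The pairing of the iterates of the `ψ` and `φ` kernels. -/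
theorem tsum_kernelIter_mul_kernelIter (n m : ℕ) (x : ℝ≥0∞) :
    ∑' l : Partn, x ^ l.size * kernelIter (fun a b => s ^ a.size * psiE q t a b) n l *
        kernelIter (fun a b => phiE q t a b * s ^ b.size) m l =
      ∏ k ∈ Finset.range m, ∏ j ∈ Finset.range n, qbinomSeries q t (x * s ^ k * s ^ (j + 1)) := by
  induction m generalizing x with
  | zero =>
    rw [Finset.prod_range_zero, tsum_eq_single Partn.nil]
    · rw [Partn.nil_size, kernelIter_psi_nil, kernelIter_zero_nil]
      simp
    · intro b hb
      rw [kernelIter_zero_of_ne _ hb, mul_zero]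
  | succ m ih =>
    have ih' := ih (x * s)
    set v := kernelIter (fun a b => s ^ a.size * psiE q t a b) n with hv
    set w := kernelIter (fun a b => phiE q t a b * s ^ b.size) m with hw
    have h1 : ∀ l : Partn, x ^ l.size * v l *
        kernelIter (fun a b => phiE q t a b * s ^ b.size) (m + 1) l =
        ∑' b, ((x * s) ^ b.size * w b) * (phiE q t l b * x ^ (l.size - b.size) * v l) := by
      intro l
      rw [kernelIter_succ, ← ENNReal.tsum_mul_left]
      refine tsum_congr fun b => ?_
      by_cases h : b.size ≤ l.size
      · nth_rw 1 [← Nat.sub_add_cancel h]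
        rw [pow_add, mul_pow]
        ring
      · rw [phiE_eq_zero h]
        simp
    simp only [h1]
    rw [ENNReal.tsum_comm]
    simp only [ENNReal.tsum_mul_left]
    simp only [hv, tsum_phi_kernelIter_psi hq0 hq1 ht0 ht1]
    rw [← hv, Finset.prod_range_succ', pow_zero, mul_one]
    have h3 : ∀ k, x * s * s ^ k = x * s ^ (k + 1) := fun k => by rw [mul_assoc, pow_succ']
    simp only [h3] at ih'
    rw [← ih', ← ENNReal.tsum_mul_right]
    refine tsum_congr fun b => ?_
    ring

end iterate

/-- Sequences of partitions that start at `a` and are empty from index `n` on. -/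
abbrev Chain (n : ℕ) (a : Partn) := {c : ℕ → Partn // c 0 = a ∧ ∀ i, n ≤ i → c i = Partn.nil}

/-- Putting a partition in front of a chain. -/
def Chain.cons {n : ℕ} (a : Partn) (x : Σ b, Chain n b) : Chain (n + 1) a :=
  ⟨fun i => Nat.casesOn i a x.2.1, rfl, fun i hi => by
    obtain ⟨j, rfl⟩ := Nat.exists_eq_add_of_le' hi
    exact x.2.2.2 _ (Nat.le_add_left _ _)⟩

theorem Chain.cons_bijective {n : ℕ} (a : Partn) :
    Function.Bijective (Chain.cons a : (Σ b, Chain n b) → Chain (n + 1) a) := by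
  constructor
  · rintro ⟨_, c, rfl, hc⟩ ⟨_, d, rfl, hd⟩ h
    have : c = d := funext fun i => congrFun (congrArg Subtype.val h) (i + 1)
    subst this
    rfl
  · rintro ⟨c, rfl, hc⟩
    refine ⟨⟨c 1, fun i => c (i + 1), rfl, fun i hi => hc _ (by omega)⟩, Subtype.ext ?_⟩
    funext i
    cases i <;> rfl

theorem kernelIter_eq_tsum (K : Partn → Partn → ℝ≥0∞) (n : ℕ) (a : Partn) :
    kernelIter K n a = ∑' c : Chain n a, ∏ i ∈ Finset.range n, K (c.1 i) (c.1 (i + 1)) := by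
  induction n generalizing a with
  | zero =>
    by_cases h : a = Partn.nil
    · subst h
      rw [kernelIter_zero_nil, tsum_eq_single ⟨fun _ => Partn.nil, rfl, fun _ _ => rfl⟩,
        Finset.prod_range_zero]
      rintro ⟨c, hc⟩ hne
      exact absurd (Subtype.ext (funext fun i => hc.2 i (Nat.zero_le _))) hne
    · rw [kernelIter_zero_of_ne _ h]
      symm
      rw [ENNReal.tsum_eq_zero]
      rintro ⟨c, hc⟩
      exact absurd (hc.1.symm.trans (hc.2 0 le_rfl)) h
  | succ n ih =>
    rw [kernelIter_succ, ← (Equiv.ofBijective _ (Chain.cons_bijective a)).tsum_eq,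
      ENNReal.tsum_sigma']
    refine tsum_congr fun b => ?_
    rw [ih, ← ENNReal.tsum_mul_left]
    refine tsum_congr fun c => ?_
    rw [Finset.prod_range_succ', mul_comm]
    obtain ⟨c, rfl, hc⟩ := c
    rfl

theorem Finset.prod_square_eq_prod_diag {M : Type*} [CommMonoid M] (n : ℕ) (f : ℕ → ℕ → M)
    (hf : ∀ i j, n ≤ i ∨ n ≤ j → f i j = 1) :
    ∏ i ∈ Finset.range n, ∏ j ∈ Finset.range n, f i j =
      (∏ k ∈ Finset.range n, ∏ i ∈ Finset.range n, f i (i + k)) *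
        ∏ k ∈ Finset.range n, ∏ j ∈ Finset.range n, f (j + (k + 1)) j := by
  have h1 : ∀ i ∈ Finset.range n, ∏ j ∈ Finset.range n, f i j =
      (∏ j ∈ Finset.range i, f i j) * ∏ k ∈ Finset.range n, f i (i + k) := by
    intro i hi
    rw [Finset.mem_range] at hi
    rw [← Finset.prod_range_mul_prod_Ico _ hi.le, Finset.prod_Ico_eq_prod_range]
    congr 1
    refine Finset.prod_subset (Finset.range_mono (Nat.sub_le _ _)) fun k _ hk => hf _ _ (Or.inr ?_)
    simp only [Finset.mem_range] at hk
    omega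
  rw [Finset.prod_congr rfl h1, Finset.prod_mul_distrib, mul_comm]
  congr 1
  · exact Finset.prod_comm
  · rw [Finset.prod_comm' (t' := Finset.range n) (s' := fun j => Finset.Ico (j + 1) n)
      (by intro i j; simp; omega), Finset.prod_comm]
    refine Finset.prod_congr rfl fun j _ => ?_
    rw [Finset.prod_Ico_eq_prod_range]
    simp only [← add_assoc, add_right_comm j]
    refine Finset.prod_subset (Finset.range_mono (Nat.sub_le _ _)) fun k _ hk => hf _ _ (Or.inl ?_)
    simp only [Finset.mem_range] at hk
    omega

theorem Finset.prod_range_shift {M : Type*} [CommMonoid M] (n : ℕ) (u w : ℕ → M) (hu : u n = 1) :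
    ∏ k ∈ Finset.range n, u k * w k = u 0 * ∏ k ∈ Finset.range n, u (k + 1) * w k := by
  rw [Finset.prod_mul_distrib, Finset.prod_mul_distrib, ← mul_assoc, mul_comm (u 0),
    ← Finset.prod_range_succ', Finset.prod_range_succ, hu, mul_one]

namespace PlanePartition

theorem part_anti (π : PlanePartition) {i j i' j' : ℕ} (hi : i ≤ i') (hj : j ≤ j') :
    π.part i' j' ≤ π.part i j :=
  (antitone_nat_of_succ_le (f := fun a => π.part a j') (fun a => π.col_decr a j') hi).trans
    (antitone_nat_of_succ_le (π.row_decr i) hj)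

/-- The reflection of a plane partition in its main diagonal. -/
def transpose (π : PlanePartition) : PlanePartition where
  part i j := π.part j i
  row_decr i j := π.col_decr j i
  col_decr i j := π.row_decr j i
  finite_supp := π.finite_supp.preimage Prod.swap_injective.injOn

@[simp]
theorem transpose_part (π : PlanePartition) (i j : ℕ) : π.transpose.part i j = π.part j i := rfl

/-- All boxes of the support lie in an `n × n` square. -/
def InSquare (π : PlanePartition) (n : ℕ) : Prop := π.part n 0 = 0 ∧ π.part 0 n = 0

theorem InSquare.transpose {π : PlanePartition} {n : ℕ} (h : π.InSquare n) :
    π.transpose.InSquare n := ⟨h.2, h.1⟩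

theorem InSquare.eq_zero {π : PlanePartition} {n : ℕ} (h : π.InSquare n) {i j : ℕ}
    (hij : n ≤ i ∨ n ≤ j) : π.part i j = 0 := by
  rcases hij with hi | hj
  · exact Nat.le_zero.1 (h.1 ▸ π.part_anti hi (Nat.zero_le j))
  · exact Nat.le_zero.1 (h.2 ▸ π.part_anti (Nat.zero_le i) hj)

theorem exists_inSquare (π : PlanePartition) : ∃ n, π.InSquare n := by
  obtain ⟨a, ha⟩ := (π.finite_supp.preimage (f := fun n : ℕ => (n, 0))
    fun _ _ _ _ h => (Prod.ext_iff.1 h).1).exists_notMem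
  obtain ⟨b, hb⟩ := (π.finite_supp.preimage (f := fun n : ℕ => (0, n))
    fun _ _ _ _ h => (Prod.ext_iff.1 h).2).exists_notMem
  have ha' : π.part a 0 = 0 := by simpa using ha
  have hb' : π.part 0 b = 0 := by simpa using hb
  exact ⟨a + b, Nat.le_zero.1 ((π.part_anti (Nat.le_add_right a b) le_rfl).trans_eq ha'),
    Nat.le_zero.1 ((π.part_anti le_rfl (Nat.le_add_left b a)).trans_eq hb')⟩

theorem InSquare.mono {π : PlanePartition} {m n : ℕ} (h : π.InSquare m) (hmn : m ≤ n) :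
    π.InSquare n := ⟨h.eq_zero (Or.inl hmn), h.eq_zero (Or.inr hmn)⟩

/-- The diagonals weakly above the main one. -/
noncomputable def diag (π : PlanePartition) (k : ℕ) : Partn :=
  Partn.ofFun (fun i => π.part i (i + k))
    (fun _ _ h => π.part_anti h (Nat.add_le_add_right h k))
    (N := π.exists_inSquare.choose)
    (π.exists_inSquare.choose_spec.eq_zero (Or.inl le_rfl))

@[simp]
theorem diag_apply (π : PlanePartition) (k i : ℕ) : π.diag k i = π.part i (i + k) := rfl

theorem transpose_diag_zero (π : PlanePartition) : π.transpose.diag 0 = π.diag 0 :=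
  Partn.ext' fun _ => rfl

theorem diag_interlace (π : PlanePartition) (k : ℕ) : (π.diag k).Interlace (π.diag (k + 1)) :=
  fun i => ⟨π.row_decr i (i + k), (π.part_anti le_rfl (by omega)).trans
    (π.col_decr i (i + (k + 1)))⟩

theorem InSquare.diag_eq_nil {π : PlanePartition} {n k : ℕ} (h : π.InSquare n) (hk : n ≤ k) :
    π.diag k = Partn.nil :=
  Partn.ext' fun _ => h.eq_zero (Or.inr (by omega))

theorem ext' {π ρ : PlanePartition} (h : ∀ i j, π.part i j = ρ.part i j) : π = ρ := by
  cases π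
  cases ρ
  congr
  funext i j
  exact h i j

theorem ext_diag {π ρ : PlanePartition} (h : ∀ k, π.diag k = ρ.diag k)
    (h' : ∀ k, π.transpose.diag k = ρ.transpose.diag k) : π = ρ := by
  refine ext' fun i j => ?_
  rcases le_total i j with hij | hij
  · obtain ⟨k, rfl⟩ := Nat.exists_eq_add_of_le hij
    exact congrArg (fun a : Partn => a i) (h k)
  · obtain ⟨k, rfl⟩ := Nat.exists_eq_add_of_le hij
    exact congrArg (fun a : Partn => a j) (h' k)

theorem exists_diag_eq {c d : ℕ → Partn} (n : ℕ) (h0 : c 0 = d 0)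
    (hc : ∀ k, (c k).Interlace (c (k + 1))) (hd : ∀ k, (d k).Interlace (d (k + 1)))
    (hcn : c n = Partn.nil) (hdn : d n = Partn.nil) :
    ∃ π : PlanePartition, π.InSquare n ∧ (∀ k, π.diag k = c k) ∧
      ∀ k, π.transpose.diag k = d k := by
  have hle : ∀ {c : ℕ → Partn}, (∀ k, (c k).Interlace (c (k + 1))) → ∀ k i, c k i ≤ c 0 i := by
    intro c hc k i
    exact antitone_nat_of_succ_le (f := fun k => c k i) (fun k => (hc k i).1) (Nat.zero_le k)
  have hnil : ∀ {c : ℕ → Partn}, (∀ k, (c k).Interlace (c (k + 1))) → c n = Partn.nil →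
      ∀ k i, n ≤ k → c k i = 0 := by
    intro c hc hcn k i hk
    have := antitone_nat_of_succ_le (f := fun k => c k i) (fun k => (hc k i).1) hk
    simpa [hcn] using this
  refine ⟨⟨fun i j => if i ≤ j then c (j - i) i else d (i - j) j, ?_, ?_, ?_⟩, ?_, ?_, ?_⟩
  · intro i j
    rcases lt_trichotomy i (j + 1) with h | rfl | h
    · rw [if_pos h.le, if_pos (by omega), show j + 1 - i = j - i + 1 by omega]
      exact (hc _ _).1
    · rw [if_pos le_rfl, if_neg (by omega), Nat.sub_self, h0, Nat.add_sub_cancel_left]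
      exact (hd _ _).2
    · rw [if_neg (by omega), if_neg (by omega), show i - j = i - (j + 1) + 1 by omega]
      exact (hd _ _).2
  · intro i j
    rcases lt_trichotomy i j with h | rfl | h
    · rw [if_pos (Nat.succ_le_of_lt h), if_pos h.le, show j - i = j - (i + 1) + 1 by omega]
      exact (hc _ _).2
    · rw [if_neg (by omega), if_pos le_rfl, Nat.sub_self, h0, Nat.add_sub_cancel_left]
      exact (hd _ _).1
    · rw [if_neg (by omega), if_neg (by omega), show i + 1 - j = i - j + 1 by omega]
      exact (hd _ _).1
  · refine ((Finset.range (n + (c 0).size) ×ˢ Finset.range (n + (c 0).size)).finite_toSet).subset ?_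
    rintro ⟨i, j⟩ hij
    simp only [Set.mem_ofPred_eq] at hij
    rw [Finset.mem_coe, Finset.mem_product, Finset.mem_range, Finset.mem_range]
    by_contra hcon
    apply hij
    have key : ∀ {c : ℕ → Partn}, (∀ k, (c k).Interlace (c (k + 1))) → c n = Partn.nil →
        ∀ k i, n + (c 0).size ≤ k + i → c k i = 0 := by
      intro c hc hcn k i h
      by_cases hk : n ≤ k
      · exact hnil hc hcn k i hk
      · exact Nat.le_zero.1 ((hle hc k i).trans_eq ((c 0).apply_of_size_le (by omega)))
    split_ifs with h
    · exact key hc hcn _ _ (by omega)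
    · exact key hd hdn _ _ (by rw [← h0]; omega)
  · constructor
    · rcases Nat.eq_zero_or_pos n with rfl | hn
      · simp [hcn]
      · simp [hn.ne', hdn]
    · simp [hcn]
  · intro k
    refine Partn.ext' fun i => ?_
    simp
  · intro k
    refine Partn.ext' fun i => ?_
    rcases Nat.eq_zero_or_pos k with rfl | hk
    · simp [h0]
    · simp [hk.ne']

end PlanePartition

section values

variable {q t : ℝ} (hq0 : 0 ≤ q) (hq1 : q < 1) (ht0 : 0 ≤ t) (ht1 : t < 1)

/-- The triangular products occurring in the branching coefficients. -/
noncomputable def fmacTriangle (q t : ℝ) (n : ℕ) (a b : ℕ → ℕ) : ℝ :=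
  ∏ j ∈ Finset.range n, ∏ i ∈ Finset.range (j + 1), fmac q t (a i - b j) (j - i)

theorem fmacTriangle_nil (n : ℕ) (b : ℕ → ℕ) :
    fmacTriangle q t n Partn.nil b = 1 :=
  Finset.prod_eq_one fun j _ => Finset.prod_eq_one fun i _ => by
    rw [Partn.nil_apply, Nat.zero_sub, fmac_zero]

theorem Fbox_eq_one_of_part_eq_zero {π : PlanePartition} {i j : ℕ} (h : π.part i j = 0) :
    Fbox q t π i j = 1 := by
  unfold Fbox
  simp [h, fmac_zero]

theorem Fbox_transpose (π : PlanePartition) (i j : ℕ) :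
    Fbox q t π.transpose i j = Fbox q t π j i := by
  unfold Fbox
  refine tprod_congr fun m => ?_
  simp only [PlanePartition.transpose_part]
  congr 1
  exact mul_comm _ _

theorem Fmac_eq_prod_square {π : PlanePartition} {n : ℕ} (h : π.InSquare n) :
    Fmac q t π = ∏ i ∈ Finset.range n, ∏ j ∈ Finset.range n, Fbox q t π i j := by
  have h1 : ∀ p : ℕ × ℕ, (if π.part p.1 p.2 ≠ 0 then Fbox q t π p.1 p.2 else 1) =
      Fbox q t π p.1 p.2 := by
    intro p
    split_ifs with hp
    · rfl
    · exact (Fbox_eq_one_of_part_eq_zero (not_not.1 hp)).symm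
  rw [Fmac]
  simp only [h1]
  rw [finprod_eq_prod_of_mulSupport_subset (s := Finset.range n ×ˢ Finset.range n),
    Finset.prod_product]
  intro p hp
  simp only [Finset.coe_product, Finset.coe_range, Set.mem_prod, Set.mem_Iio]
  by_contra hcon
  exact hp (Fbox_eq_one_of_part_eq_zero (h.eq_zero (by omega)))

include hq0 hq1 ht0 ht1

theorem phiCoeff_eq_triangle {a b : Partn} (h : a.Interlace b) {n : ℕ} (hn : a n = 0) :
    phiCoeff q t a b = fmacTriangle q t n a b * fmacTriangle q t n b (fun i => a (i + 1)) /
      (fmacTriangle q t n a a * fmacTriangle q t n b (fun i => b (i + 1))) := by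
  rw [phiCoeff_eq hq0 hq1 ht0 ht1 h hn]
  simp only [fmacTriangle, Finset.prod_div_distrib, Finset.prod_mul_distrib]

theorem psiCoeff_eq_triangle {a b : Partn} (h : a.Interlace b) {n : ℕ} (hn : a n = 0) :
    psiCoeff q t a b = fmacTriangle q t n a b * fmacTriangle q t n b (fun i => a (i + 1)) /
      (fmacTriangle q t n b b * fmacTriangle q t n a (fun i => a (i + 1))) := by
  rw [psiCoeff_eq hq0 hq1 ht0 ht1 h (a.eq_zero_of_le hn (Nat.le_succ n))
    (Nat.le_zero.1 (hn ▸ (h n).1))]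
  simp only [fmacTriangle, Finset.prod_div_distrib, Finset.prod_mul_distrib]

theorem Fbox_diag_eq {π : PlanePartition} {n : ℕ} (h : π.InSquare n) (k i : ℕ) :
    Fbox q t π i (i + k) = ∏ j ∈ Finset.Ico i n,
      (fmac q t (π.diag k i - π.part (j + 1) (j + k)) (j - i) *
          fmac q t (π.diag k i - π.diag (k + 1) j) (j - i)) /
        (fmac q t (π.diag k i - π.diag k j) (j - i) *
          fmac q t (π.diag k i - π.diag k (j + 1)) (j - i)) := by
  rw [Fbox, tprod_eq_prod (s := Finset.range (n - i)), Finset.prod_Ico_eq_prod_range]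
  · refine Finset.prod_congr rfl fun m _ => ?_
    simp only [PlanePartition.diag_apply, Nat.add_sub_cancel_left]
    rw [show i + 1 + m = i + m + 1 by omega, show i + k + m = i + m + k by omega,
      show i + k + 1 + m = i + m + (k + 1) by omega, show i + m + k + 1 = i + m + 1 + k by omega]
  · intro m hm
    rw [Finset.mem_range] at hm
    rw [h.eq_zero (i := i + 1 + m) (Or.inl (by omega)), h.eq_zero (i := i + m) (Or.inl (by omega)),
      h.eq_zero (i := i + m) (Or.inl (by omega)), h.eq_zero (i := i + m + 1) (Or.inl (by omega))]
    exact div_self (mul_pos (fmac_pos hq0 hq1 ht0 ht1 _ _) (fmac_pos hq0 hq1 ht0 ht1 _ _)).ne'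

theorem prod_Fbox_diag {π : PlanePartition} {n : ℕ} (h : π.InSquare n) (k : ℕ) :
    ∏ i ∈ Finset.range n, Fbox q t π i (i + k) =
      (fmacTriangle q t n (π.diag k) (fun j => π.part (j + 1) (j + k)) *
        fmacTriangle q t n (π.diag k) (π.diag (k + 1))) /
      (fmacTriangle q t n (π.diag k) (π.diag k) *
        fmacTriangle q t n (π.diag k) (fun j => π.diag k (j + 1))) := by
  simp only [Fbox_diag_eq hq0 hq1 ht0 ht1 h]
  rw [Finset.prod_comm' (t' := Finset.range n) (s' := fun j => Finset.range (j + 1))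
    (by intro i j; simp; omega)]
  simp only [fmacTriangle, Finset.prod_div_distrib, Finset.prod_mul_distrib]

theorem prod_psiCoeff_diag {π : PlanePartition} {n : ℕ} (h : π.InSquare n) :
    ∏ k ∈ Finset.range n, psiCoeff q t (π.diag k) (π.diag (k + 1)) =
      fmacTriangle q t n (π.diag 0) (π.diag 1) /
          fmacTriangle q t n (π.diag 0) (fun i => π.diag 0 (i + 1)) *
        ∏ k ∈ Finset.range n, ∏ i ∈ Finset.range n, Fbox q t π i (i + (k + 1)) := by
  have h0 : ∀ k, π.diag k n = 0 := fun k => h.eq_zero (Or.inl le_rfl)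
  simp only [fun k => psiCoeff_eq_triangle hq0 hq1 ht0 ht1 (π.diag_interlace k) (h0 k),
    prod_Fbox_diag hq0 hq1 ht0 ht1 h]
  have := Finset.prod_range_shift n
    (fun k => fmacTriangle q t n (π.diag k) (π.diag (k + 1)) /
      fmacTriangle q t n (π.diag k) (fun i => π.diag k (i + 1)))
    (fun k => fmacTriangle q t n (π.diag (k + 1)) (fun i => π.diag k (i + 1)) /
      fmacTriangle q t n (π.diag (k + 1)) (π.diag (k + 1)))
    (by simp only [h.diag_eq_nil le_rfl, fmacTriangle_nil, div_one])
  convert this using 1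
  · refine Finset.prod_congr rfl fun k _ => ?_
    rw [div_mul_div_comm, mul_comm (fmacTriangle q t n (π.diag (k + 1)) (π.diag (k + 1)))]
  · congr 1
    refine Finset.prod_congr rfl fun k _ => ?_
    have : (fun i => π.diag k (i + 1)) = fun j => π.part (j + 1) (j + (k + 1)) := by
      funext i
      rw [PlanePartition.diag_apply]
      congr 1
      omega
    rw [this, div_mul_div_comm, mul_comm (fmacTriangle _ _ _ _ _)]
    congr 1
    exact mul_comm _ _

theorem prod_phiCoeff_diag {π : PlanePartition} {n : ℕ} (h : π.InSquare n) :
    ∏ k ∈ Finset.range n, phiCoeff q t (π.diag k) (π.diag (k + 1)) =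
      fmacTriangle q t n (π.diag 0) (π.diag 1) / fmacTriangle q t n (π.diag 0) (π.diag 0) *
        ∏ k ∈ Finset.range n, ∏ i ∈ Finset.range n, Fbox q t π i (i + (k + 1)) := by
  have h0 : ∀ k, π.diag k n = 0 := fun k => h.eq_zero (Or.inl le_rfl)
  simp only [fun k => phiCoeff_eq_triangle hq0 hq1 ht0 ht1 (π.diag_interlace k) (h0 k),
    prod_Fbox_diag hq0 hq1 ht0 ht1 h]
  have := Finset.prod_range_shift n
    (fun k => fmacTriangle q t n (π.diag k) (π.diag (k + 1)) /
      fmacTriangle q t n (π.diag k) (π.diag k))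
    (fun k => fmacTriangle q t n (π.diag (k + 1)) (fun i => π.diag k (i + 1)) /
      fmacTriangle q t n (π.diag (k + 1)) (fun i => π.diag (k + 1) (i + 1)))
    (by simp only [h.diag_eq_nil le_rfl, fmacTriangle_nil, div_one])
  convert this using 1
  · refine Finset.prod_congr rfl fun k _ => ?_
    rw [div_mul_div_comm]
  · congr 1
    refine Finset.prod_congr rfl fun k _ => ?_
    have : (fun i => π.diag k (i + 1)) = fun j => π.part (j + 1) (j + (k + 1)) := by
      funext i
      rw [PlanePartition.diag_apply]
      congr 1
      omega
    rw [this, div_mul_div_comm, mul_comm (fmacTriangle _ _ _ _ _)]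

theorem prod_Fbox_main_diag {π : PlanePartition} {n : ℕ} (h : π.InSquare n) :
    ∏ i ∈ Finset.range n, Fbox q t π i i =
      (fmacTriangle q t n (π.diag 0) (π.diag 1) /
          fmacTriangle q t n (π.diag 0) (fun i => π.diag 0 (i + 1))) *
        (fmacTriangle q t n (π.transpose.diag 0) (π.transpose.diag 1) /
          fmacTriangle q t n (π.transpose.diag 0) (π.transpose.diag 0)) := by
  have := prod_Fbox_diag hq0 hq1 ht0 ht1 h 0
  simp only [add_zero] at this
  rw [this, π.transpose_diag_zero, div_mul_div_comm, zero_add,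
    mul_comm (fmacTriangle q t n (π.diag 0) (fun i => π.diag 0 (i + 1))),
    mul_comm (fmacTriangle q t n (π.diag 0) (π.diag 1))]
  rfl

theorem Fbox_nonneg (π : PlanePartition) (i j : ℕ) : 0 ≤ Fbox q t π i j := by
  obtain ⟨n, hn⟩ := π.exists_inSquare
  have key : ∀ {π : PlanePartition}, π.InSquare n → ∀ i k, 0 ≤ Fbox q t π i (i + k) := by
    intro π hπ i k
    rw [Fbox_diag_eq hq0 hq1 ht0 ht1 hπ]
    have := fun n m => (fmac_pos hq0 hq1 ht0 ht1 n m).le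
    exact Finset.prod_nonneg fun _ _ => div_nonneg (mul_nonneg (this _ _) (this _ _))
      (mul_nonneg (this _ _) (this _ _))
  rcases le_total i j with hij | hij
  · obtain ⟨k, rfl⟩ := Nat.exists_eq_add_of_le hij
    exact key hn i k
  · obtain ⟨k, rfl⟩ := Nat.exists_eq_add_of_le hij
    rw [← Fbox_transpose]
    exact key hn.transpose j k

theorem Fmac_nonneg (π : PlanePartition) : 0 ≤ Fmac q t π := by
  obtain ⟨n, hn⟩ := π.exists_inSquare
  rw [Fmac_eq_prod_square hn]
  exact Finset.prod_nonneg fun _ _ => Finset.prod_nonneg fun _ _ =>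
    Fbox_nonneg hq0 hq1 ht0 ht1 _ _ _

/-- The weight of a plane partition in terms of its diagonals. -/
theorem Fmac_eq_prod_diag {π : PlanePartition} {n : ℕ} (h : π.InSquare n) :
    Fmac q t π = (∏ k ∈ Finset.range n, psiCoeff q t (π.diag k) (π.diag (k + 1))) *
      ∏ k ∈ Finset.range n, phiCoeff q t (π.transpose.diag k) (π.transpose.diag (k + 1)) := by
  rw [Fmac_eq_prod_square h, Finset.prod_square_eq_prod_diag n (Fbox q t π)
    fun i j hij => Fbox_eq_one_of_part_eq_zero (h.eq_zero hij)]
  have h2 : ∏ k ∈ Finset.range n, ∏ i ∈ Finset.range n, Fbox q t π i (i + k) =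
      (∏ i ∈ Finset.range n, Fbox q t π i i) *
        ∏ k ∈ Finset.range n, ∏ i ∈ Finset.range n, Fbox q t π i (i + (k + 1)) := by
    have := Finset.prod_range_succ' (fun k => ∏ i ∈ Finset.range n, Fbox q t π i (i + k)) n
    rw [mul_comm] at this
    simp only [add_zero] at this
    rw [← this, Finset.prod_range_succ, Finset.prod_eq_one (s := Finset.range n)
      (f := fun i => Fbox q t π i (i + n)), mul_one]
    exact fun i _ => Fbox_eq_one_of_part_eq_zero (h.eq_zero (Or.inr (by omega)))
  rw [h2, prod_psiCoeff_diag hq0 hq1 ht0 ht1 h,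
    prod_phiCoeff_diag hq0 hq1 ht0 ht1 h.transpose, prod_Fbox_main_diag hq0 hq1 ht0 ht1 h]
  simp only [Fbox_transpose]
  ring

omit hq0 hq1 ht0 ht1

theorem pow_weight_eq {M : Type*} [CommMonoid M] (s : M) {π : PlanePartition} {n : ℕ}
    (h : π.InSquare n) :
    s ^ π.weight = (∏ k ∈ Finset.range n, s ^ (π.diag k).size) *
      ∏ k ∈ Finset.range n, s ^ (π.transpose.diag (k + 1)).size := by
  have hw : π.weight = ∑ i ∈ Finset.range n, ∑ j ∈ Finset.range n, π.part i j := by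
    rw [PlanePartition.weight, finsum_eq_sum_of_support_subset
      (s := Finset.range n ×ˢ Finset.range n), Finset.sum_product]
    intro p hp
    simp only [Finset.coe_product, Finset.coe_range, Set.mem_prod, Set.mem_Iio]
    by_contra hcon
    exact hp (h.eq_zero (by omega))
  rw [hw]
  simp only [← Finset.prod_pow_eq_pow_sum]
  rw [Finset.prod_square_eq_prod_diag n (fun i j => s ^ π.part i j)
    fun i j hij => by rw [h.eq_zero hij, pow_zero]]
  congr 1
  · refine Finset.prod_congr rfl fun k _ => ?_
    rw [(π.diag k).size_eq (N := n) (h.eq_zero (Or.inl le_rfl)), ← Finset.prod_pow_eq_pow_sum]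
    rfl
  · refine Finset.prod_congr rfl fun k _ => ?_
    rw [(π.transpose.diag (k + 1)).size_eq (N := n) (h.transpose.eq_zero (Or.inl le_rfl)),
      ← Finset.prod_pow_eq_pow_sum]
    rfl

end values

section square

variable {q t : ℝ} (hq0 : 0 ≤ q) (hq1 : q < 1) (ht0 : 0 ≤ t) (ht1 : t < 1) (s : ℝ≥0∞)
include hq0 hq1 ht0 ht1

theorem prod_psiE_mul_prod_phiE_diag {π : PlanePartition} {n : ℕ} (h : π.InSquare n) :
    (∏ k ∈ Finset.range n, s ^ (π.diag k).size * psiE q t (π.diag k) (π.diag (k + 1))) *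
      (∏ k ∈ Finset.range n, phiE q t (π.transpose.diag k) (π.transpose.diag (k + 1)) *
        s ^ (π.transpose.diag (k + 1)).size) =
      ENNReal.ofReal (Fmac q t π) * s ^ π.weight := by
  have h1 := psiCoeff_nonneg hq0 hq1 ht0 ht1
  have h2 := phiCoeff_nonneg hq0 hq1 ht0 ht1
  rw [Fmac_eq_prod_diag hq0 hq1 ht0 ht1 h, pow_weight_eq s h,
    ENNReal.ofReal_mul (Finset.prod_nonneg fun _ _ => h1 _ _),
    ENNReal.ofReal_prod_of_nonneg fun _ _ => h1 _ _,
    ENNReal.ofReal_prod_of_nonneg fun _ _ => h2 _ _, Finset.prod_mul_distrib,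
    Finset.prod_mul_distrib]
  simp only [psiE, phiE]
  ring

/-- The generating function of plane partitions with support in a square. -/
theorem tsum_inSquare (n : ℕ) :
    ∑' π : {π : PlanePartition // π.InSquare n}, ENNReal.ofReal (Fmac q t π) * s ^ π.1.weight =
      ∏ k ∈ Finset.range n, ∏ j ∈ Finset.range n, qbinomSeries q t (s ^ k * s ^ (j + 1)) := by
  have hZ := tsum_kernelIter_mul_kernelIter hq0 hq1 ht0 ht1 s n n 1
  simp only [one_pow, one_mul] at hZ
  rw [← hZ]
  simp only [kernelIter_eq_tsum, ← ENNReal.tsum_mul_right]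
  simp only [← ENNReal.tsum_mul_left]
  simp only [← ENNReal.tsum_prod]
  rw [← ENNReal.tsum_sigma fun (l : Partn) (p : Chain n l × Chain n l) =>
    (∏ i ∈ Finset.range n, s ^ (p.1.1 i).size * psiE q t (p.1.1 i) (p.1.1 (i + 1))) *
      ∏ i ∈ Finset.range n, phiE q t (p.2.1 i) (p.2.1 (i + 1)) * s ^ (p.2.1 (i + 1)).size]
  let g : {π : PlanePartition // π.InSquare n} → Σ a : Partn, Chain n a × Chain n a := fun π =>
    ⟨π.1.diag 0, ⟨π.1.diag, rfl, fun _ hi => π.2.diag_eq_nil hi⟩,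
      ⟨π.1.transpose.diag, π.1.transpose_diag_zero, fun _ hi => π.2.transpose.diag_eq_nil hi⟩⟩
  have hg : Function.Injective g := by
    intro π ρ h
    have h1 : π.1.diag = ρ.1.diag := congrArg (fun x => x.2.1.1) h
    have h2 : π.1.transpose.diag = ρ.1.transpose.diag := congrArg (fun x => x.2.2.1) h
    exact Subtype.ext (PlanePartition.ext_diag (congrFun h1) (congrFun h2))
  rw [← hg.tsum_eq]
  · exact tsum_congr fun π => (prod_psiE_mul_prod_phiE_diag hq0 hq1 ht0 ht1 s π.2).symm
  · rintro ⟨a, ⟨c, rfl, hc⟩, d, hd0, hd⟩ hx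
    rw [Function.mem_support] at hx
    have hψ : ∀ k, (c k).Interlace (c (k + 1)) := by
      intro k
      by_cases hk : k < n
      · have := Finset.prod_ne_zero_iff.1 (left_ne_zero_of_mul hx) k (Finset.mem_range.2 hk)
        refine interlace_of_psiCoeff_ne_zero (q := q) (t := t) fun h => right_ne_zero_of_mul this ?_
        rw [psiE, h, ENNReal.ofReal_zero]
      · rw [hc k (by omega), hc (k + 1) (by omega)]
        exact fun _ => ⟨le_rfl, le_rfl⟩
    have hφ : ∀ k, (d k).Interlace (d (k + 1)) := by
      intro k
      by_cases hk : k < n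
      · have := Finset.prod_ne_zero_iff.1 (right_ne_zero_of_mul hx) k (Finset.mem_range.2 hk)
        refine interlace_of_phiCoeff_ne_zero (q := q) (t := t) fun h => left_ne_zero_of_mul this ?_
        rw [phiE, h, ENNReal.ofReal_zero]
      · rw [hd k (by omega), hd (k + 1) (by omega)]
        exact fun _ => ⟨le_rfl, le_rfl⟩
    obtain ⟨π, hπ, h1, h2⟩ := PlanePartition.exists_diag_eq n hd0.symm hψ hφ (hc n le_rfl)
      (hd n le_rfl)
    obtain rfl := funext h1
    obtain rfl := funext h2
    exact ⟨⟨π, hπ⟩, rfl⟩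

end square

section limit

variable {q t s : ℝ} (hq0 : 0 ≤ q) (hq1 : q < 1) (ht0 : 0 ≤ t) (ht1 : t < 1) (hs0 : 0 ≤ s)
  (hs1 : s < 1)
include hq0 hq1 ht0 ht1

theorem qbinomSeries_ofReal {z : ℝ} (hz0 : 0 ≤ z) (hz1 : z < 1) :
    qbinomSeries q t (ENNReal.ofReal z) = ENNReal.ofReal (qPoch (t * z) q / qPoch z q) := by
  have h0 : ∀ n, 0 ≤ qbinom q t n := fun n => (qbinom_pos hq0 hq1 ht0 ht1 n).le
  rw [← tsum_qbinom hq0 hq1 ht0 ht1 hz0 hz1, ENNReal.ofReal_tsum_of_nonneg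
    (fun n => mul_nonneg (h0 n) (pow_nonneg hz0 n)) (summable_qbinom hq0 hq1 ht0 ht1 hz0 hz1),
    qbinomSeries]
  refine tsum_congr fun n => ?_
  rw [ENNReal.ofReal_mul (h0 n), ENNReal.ofReal_pow hz0]

theorem one_le_qPoch_div {z : ℝ} (hz0 : 0 ≤ z) (hz1 : z < 1) :
    1 ≤ qPoch (t * z) q / qPoch z q := by
  rw [← tsum_qbinom hq0 hq1 ht0 ht1 hz0 hz1]
  refine le_trans ?_ ((summable_qbinom hq0 hq1 ht0 ht1 hz0 hz1).le_tsum 0 fun n _ =>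
    mul_nonneg (qbinom_pos hq0 hq1 ht0 ht1 n).le (pow_nonneg hz0 n))
  rw [qbinom_zero, pow_zero, one_mul]

include hs0 hs1

theorem qPoch_div_sub_one_le (k : ℕ) :
    qPoch (t * s ^ (k + 1)) q / qPoch (s ^ (k + 1)) q - 1 ≤
      s ^ k * (qPoch (t * s) q / qPoch s q - 1) := by
  have hk0 : 0 ≤ s ^ (k + 1) := pow_nonneg hs0 _
  have hk1 : s ^ (k + 1) < 1 := pow_lt_one₀ hs0 hs1 (Nat.succ_ne_zero k)
  have h1 := summable_qbinom hq0 hq1 ht0 ht1 hk0 hk1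
  have h2 := summable_qbinom hq0 hq1 ht0 ht1 hs0 hs1
  rw [← tsum_qbinom hq0 hq1 ht0 ht1 hk0 hk1, ← tsum_qbinom hq0 hq1 ht0 ht1 hs0 hs1,
    h1.tsum_eq_zero_add, h2.tsum_eq_zero_add, qbinom_zero, pow_zero, pow_zero, mul_one,
    add_sub_cancel_left, add_sub_cancel_left, ← tsum_mul_left]
  refine Summable.tsum_le_tsum (fun n => ?_) ((summable_nat_add_iff 1).2 h1)
    (((summable_nat_add_iff 1).2 h2).mul_left _)
  have h3 : (s ^ (k + 1)) ^ (n + 1) ≤ s ^ k * s ^ (n + 1) := by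
    rw [← pow_mul, ← pow_add]
    exact pow_le_pow_of_le_one hs0 hs1.le (by nlinarith [Nat.zero_le (k * n)])
  rw [mul_left_comm]
  exact mul_le_mul_of_nonneg_left h3 (qbinom_pos hq0 hq1 ht0 ht1 _).le

theorem multipliable_qPoch_div_pow :
    Multipliable fun n : ℕ => (qPoch (t * s ^ (n + 1)) q / qPoch (s ^ (n + 1)) q) ^ (n + 1) := by
  have h1 : ∀ k : ℕ, 1 ≤ qPoch (t * s ^ (k + 1)) q / qPoch (s ^ (k + 1)) q := fun k =>
    one_le_qPoch_div hq0 hq1 ht0 ht1 (pow_nonneg hs0 _) (pow_lt_one₀ hs0 hs1 (Nat.succ_ne_zero k))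
  have hsum : Summable fun k : ℕ => ((k : ℝ) + 1) * s ^ k := by
    have := (summable_pow_mul_geometric_of_norm_lt_one 1 (r := s)
      (by rwa [Real.norm_of_nonneg hs0])).add (summable_geometric_of_lt_one hs0 hs1)
    simpa only [pow_one, add_mul, one_mul] using this
  refine Real.multipliable_of_summable_log (fun k => pow_pos (one_pos.trans_le (h1 k)) _) ?_
  refine Summable.of_nonneg_of_le (fun k => Real.log_nonneg (one_le_pow₀ (h1 k))) (fun k => ?_)
    (hsum.mul_right (qPoch (t * s) q / qPoch s q - 1))
  rw [Real.log_pow, mul_assoc]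
  push_cast
  exact mul_le_mul_of_nonneg_left ((Real.log_le_sub_one_of_pos (one_pos.trans_le (h1 k))).trans
    (qPoch_div_sub_one_le hq0 hq1 ht0 ht1 hs0 hs1 k)) (by positivity)

omit hq0 hq1 ht0 ht1 hs0 hs1

theorem prod_pow_succ_eq {M : Type*} [CommMonoid M] (f : ℕ → M) (n : ℕ) :
    ∏ m ∈ Finset.range n, f m ^ (m + 1) =
      ∏ k ∈ Finset.range n, ∏ j ∈ Finset.range (n - k), f (k + j) := by
  have h : ∀ m ∈ Finset.range n, f m ^ (m + 1) = ∏ _k ∈ Finset.range (m + 1), f m := by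
    intro m _
    rw [Finset.prod_const, Finset.card_range]
  rw [Finset.prod_congr rfl h, Finset.prod_comm' (t' := Finset.range n)
    (s' := fun k => Finset.Ico k n) (by intro i j; simp; omega)]
  exact Finset.prod_congr rfl fun k _ => Finset.prod_Ico_eq_prod_range _ _ _

theorem prod_pow_succ_le_prod_square {f : ℕ → ℝ≥0∞} (hf : ∀ m, 1 ≤ f m) (n : ℕ) :
    ∏ m ∈ Finset.range n, f m ^ (m + 1) ≤
      ∏ k ∈ Finset.range n, ∏ j ∈ Finset.range n, f (k + j) := by
  rw [prod_pow_succ_eq]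
  exact Finset.prod_le_prod' fun k _ => Finset.prod_le_prod_of_subset_of_one_le'
    (Finset.range_mono (Nat.sub_le _ _)) fun _ _ _ => hf _

theorem prod_square_le_prod_pow_succ {f : ℕ → ℝ≥0∞} (hf : ∀ m, 1 ≤ f m) (n : ℕ) :
    ∏ k ∈ Finset.range n, ∏ j ∈ Finset.range n, f (k + j) ≤
      ∏ m ∈ Finset.range (n + n), f m ^ (m + 1) := by
  rw [prod_pow_succ_eq]
  refine (Finset.prod_le_prod' fun k hk => ?_).trans
    (Finset.prod_le_prod_of_subset_of_one_le' (Finset.range_mono (Nat.le_add_right n n))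
      fun k _ _ => Finset.one_le_prod' fun _ _ => hf _)
  rw [Finset.mem_range] at hk
  exact Finset.prod_le_prod_of_subset_of_one_le' (Finset.range_mono (by omega)) fun _ _ _ => hf _

include hq0 hq1 ht0 ht1 hs0 hs1

theorem tsum_ofReal_Fmac :
    ∑' π : PlanePartition, ENNReal.ofReal (Fmac q t π * s ^ π.weight) =
      ENNReal.ofReal
        (∏' n : ℕ, (qPoch (t * s ^ (n + 1)) q / qPoch (s ^ (n + 1)) q) ^ (n + 1)) := by
  set r : ℕ → ℝ := fun k => qPoch (t * s ^ (k + 1)) q / qPoch (s ^ (k + 1)) q with hr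
  have hr1 : ∀ k, 1 ≤ r k := fun k =>
    one_le_qPoch_div hq0 hq1 ht0 ht1 (pow_nonneg hs0 _) (pow_lt_one₀ hs0 hs1 (Nat.succ_ne_zero k))
  have hr0 : ∀ k, 0 ≤ r k := fun k => zero_le_one.trans (hr1 k)
  have hf1 : ∀ k, 1 ≤ ENNReal.ofReal (r k) := fun k => ENNReal.one_le_ofReal.2 (hr1 k)
  have hlim : Filter.Tendsto (fun n => ∏ k ∈ Finset.range n, r k ^ (k + 1)) Filter.atTop
      (nhds (∏' k, r k ^ (k + 1))) :=
    (multipliable_qPoch_div_pow hq0 hq1 ht0 ht1 hs0 hs1).hasProd.tendsto_prod_nat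
  have hmono : Monotone fun n => ∏ k ∈ Finset.range n, r k ^ (k + 1) :=
    monotone_nat_of_le_succ fun n => by
      rw [Finset.prod_range_succ]
      exact le_mul_of_one_le_right (Finset.prod_nonneg fun k _ => pow_nonneg (hr0 k) _)
        (one_le_pow₀ (hr1 n))
  have hcoe : ∀ n, ENNReal.ofReal (∏ k ∈ Finset.range n, r k ^ (k + 1)) =
      ∏ k ∈ Finset.range n, ENNReal.ofReal (r k) ^ (k + 1) := fun n => by
    rw [ENNReal.ofReal_prod_of_nonneg fun k _ => pow_nonneg (hr0 k) _]
    exact Finset.prod_congr rfl fun k _ => ENNReal.ofReal_pow (hr0 k) _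
  have hsq : ∀ n, ∑' π : {π : PlanePartition // π.InSquare n},
      ENNReal.ofReal (Fmac q t π * s ^ π.1.weight) =
      ∏ k ∈ Finset.range n, ∏ j ∈ Finset.range n, ENNReal.ofReal (r (k + j)) := by
    intro n
    simp only [ENNReal.ofReal_mul (Fmac_nonneg hq0 hq1 ht0 ht1 _), ENNReal.ofReal_pow hs0]
    rw [tsum_inSquare hq0 hq1 ht0 ht1]
    refine Finset.prod_congr rfl fun k _ => Finset.prod_congr rfl fun j _ => ?_
    rw [← pow_add, ← ENNReal.ofReal_pow hs0, ← add_assoc, qbinomSeries_ofReal hq0 hq1 ht0 ht1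
      (pow_nonneg hs0 _) (pow_lt_one₀ hs0 hs1 (Nat.succ_ne_zero _))]
  refine le_antisymm ?_ ?_
  · rw [ENNReal.tsum_eq_iSup_sum]
    refine iSup_le fun S => ?_
    classical
    obtain ⟨n, hn⟩ : ∃ n, ∀ π ∈ S, PlanePartition.InSquare π n := by
      choose N hN using PlanePartition.exists_inSquare
      exact ⟨S.sup N, fun π hπ => (hN π).mono (Finset.le_sup hπ)⟩
    calc ∑ π ∈ S, ENNReal.ofReal (Fmac q t π * s ^ π.weight)
        = ∑ π ∈ S.subtype (PlanePartition.InSquare · n),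
            ENNReal.ofReal (Fmac q t π * s ^ π.1.weight) :=
          (Finset.sum_subtype_of_mem _ hn).symm
      _ ≤ _ := ENNReal.sum_le_tsum _
      _ ≤ ENNReal.ofReal (∏ k ∈ Finset.range (n + n), r k ^ (k + 1)) := by
        rw [hsq, hcoe]
        exact prod_square_le_prod_pow_succ hf1 n
      _ ≤ _ := ENNReal.ofReal_le_ofReal (hmono.ge_of_tendsto hlim _)
  · refine le_of_tendsto' (ENNReal.tendsto_ofReal hlim) fun n => ?_
    rw [hcoe]
    refine (prod_pow_succ_le_prod_square hf1 n).trans ?_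
    rw [← hsq]
    exact ENNReal.tsum_comp_le_tsum_of_injective Subtype.val_injective _

end limit

/-- **Generalized MacMahon's formula (Macdonald's case, full version).**
`∑_{π ∈ P} F_π(q,t) s^{|π|} = ∏_{n=1}^{∞} [ (t sⁿ; q)_∞ / (sⁿ; q)_∞ ]ⁿ`,
the sum being over all plane partitions, for real `0 ≤ q, t, s < 1`. -/
theorem generalized_macmahon_macdonald
    (q t s : ℝ) (hq0 : 0 ≤ q) (hq1 : q < 1) (ht0 : 0 ≤ t) (ht1 : t < 1)
    (hs0 : 0 ≤ s) (hs1 : s < 1) :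
    ∑' π : PlanePartition, Fmac q t π * s ^ π.weight =
      ∏' n : ℕ, (qPoch (t * s ^ (n + 1)) q / qPoch (s ^ (n + 1)) q) ^ (n + 1) := by
  have h := congrArg ENNReal.toReal (tsum_ofReal_Fmac hq0 hq1 ht0 ht1 hs0 hs1)
  rw [ENNReal.tsum_toReal_eq fun _ => ENNReal.ofReal_ne_top, ENNReal.toReal_ofReal] at h
  · rw [← h]
    exact tsum_congr fun π => (ENNReal.toReal_ofReal (mul_nonneg
      (Fmac_nonneg hq0 hq1 ht0 ht1 π) (pow_nonneg hs0 _))).symm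
  · refine ge_of_tendsto'
      (multipliable_qPoch_div_pow hq0 hq1 ht0 ht1 hs0 hs1).hasProd.tendsto_prod_nat fun n =>
        Finset.prod_nonneg fun k _ => pow_nonneg (zero_le_one.trans ?_) _
    exact one_le_qPoch_div hq0 hq1 ht0 ht1 (pow_nonneg hs0 _)
      (pow_lt_one₀ hs0 hs1 (Nat.succ_ne_zero k))
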